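/- arXiv:2508.19125 — 2 statements merged into one kernel-verified Lean document; each statement's English description precedes it below -/
import Mathlib

section
/- Let β > 0 with β ≠ −G(e) for every zero e of h, suppose D is differentiable at β, set ū := 2D(β), and let (u, θ) be a stationary solution with −G(θ(1/2)) = β. Let p0 := g(θ(0))u′(0) (so p0 > 0 and g(θ(x))u′(x) = p0 for all x ∈ [0,1]). Let Z1, Z2 : [0,1] → ℝ⁴ be C¹ solutions of Z′(x) = A(x)Z(x) with Z1(0) = (0,1,0,0) and Z2(0) = (0,0,0,1). Then the determinant of the 4×4 matrix with columns Z1(1), Z2(1), (0,1,0,0), (0,0,0,1) equals −(2β/(p0·c(θ0)²))·D′(β). -/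
open Real Set Filter MeasureTheory

/-- A stationary solution of the shear-flow boundary value problem: a pair of C²
functions `(u, θ)` satisfying `(g(θ)u′)′ = 0` and `c(θ)(c(θ)θ′)′ − h(θ)u′ = 0` on
`[0,1]`, with `u(0) = 0`, `u(1) = ū`, `θ(0) = θ(1) = θ0`. -/
def IsStationarySolution (g h c : ℝ → ℝ) (θ0 ub : ℝ) (u th : ℝ → ℝ) : Prop :=
  ContDiff ℝ 2 u ∧ ContDiff ℝ 2 th ∧
  (∀ x ∈ Set.Icc (0:ℝ) 1, deriv (fun y => g (th y) * deriv u y) x = 0) ∧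
  (∀ x ∈ Set.Icc (0:ℝ) 1,
    c (th x) * deriv (fun y => c (th y) * deriv th y) x - h (th x) * deriv u x = 0) ∧
  u 0 = 0 ∧ u 1 = ub ∧ th 0 = θ0 ∧ th 1 = θ0


lemma param_deriv {Φ Φ' : ℝ → ℝ → ℝ} {β ε a b : ℝ} (hε : 0 < ε) (hab : a ≤ b)
    (hd : ∀ z ∈ Icc (β - ε) (β + ε), ∀ s ∈ Icc a b, HasDerivAt (fun z => Φ z s) (Φ' z s) z)
    (hc : ∀ z ∈ Icc (β - ε) (β + ε), ContinuousOn (Φ z) (Icc a b))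
    (hc' : ContinuousOn (Function.uncurry Φ') (Icc (β - ε) (β + ε) ×ˢ Icc a b)) :
    HasDerivAt (fun z => ∫ s in a..b, Φ z s) (∫ s in a..b, Φ' β s) β := by
  obtain ⟨C, hC⟩ := (isCompact_Icc.prod isCompact_Icc).exists_bound_of_continuousOn hc'
  have hβ : β ∈ Icc (β - ε) (β + ε) := ⟨by linarith, by linarith⟩
  have hsub : uIoc a b ⊆ Icc a b := by rw [uIoc_of_le hab]; exact Ioc_subset_Icc_self
  refine (intervalIntegral.hasDerivAt_integral_of_dominated_loc_of_deriv_le (F := Φ) (F' := Φ')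
    (s := Icc (β - ε) (β + ε)) (bound := fun _ => C)
    (Icc_mem_nhds (by linarith) (by linarith)) ?_ ?_ ?_ ?_ ?_ ?_).2
  · filter_upwards [Icc_mem_nhds (show β - ε < β by linarith) (show β < β + ε by linarith)] with z hz
    exact ((hc z hz).mono hsub).aestronglyMeasurable measurableSet_uIoc
  · apply ContinuousOn.intervalIntegrable
    rw [uIcc_of_le hab]; exact hc β hβ
  · have : ContinuousOn (Φ' β) (Icc a b) := by
      have := hc'.comp (f := fun s => (β, s)) (s := Icc a b) (by fun_prop) (fun s hs => ⟨hβ, hs⟩)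
      exact this
    exact (this.mono hsub).aestronglyMeasurable measurableSet_uIoc
  · exact Eventually.of_forall fun s hs z hz => hC (z, s) ⟨hz, hsub hs⟩
  · exact intervalIntegrable_const
  · exact Eventually.of_forall fun s hs z hz => hd z hz s (hsub hs)

lemma subst_set {s N : Set ℝ} (hs : MeasurableSet s) (hN : N.Countable) {T T' k k' : ℝ → ℝ} {l r : ℝ}
    (hT : ∀ x ∈ s, HasDerivWithinAt T (T' x) s x) (hi : InjOn T s) (him : T '' s = Ioo l r)
    (hk : ∀ x ∈ s, x ∉ N → |T' x| * k (T x) = k' x) :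
    (∫ t in Ioo l r, k t) = (∫ x in s, k' x) ∧ (IntegrableOn k' s → IntegrableOn k (Ioo l r)) := by
  have hae : (fun x => |T' x| • k (T x)) =ᵐ[volume.restrict s] k' := by
    have h1 : ∀ᵐ x ∂(volume.restrict s), x ∉ N :=
      ae_restrict_of_ae (hN.ae_notMem _)
    filter_upwards [h1, ae_restrict_mem hs] with x hx hxs
    exact hk x hxs hx
  constructor
  · rw [← him, integral_image_eq_integral_abs_deriv_smul hs hT hi]
    exact integral_congr_ae hae
  · intro h
    rw [← him, integrableOn_image_iff_integrableOn_abs_deriv_smul hs hT hi]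
    exact (integrable_congr hae).2 h

lemma J_split {q ρ G F f : ℝ → ℝ} {θ0 θ1 b : ℝ}
    (hGd : ∀ θ, HasDerivAt G (ρ θ) θ) (hGm : StrictMono G)
    (hF : Function.LeftInverse F G)
    (hF' : Function.RightInverse F G) (hρ : {θ | ρ θ = 0}.Countable) (hρ0 : ∀ θ, 0 ≤ ρ θ)
    (hq : Continuous q) (hG0 : G θ0 = 0) (hθ1 : θ1 < θ0) (hb : -G θ1 < b)
    (hf : ∀ s, f s = q (F s) / ρ (F s))
    (hfc : ContinuousOn f (Icc (-b) (G θ1))) :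
    (∫ t in (0:ℝ)..b, f (t - b) / √t) =
      2 * √(b + G θ1) * (∫ σ in (0:ℝ)..1, f (G θ1 - (b + G θ1) * (1 - σ ^ 2)))
       + ∫ θ in θ1..θ0, q θ / √(G θ + b) := by
  have hG1 : G θ1 < 0 := hG0 ▸ hGm hθ1
  set B := b + G θ1 with hB
  have hBpos : 0 < B := by linarith
  have hb0 : 0 < b := by linarith
  have hGc : Continuous G := continuous_iff_continuousAt.2 fun x => (hGd x).continuousAt
  -- first part
  have him1 : (fun σ : ℝ => B * σ ^ 2) '' Ioo 0 1 = Ioo 0 B := by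
    ext t; constructor
    · rintro ⟨σ, ⟨h0, h1⟩, rfl⟩
      have : σ ^ 2 < 1 := by nlinarith
      exact ⟨by positivity, by nlinarith⟩
    · rintro ⟨h0, h1⟩
      refine ⟨√(t / B), ⟨by positivity, ?_⟩, ?_⟩
      · rw [Real.sqrt_lt' one_pos, div_lt_iff₀ hBpos]; linarith
      · simp only
        rw [Real.sq_sqrt (by positivity)]; field_simp
  have p1 := subst_set (s := Ioo 0 1) (N := ∅) measurableSet_Ioo countable_empty
    (T := fun σ => B * σ ^ 2) (T' := fun σ => B * (2 * σ)) (k := fun t => f (t - b) / √t)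
    (k' := fun σ => 2 * √B * f (G θ1 - B * (1 - σ ^ 2))) (l := 0) (r := B)
    (by
      intro x _
      have := ((hasDerivAt_pow 2 x).const_mul B).hasDerivWithinAt (s := Ioo 0 1)
      simpa using this)
    (by
      intro x hx y hy hxy
      have h1 : x ^ 2 = y ^ 2 := mul_left_cancel₀ hBpos.ne' hxy
      exact (pow_left_inj₀ hx.1.le hy.1.le two_ne_zero).1 h1)
    him1
    (by
      intro x hx _
      have hx0 := hx.1
      have e1 : B * x ^ 2 - b = G θ1 - B * (1 - x ^ 2) := by rw [hB]; ring
      have e2 : √(B * x ^ 2) = √B * x := by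
        rw [Real.sqrt_mul hBpos.le, Real.sqrt_sq hx0.le]
      have e3 : √B * √B = B := Real.mul_self_sqrt hBpos.le
      have e4 : 0 < √B := Real.sqrt_pos.2 hBpos
      simp only [e1, e2]
      rw [abs_of_pos (by positivity)]
      field_simp
      rw [Real.sq_sqrt hBpos.le]; ring)
  have him2 : (fun θ : ℝ => G θ + b) '' Ioo θ1 θ0 = Ioo B b := by
    ext t; constructor
    · rintro ⟨θ, ⟨h0, h1⟩, rfl⟩
      have := hGm h0; have := hGm h1
      constructor <;> simp only <;> linarith
    · rintro ⟨h0, h1⟩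
      have := hF' (t - b)
      refine ⟨F (t - b), ⟨?_, ?_⟩, ?_⟩
      · rw [← hGm.lt_iff_lt, this]; linarith
      · rw [← hGm.lt_iff_lt, this]; linarith
      · simp only [this]; ring
  have p2 := subst_set (s := Ioo θ1 θ0) (N := {θ | ρ θ = 0}) measurableSet_Ioo hρ
    (T := fun θ => G θ + b) (T' := ρ) (k := fun t => f (t - b) / √t)
    (k' := fun θ => q θ / √(G θ + b)) (l := B) (r := b)
    (fun x _ => ((hGd x).add_const b).hasDerivWithinAt)
    (fun x _ y _ hxy => hGm.injective (by simpa using hxy))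
    him2
    (by
      intro x hx hxN
      have hx' : ρ x ≠ 0 := hxN
      rw [abs_of_nonneg (hρ0 x)]
      simp only [add_sub_cancel_right, hf, hF x]
      field_simp)
  have c1 : ContinuousOn (fun σ => 2 * √B * f (G θ1 - B * (1 - σ ^ 2))) (Icc 0 1) := by
    refine continuousOn_const.mul (hfc.comp (by fun_prop) ?_)
    intro σ hσ
    have h1 : σ ^ 2 ≤ 1 := by have := hσ.1; have := hσ.2; nlinarith
    have h2 : 0 ≤ σ ^ 2 := sq_nonneg σ
    constructor <;> nlinarith
  have c2 : ContinuousOn (fun θ => q θ / √(G θ + b)) (Icc θ1 θ0) := by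
    refine hq.continuousOn.div (by fun_prop) ?_
    intro θ hθ
    have := hGm.monotone hθ.1
    exact (Real.sqrt_pos.2 (by linarith)).ne'
  have i1 := p1.2 (c1.integrableOn_Icc.mono_set Ioo_subset_Icc_self)
  have i2 := p2.2 (c2.integrableOn_Icc.mono_set Ioo_subset_Icc_self)
  have hBb : B ≤ b := by linarith
  rw [← intervalIntegral.integral_add_adjacent_intervals (b := B)
    ((intervalIntegrable_iff_integrableOn_Ioo_of_le hBpos.le).2 i1)
    ((intervalIntegrable_iff_integrableOn_Ioo_of_le hBb).2 i2)]
  congr 1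
  · rw [intervalIntegral.integral_of_le hBpos.le, integral_Ioc_eq_integral_Ioo, p1.1,
      ← integral_Ioc_eq_integral_Ioo, ← intervalIntegral.integral_of_le zero_le_one,
      intervalIntegral.integral_const_mul]
  · rw [intervalIntegral.integral_of_le hBb, integral_Ioc_eq_integral_Ioo, p2.1,
      ← integral_Ioc_eq_integral_Ioo, ← intervalIntegral.integral_of_le hθ1.le]

lemma J_deriv {q ρ G F f f' : ℝ → ℝ} {θ0 θ1 β η : ℝ}
    (hGd : ∀ θ, HasDerivAt G (ρ θ) θ) (hGm : StrictMono G)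
    (hF : Function.LeftInverse F G)
    (hF' : Function.RightInverse F G) (hρ : {θ | ρ θ = 0}.Countable) (hρ0 : ∀ θ, 0 ≤ ρ θ)
    (hq : Continuous q) (hG0 : G θ0 = 0) (hθ1 : θ1 < θ0) (hβ : -G θ1 < β) (hη : 0 < η)
    (hf : ∀ s, f s = q (F s) / ρ (F s))
    (hfd : ∀ s ∈ Icc (-β - η) (G θ1), HasDerivAt f (f' s) s)
    (hfc' : ContinuousOn f' (Icc (-β - η) (G θ1))) :
    HasDerivAt (fun b => ∫ t in (0:ℝ)..b, f (t - b) / √t)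
      (f (G θ1) / √(β + G θ1)
        - 2 * √(β + G θ1) * (∫ σ in (0:ℝ)..1, f' (G θ1 - (β + G θ1) * (1 - σ ^ 2)))
        - (∫ θ in θ1..θ0, q θ / √(G θ + β) ^ 3) / 2) β := by
  have hGc : Continuous G := continuous_iff_continuousAt.2 fun x => (hGd x).continuousAt
  have hfc : ContinuousOn f (Icc (-β - η) (G θ1)) :=
    fun s hs => (hfd s hs).continuousAt.continuousWithinAt
  set B := β + G θ1 with hB
  have hBpos : 0 < B := by linarith
  obtain ⟨ε, hε, hεη, hεB⟩ : ∃ ε, 0 < ε ∧ ε ≤ η ∧ ε < B :=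
    ⟨min η (B / 2), by positivity, min_le_left _ _, (min_le_right _ _).trans_lt (by linarith)⟩
  have hmem : ∀ b ∈ Icc (β - ε) (β + ε), ∀ σ ∈ Icc (0:ℝ) 1,
      G θ1 - (b + G θ1) * (1 - σ ^ 2) ∈ Icc (-β - η) (G θ1) := by
    intro b hb σ hσ
    have h1 : σ ^ 2 ≤ 1 := by have := hσ.1; have := hσ.2; nlinarith
    have h2 : 0 ≤ σ ^ 2 := sq_nonneg σ
    have h3 : 0 < b + G θ1 := by have := hb.1; linarith
    have := hb.2
    constructor <;> nlinarith
  have hβm : β ∈ Icc (β - ε) (β + ε) := ⟨by linarith, by linarith⟩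
  -- part 1
  have d1 : HasDerivAt (fun b => ∫ σ in (0:ℝ)..1, f (G θ1 - (b + G θ1) * (1 - σ ^ 2)))
      (∫ σ in (0:ℝ)..1, f' (G θ1 - (β + G θ1) * (1 - σ ^ 2)) * (-(1 - σ ^ 2))) β := by
    refine param_deriv (Φ := fun b σ => f (G θ1 - (b + G θ1) * (1 - σ ^ 2)))
      (Φ' := fun b σ => f' (G θ1 - (b + G θ1) * (1 - σ ^ 2)) * (-(1 - σ ^ 2))) hε zero_le_one ?_ ?_ ?_
    · intro b hb σ hσ
      have h1 : HasDerivAt (fun b : ℝ => G θ1 - (b + G θ1) * (1 - σ ^ 2)) (-(1 - σ ^ 2)) b := by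
        have := (((hasDerivAt_id b).add_const (G θ1)).mul_const (1 - σ ^ 2)).const_sub (G θ1)
        simpa using this
      exact (hfd _ (hmem b hb σ hσ)).comp b h1
    · intro b hb
      exact hfc.comp (by fun_prop) (fun σ hσ => hmem b hb σ hσ)
    · refine ContinuousOn.mul ?_ (by fun_prop)
      exact hfc'.comp (f := fun z : ℝ × ℝ => G θ1 - (z.1 + G θ1) * (1 - z.2 ^ 2))
        (by fun_prop) (fun z hz => hmem z.1 hz.1 z.2 hz.2)
  have d1' : HasDerivAt (fun b => √(b + G θ1)) (1 / (2 * √B)) β := by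
    have := ((hasDerivAt_id β).add_const (G θ1)).sqrt (by simpa using hBpos.ne')
    simpa using this
  -- part 2
  have d2 : HasDerivAt (fun b => ∫ θ in θ1..θ0, q θ / √(G θ + b))
      (∫ θ in θ1..θ0, -(q θ / √(G θ + β) ^ 3 / 2)) β := by
    have hpos : ∀ b ∈ Icc (β - ε) (β + ε), ∀ θ ∈ Icc θ1 θ0, 0 < G θ + b := by
      intro b hb θ hθ
      have := hGm.monotone hθ.1
      have := hb.1
      linarith
    refine param_deriv (Φ := fun b θ => q θ / √(G θ + b))
      (Φ' := fun b θ => -(q θ / √(G θ + b) ^ 3 / 2)) hε hθ1.le ?_ ?_ ?_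
    · intro b hb θ hθ
      have h0 := hpos b hb θ hθ
      have h1 : 0 < √(G θ + b) := Real.sqrt_pos.2 h0
      have := (((hasDerivAt_id b).const_add (G θ)).sqrt h0.ne').fun_inv h1.ne'
      have := this.const_mul (q θ)
      refine this.congr_deriv ?_
      simp only [id]
      field_simp
    · intro b hb
      exact hq.continuousOn.div (by fun_prop) fun θ hθ => (Real.sqrt_pos.2 (hpos b hb θ hθ)).ne'
    · refine ContinuousOn.neg (ContinuousOn.div_const (ContinuousOn.div (by fun_prop) (by fun_prop) ?_) _)
      rintro ⟨b, θ⟩ ⟨hb, hθ⟩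
      exact pow_ne_zero _ (Real.sqrt_pos.2 (hpos b hb θ hθ)).ne'
  have hev : (fun b => ∫ t in (0:ℝ)..b, f (t - b) / √t) =ᶠ[nhds β] fun b =>
      2 * √(b + G θ1) * (∫ σ in (0:ℝ)..1, f (G θ1 - (b + G θ1) * (1 - σ ^ 2)))
       + ∫ θ in θ1..θ0, q θ / √(G θ + b) := by
    filter_upwards [Icc_mem_nhds (show β - ε < β by linarith) (show β < β + ε by linarith)] with b hb
    refine J_split hGd hGm hF hF' hρ hρ0 hq hG0 hθ1 (by have := hb.1; linarith) hf (hfc.mono ?_)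
    exact Icc_subset_Icc_left (by have := hb.2; linarith)
  refine HasDerivAt.congr_of_eventuallyEq ?_ hev
  refine (((d1'.const_mul 2).mul d1).add d2).congr_deriv ?_
  -- integration by parts
  have hc1 : ContinuousOn (fun σ => f (G θ1 - B * (1 - σ ^ 2))) (Icc 0 1) :=
    hfc.comp (by fun_prop) (fun σ hσ => hmem β hβm σ hσ)
  have hc2 : ContinuousOn (fun σ => f' (G θ1 - B * (1 - σ ^ 2))) (Icc 0 1) :=
    hfc'.comp (by fun_prop) (fun σ hσ => hmem β hβm σ hσ)
  have ii1 : IntervalIntegrable (fun σ => f (G θ1 - B * (1 - σ ^ 2))) volume 0 1 :=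
    ContinuousOn.intervalIntegrable (by rwa [uIcc_of_le zero_le_one])
  have ii2 : IntervalIntegrable (fun σ => f' (G θ1 - B * (1 - σ ^ 2))) volume 0 1 :=
    ContinuousOn.intervalIntegrable (by rwa [uIcc_of_le zero_le_one])
  have ii3 : IntervalIntegrable (fun σ => σ ^ 2 * f' (G θ1 - B * (1 - σ ^ 2))) volume 0 1 :=
    ContinuousOn.intervalIntegrable (by
      rw [uIcc_of_le zero_le_one]; exact ContinuousOn.mul (by fun_prop) hc2)
  have ibp : (∫ σ in (0:ℝ)..1, (f (G θ1 - B * (1 - σ ^ 2))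
      + (2 * B) * (σ ^ 2 * f' (G θ1 - B * (1 - σ ^ 2))))) = f (G θ1) := by
    rw [intervalIntegral.integral_eq_sub_of_hasDerivAt (f := fun σ => σ * f (G θ1 - B * (1 - σ ^ 2)))]
    · simp
    · intro σ hσ
      rw [uIcc_of_le zero_le_one] at hσ
      have h1 : HasDerivAt (fun σ : ℝ => G θ1 - B * (1 - σ ^ 2)) (B * (2 * σ)) σ := by
        have := (((hasDerivAt_pow 2 σ).const_sub 1).const_mul B).const_sub (G θ1)
        simpa using this
      have := (hasDerivAt_id σ).mul ((hfd _ (hmem β hβm σ hσ)).comp σ h1)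
      refine this.congr_deriv ?_
      simp only [id, Function.comp, hB]; ring
    · exact ii1.add (ii3.const_mul _)
  rw [intervalIntegral.integral_add ii1 (ii3.const_mul _), intervalIntegral.integral_const_mul] at ibp
  have e1 : (∫ σ in (0:ℝ)..1, f' (G θ1 - B * (1 - σ ^ 2)) * (-(1 - σ ^ 2)))
     = (∫ σ in (0:ℝ)..1, σ ^ 2 * f' (G θ1 - B * (1 - σ ^ 2)))
       - ∫ σ in (0:ℝ)..1, f' (G θ1 - B * (1 - σ ^ 2)) := by
    rw [← intervalIntegral.integral_sub ii3 ii2]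
    congr 1; ext σ; ring
  have e2 : (∫ θ in θ1..θ0, -(q θ / √(G θ + β) ^ 3 / 2))
      = - ((∫ θ in θ1..θ0, q θ / √(G θ + β) ^ 3) / 2) := by
    rw [intervalIntegral.integral_neg, intervalIntegral.integral_div]
  rw [← hB, e1, e2, ← ibp]
  have hs : 0 < √B := Real.sqrt_pos.2 hBpos
  generalize (∫ σ in (0:ℝ)..1, σ ^ 2 * f' (G θ1 - B * (1 - σ ^ 2))) = I3
  generalize (∫ σ in (0:ℝ)..1, f' (G θ1 - B * (1 - σ ^ 2))) = I2
  generalize (∫ σ in (0:ℝ)..1, f (G θ1 - B * (1 - σ ^ 2))) = I1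
  generalize (∫ θ in θ1..θ0, q θ / √(G θ + β) ^ 3) = I4
  have hB2 : B = √B ^ 2 := (Real.sq_sqrt hBpos.le).symm
  generalize √B = r at *
  rw [hB2]
  field_simp
  ring

lemma F_cont {G F : ℝ → ℝ} (hGm : StrictMono G) (hF : Function.LeftInverse F G)
    (hF' : Function.RightInverse F G) : Continuous F := by
  refine Monotone.continuous_of_surjective ?_ hF.surjective
  intro s t hst
  rw [← hGm.le_iff_le, hF' s, hF' t]; exact hst

lemma P_integral {N v r : ℝ → ℝ} {x0 x1 w : ℝ} (h01 : x0 ≤ x1) (hN0 : N x0 = 0) (hv0 : v x0 = 0)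
    (hN : HasDerivAt N 0 x0) (hv : HasDerivAt v w x0) (hw : w ≠ 0)
    (hP : ∀ x ∈ Ioc x0 x1, HasDerivAt (fun x => N x / v x) (r x) x)
    (hr : ContinuousOn r (Icc x0 x1)) :
    ∫ x in x0..x1, r x = N x1 / v x1 := by
  rw [intervalIntegral.integral_eq_sub_of_hasDerivAt_of_le h01 (f := fun x => N x / v x)]
  · simp [hN0]
  · intro x hx
    rcases eq_or_lt_of_le hx.1 with rfl | h
    · refine ContinuousAt.continuousWithinAt ?_
      rw [continuousAt_iff_punctured_nhds]
      have h1 := (hasDerivAt_iff_tendsto_slope.1 hN).div (hasDerivAt_iff_tendsto_slope.1 hv) hw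
      simp only [hN0, zero_div] at h1 ⊢
      refine h1.congr' ?_
      filter_upwards [self_mem_nhdsWithin] with y hy
      have : y - x0 ≠ 0 := sub_ne_zero.2 hy
      simp only [Pi.div_apply, slope_def_field, hN0, hv0, sub_zero]
      field_simp
    · exact (hP x ⟨h, hx.2⟩).continuousAt.continuousWithinAt
  · exact fun x hx => hP x ⟨hx.1, hx.2.le⟩
  · exact ContinuousOn.intervalIntegrable (by rwa [uIcc_of_le h01])

lemma J_main {c ρ κ κ' a a' G F th v E E1 : ℝ → ℝ} {θ0 β p μ : ℝ}
    (hGd : ∀ θ, HasDerivAt G (ρ θ) θ) (hGm : StrictMono G)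
    (hF : Function.LeftInverse F G)
    (hF' : Function.RightInverse F G) (hρ : {θ | ρ θ = 0}.Countable) (hρ0 : ∀ θ, 0 ≤ ρ θ)
    (hc : Continuous c) (hcpos : ∀ θ, 0 < c θ) (hρκ : ∀ θ, ρ θ = κ θ * c θ)
    (hκ : ∀ θ, HasDerivAt κ (κ' θ) θ) (hκ' : Continuous κ')
    (ha : ∀ θ, HasDerivAt a (a' θ) θ) (ha' : Continuous a')
    (hG0 : G θ0 = 0) (hp : 0 < p) (hμ : μ ≠ 0)
    (hth : ∀ x ∈ Icc (1/2:ℝ) 1, HasDerivAt th (v x / c (th x)) x)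
    (hv : ∀ x ∈ Icc (1/2:ℝ) 1, HasDerivAt v (p * κ (th x)) x)
    (hv0 : v (1/2) = 0) (hvpos : ∀ x ∈ Ioc (1/2:ℝ) 1, 0 < v x)
    (hen : ∀ x ∈ Icc (1/2:ℝ) 1, v x ^ 2 = 2 * p * (G (th x) + β))
    (hth1 : th 1 = θ0) (hm : κ (th (1/2)) ≠ 0)
    (hE : ∀ x ∈ Icc (1/2:ℝ) 1, HasDerivAt E (E1 x) x)
    (hW : ∀ x ∈ Icc (1/2:ℝ) 1, v x * E1 x - p * κ (th x) * E x = -μ)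
    (hE1 : E1 (1/2) = 0) :
    HasDerivAt (fun b => ∫ t in (0:ℝ)..b, c (F (t - b)) * a (F (t - b)) / ρ (F (t - b)) / √t)
      (√(2 * p) * (p / μ) * (a θ0 * E 1 / v 1
        - ∫ x in (1/2:ℝ)..1, a' (th x) / c (th x) * E x)) β := by
  have hFc := F_cont hGm hF hF'
  have hGc : Continuous G := continuous_iff_continuousAt.2 fun x => (hGd x).continuousAt
  have hκc : Continuous κ := continuous_iff_continuousAt.2 fun x => (hκ x).continuousAt
  have hac : Continuous a := continuous_iff_continuousAt.2 fun x => (ha x).continuousAt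
  have hthc : ContinuousOn th (Icc (1/2) 1) := fun x hx => (hth x hx).continuousAt.continuousWithinAt
  have hvc : ContinuousOn v (Icc (1/2) 1) := fun x hx => (hv x hx).continuousAt.continuousWithinAt
  have hEc : ContinuousOn E (Icc (1/2) 1) := fun x hx => (hE x hx).continuousAt.continuousWithinAt
  have hcne : ∀ θ, c θ ≠ 0 := fun θ => (hcpos θ).ne'
  have hκ0 : ∀ θ, 0 ≤ κ θ := fun θ => by
    have := hρ0 θ; rw [hρκ] at this; exact nonneg_of_mul_nonneg_left this (hcpos θ)
  have hhalf : (1/2:ℝ) ∈ Icc (1/2:ℝ) 1 := by norm_num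
  have hone : (1:ℝ) ∈ Icc (1/2:ℝ) 1 := by norm_num
  have hthm : StrictMonoOn th (Icc (1/2) 1) := by
    refine strictMonoOn_of_deriv_pos (convex_Icc _ _) hthc ?_
    intro x hx
    rw [interior_Icc] at hx
    rw [(hth x ⟨hx.1.le, hx.2.le⟩).deriv]
    exact div_pos (hvpos x ⟨hx.1, hx.2.le⟩) (hcpos _)
  have hvm : MonotoneOn v (Icc (1/2) 1) := by
    refine monotoneOn_of_deriv_nonneg (convex_Icc _ _) hvc ?_ ?_
    · intro x hx
      rw [interior_Icc] at hx
      exact (hv x ⟨hx.1.le, hx.2.le⟩).differentiableAt.differentiableWithinAt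
    · intro x hx
      rw [interior_Icc] at hx
      rw [(hv x ⟨hx.1.le, hx.2.le⟩).deriv]
      exact mul_nonneg hp.le (hκ0 _)
  set m := th (1/2) with hmdef
  have hGm' : G m = -β := by
    have := hen (1/2) hhalf
    rw [hv0] at this
    have h2 : (2 * p) * (G m + β) = 0 := by rw [← this]; ring
    have := (mul_eq_zero.1 h2).resolve_left (by positivity)
    linarith
  -- choose neighbourhood
  obtain ⟨δ, hδ, hδκ⟩ : ∃ δ > 0, ∀ θ, |θ - m| < δ → κ θ ≠ 0 := by
    have := hκc.continuousAt.eventually_ne hm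
    rw [Metric.eventually_nhds_iff] at this
    obtain ⟨δ, h1, h2⟩ := this
    exact ⟨δ, h1, fun θ hθ => h2 (by rwa [Real.dist_eq])⟩
  obtain ⟨x1, hx1l, hx1r, hx1δ⟩ : ∃ x1, 1/2 < x1 ∧ x1 < 1 ∧ th x1 < m + δ := by
    have h1 : ∀ᶠ x in nhdsWithin (1/2:ℝ) (Ioi (1/2)), th x < m + δ :=
      ((hth _ hhalf).continuousAt.continuousWithinAt).eventually_lt continuousWithinAt_const (by
        rw [← hmdef]; linarith)
    have h2 : ∀ᶠ x in nhdsWithin (1/2:ℝ) (Ioi (1/2)), x ∈ Ioo (1/2:ℝ) 1 :=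
      Ioo_mem_nhdsGT (by norm_num)
    obtain ⟨x, hx⟩ := (h1.and h2).exists
    exact ⟨x, hx.2.1, hx.2.2, hx.1⟩
  have hx1m : x1 ∈ Icc (1/2:ℝ) 1 := ⟨hx1l.le, hx1r.le⟩
  set θ1 := th x1 with hθ1def
  have hmθ1 : m < θ1 := hthm hhalf hx1m hx1l
  have hθ10 : θ1 < θ0 := hth1 ▸ hthm hx1m hone hx1r
  have hκnear : ∀ θ ∈ Icc (m - δ/2) θ1, κ θ ≠ 0 := by
    intro θ hθ
    refine hδκ θ (abs_lt.2 ⟨?_, ?_⟩) <;> linarith [hθ.1, hθ.2]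
  set η := G m - G (m - δ/2) with hηdef
  have hη : 0 < η := by have := hGm (show m - δ/2 < m by linarith); linarith
  have hηs : -β - η = G (m - δ/2) := by rw [hηdef, hGm']; ring
  have hFmem : ∀ s ∈ Icc (-β - η) (G θ1), F s ∈ Icc (m - δ/2) θ1 := by
    intro s hs
    rw [hηs] at hs
    constructor
    · rw [← hGm.le_iff_le, hF' s]; exact hs.1
    · rw [← hGm.le_iff_le, hF' s]; exact hs.2
  have hρne : ∀ θ, κ θ ≠ 0 → ρ θ ≠ 0 := fun θ h => by rw [hρκ]; exact mul_ne_zero h (hcne θ)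
  have hρc : Continuous ρ := by
    have : ρ = fun θ => κ θ * c θ := funext hρκ
    rw [this]; fun_prop
  have hfeq : ∀ s, c (F s) * a (F s) / ρ (F s) = a (F s) / κ (F s) := by
    intro s; rw [hρκ, mul_comm (κ _)]; exact mul_div_mul_left _ _ (hcne _)
  have hfd : ∀ s ∈ Icc (-β - η) (G θ1), HasDerivAt (fun s => c (F s) * a (F s) / ρ (F s))
      ((a' (F s) * κ (F s) - a (F s) * κ' (F s)) / κ (F s) ^ 2 / ρ (F s)) s := by
    intro s hs
    have hk := hκnear _ (hFmem s hs)
    have hFd : HasDerivAt F (ρ (F s))⁻¹ s :=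
      HasDerivAt.of_local_left_inverse hFc.continuousAt (hGd (F s)) (hρne _ hk)
        (Eventually.of_forall hF')
    have := ((ha (F s)).div (hκ (F s)) hk).comp s hFd
    have h2 : (fun s => c (F s) * a (F s) / ρ (F s)) = (a / κ) ∘ F := by
      funext s; rw [hfeq]; rfl
    rw [h2, div_eq_mul_inv _ (ρ (F s))]
    exact this
  have hfc' : ContinuousOn (fun s => (a' (F s) * κ (F s) - a (F s) * κ' (F s)) / κ (F s) ^ 2 / ρ (F s))
      (Icc (-β - η) (G θ1)) := by
    refine ContinuousOn.div (ContinuousOn.div (by fun_prop) (by fun_prop) ?_) (by fun_prop) ?_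
    · intro s hs; exact pow_ne_zero _ (hκnear _ (hFmem s hs))
    · intro s hs; exact hρne _ (hκnear _ (hFmem s hs))
  have hβ1 : -G θ1 < β := by have := hGm hmθ1; linarith
  have key := J_deriv (q := fun θ => c θ * a θ) hGd hGm hF hF' hρ hρ0 (by fun_prop) hG0 hθ10 hβ1 hη
    (fun s => rfl) hfd hfc'
  refine key.congr_deriv ?_
  clear key
  set R := √(2 * p) with hR
  have hRpos : 0 < R := Real.sqrt_pos.2 (by positivity)
  have hR2 : R ^ 2 = 2 * p := Real.sq_sqrt (by positivity)
  have hsq : ∀ x ∈ Icc (1/2:ℝ) 1, √(G (th x) + β) = v x / R := by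
    intro x hx
    have h0 : 0 ≤ v x := by
      rcases eq_or_lt_of_le hx.1 with rfl | h
      · rw [hv0]
      · exact (hvpos x ⟨h, hx.2⟩).le
    have h1 : G (th x) + β = (v x / R) ^ 2 := by
      rw [div_pow, hen x hx, hR2]; field_simp
    rw [h1, Real.sqrt_sq (by positivity)]
  have hGv : ∀ x ∈ Icc (1/2:ℝ) 1, G (th x) = v x ^ 2 / R ^ 2 - β := by
    intro x hx
    rw [hen x hx, hR2]; field_simp; ring
  set v1 := v x1 with hv1
  have hv1pos : 0 < v1 := hvpos x1 ⟨hx1l, hx1r.le⟩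
  have hsub1 : Icc (1/2:ℝ) x1 ⊆ Icc (1/2) 1 := Icc_subset_Icc_right hx1r.le
  have hsub2 : Icc x1 1 ⊆ Icc (1/2:ℝ) 1 := Icc_subset_Icc_left hx1l.le
  have hκx : ∀ x ∈ Icc (1/2:ℝ) x1, κ (th x) ≠ 0 := by
    intro x hx
    refine hκnear _ ⟨?_, ?_⟩
    · have := hthm.monotoneOn hhalf (hsub1 hx) hx.1
      linarith
    · exact hthm.monotoneOn (hsub1 hx) hx1m hx.2
  have hvx : ∀ x ∈ Icc x1 1, v x ≠ 0 := fun x hx => (hvpos x ⟨by linarith [hx.1], hx.2⟩).ne'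
  have hBeq : β + G θ1 = (v1 / R) ^ 2 := by
    rw [hθ1def, hGv x1 hx1m, div_pow]; ring
  have hsB : √(β + G θ1) = v1 / R := by rw [hBeq, Real.sqrt_sq (by positivity)]
  -- the integral near the turning point
  have I1 : (∫ σ in (0:ℝ)..1, (fun s => (a' (F s) * κ (F s) - a (F s) * κ' (F s)) / κ (F s) ^ 2
        / ρ (F s)) (G θ1 - (β + G θ1) * (1 - σ ^ 2)))
      = (p / v1) * ∫ x in (1/2:ℝ)..x1,
          (a' (th x) * κ (th x) - a (th x) * κ' (th x)) / κ (th x) ^ 2 / c (th x) := by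
    set f' := (fun s => (a' (F s) * κ (F s) - a (F s) * κ' (F s)) / κ (F s) ^ 2 / ρ (F s)) with hf'
    have hBpos : 0 < β + G θ1 := by linarith
    have hcomp := intervalIntegral.integral_comp_mul_deriv'' (a := 1/2) (b := x1)
      (f := fun x => v x / v1) (f' := fun x => p * κ (th x) / v1)
      (g := fun σ => f' (G θ1 - (β + G θ1) * (1 - σ ^ 2)))
      (by rw [uIcc_of_le hx1l.le]; exact (hvc.mono hsub1).div_const _)
      (by
        intro x hx
        rw [min_eq_left hx1l.le, max_eq_right hx1l.le] at hx
        exact ((hv x (hsub1 ⟨hx.1.le, hx.2.le⟩)).div_const v1).hasDerivWithinAt)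
      (by
        rw [uIcc_of_le hx1l.le]
        exact (continuousOn_const.mul (hκc.comp_continuousOn (hthc.mono hsub1))).div_const _)
      (by
        rw [uIcc_of_le hx1l.le]
        refine hfc'.comp (by fun_prop) ?_
        rintro _ ⟨x, hx, rfl⟩
        have h0 : 0 ≤ v x / v1 := by
          have := hvm hhalf (hsub1 hx) hx.1
          rw [hv0] at this; positivity
        have h1 : v x / v1 ≤ 1 := by
          rw [div_le_one hv1pos]; exact hvm (hsub1 hx) hx1m hx.2
        have h2 : (v x / v1) ^ 2 ≤ 1 := by nlinarith
        have h3 : 0 ≤ (v x / v1) ^ 2 := sq_nonneg _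
        constructor <;> simp only <;> nlinarith)
    simp only [hv0, zero_div, ← hv1, div_self hv1pos.ne'] at hcomp
    rw [← hcomp, ← intervalIntegral.integral_const_mul]
    refine intervalIntegral.integral_congr ?_
    intro x hx
    rw [uIcc_of_le hx1l.le] at hx
    have e : G θ1 - (β + G θ1) * (1 - (v x / v1) ^ 2) = G (th x) := by
      rw [hGv x (hsub1 hx)]
      have : G θ1 = (v1 / R) ^ 2 - β := by linarith
      rw [this]; field_simp; ring
    have hk := hκx x hx
    have hcx := hcne (th x)
    simp only [Function.comp, e, hf', hF (th x), hρκ]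
    field_simp
  have I2 : (∫ θ in θ1..θ0, (fun θ => c θ * a θ) θ / √(G θ + β) ^ 3)
      = R ^ 3 * ∫ x in x1..1, a (th x) / v x ^ 2 := by
    have hcomp := intervalIntegral.integral_comp_mul_deriv'' (a := x1) (b := 1)
      (f := th) (f' := fun x => v x / c (th x))
      (g := fun θ => (c θ * a θ) / √(G θ + β) ^ 3)
      (by rw [uIcc_of_le hx1r.le]; exact hthc.mono hsub2)
      (by
        intro x hx
        rw [min_eq_left hx1r.le, max_eq_right hx1r.le] at hx
        exact (hth x (hsub2 ⟨hx.1.le, hx.2.le⟩)).hasDerivWithinAt)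
      (by
        rw [uIcc_of_le hx1r.le]
        exact (hvc.mono hsub2).div (hc.comp_continuousOn (hthc.mono hsub2)) (fun x _ => hcne _))
      (by
        rw [uIcc_of_le hx1r.le]
        refine ContinuousOn.div (by fun_prop) (by fun_prop) ?_
        rintro _ ⟨x, hx, rfl⟩
        rw [hsq x (hsub2 hx)]
        exact pow_ne_zero _ (div_ne_zero (hvx x hx) hRpos.ne'))
    rw [hth1, ← hθ1def] at hcomp
    simp only
    rw [← hcomp, ← intervalIntegral.integral_const_mul]
    refine intervalIntegral.integral_congr ?_
    intro x hx
    rw [uIcc_of_le hx1r.le] at hx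
    have h1 := hvx x hx
    have hcx := hcne (th x)
    simp only [Function.comp, hsq x (hsub2 hx)]
    field_simp
  -- the outer part
  have hthc2 := hthc.mono hsub2
  have hvc2 := hvc.mono hsub2
  have hEc2 := hEc.mono hsub2
  have cO1 : ContinuousOn (fun x => a' (th x) / c (th x) * E x) (Icc (1/2) 1) :=
    ((ha'.comp_continuousOn hthc).div (hc.comp_continuousOn hthc) (fun x _ => hcne _)).mul hEc
  have cO2 : ContinuousOn (fun x => a (th x) / v x ^ 2) (Icc x1 1) :=
    (hac.comp_continuousOn hthc2).div (hvc2.pow 2) (fun x hx => pow_ne_zero _ (hvx x hx))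
  have iO1 : IntervalIntegrable (fun x => a' (th x) / c (th x) * E x) volume x1 1 :=
    ContinuousOn.intervalIntegrable (by rw [uIcc_of_le hx1r.le]; exact cO1.mono hsub2)
  have iO1' : IntervalIntegrable (fun x => a' (th x) / c (th x) * E x) volume (1/2) x1 :=
    ContinuousOn.intervalIntegrable (by rw [uIcc_of_le hx1l.le]; exact cO1.mono hsub1)
  have iO2 : IntervalIntegrable (fun x => a (th x) / v x ^ 2) volume x1 1 :=
    ContinuousOn.intervalIntegrable (by rw [uIcc_of_le hx1r.le]; exact cO2)
  have O1 : (∫ x in x1..1, (a' (th x) / c (th x) * E x - μ * (a (th x) / v x ^ 2)))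
      = a θ0 * E 1 / v 1 - a θ1 * E x1 / v1 := by
    rw [intervalIntegral.integral_eq_sub_of_hasDerivAt (f := fun x => a (th x) * E x / v x)]
    · simp only [hth1, ← hθ1def, ← hv1]
    · intro x hx
      rw [uIcc_of_le hx1r.le] at hx
      have h1 := hvx x hx
      have hcx := hcne (th x)
      have := ((((ha (th x)).comp x (hth x (hsub2 hx))).mul (hE x (hsub2 hx))).div
        (hv x (hsub2 hx)) h1)
      refine this.congr_deriv ?_
      have hw := hW x (hsub2 hx)
      have hμe : μ = p * κ (th x) * E x - v x * E1 x := by linarith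
      simp only [Function.comp, Pi.mul_apply]
      rw [hμe]
      field_simp
      ring
    · exact iO1.sub (iO2.const_mul μ)
  rw [intervalIntegral.integral_sub iO1 (iO2.const_mul μ), intervalIntegral.integral_const_mul] at O1
  -- the inner part
  have hthc1 := hthc.mono hsub1
  have cI : ContinuousOn (fun x => (a' (th x) * κ (th x) - a (th x) * κ' (th x)) / κ (th x) ^ 2
      / c (th x)) (Icc (1/2) x1) := by
    refine ContinuousOn.div (ContinuousOn.div (((ha'.comp_continuousOn hthc1).mul
      (hκc.comp_continuousOn hthc1)).sub ((hac.comp_continuousOn hthc1).mul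
      (hκ'.comp_continuousOn hthc1))) ((hκc.comp_continuousOn hthc1).pow 2) ?_)
      (hc.comp_continuousOn hthc1) ?_
    · intro x hx; exact pow_ne_zero _ (hκx x hx)
    · intro x _; exact hcne _
  have iI : IntervalIntegrable (fun x => (a' (th x) * κ (th x) - a (th x) * κ' (th x))
      / κ (th x) ^ 2 / c (th x)) volume (1/2) x1 :=
    ContinuousOn.intervalIntegrable (by rw [uIcc_of_le hx1l.le]; exact cI)
  have hNd : ∀ x ∈ Icc (1/2:ℝ) x1, HasDerivAt
      (fun x => a (th x) / κ (th x) - p / μ * (a (th x) * E x))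
      ((a' (th x) * κ (th x) - a (th x) * κ' (th x)) / κ (th x) ^ 2 * (v x / c (th x))
        - p / μ * (a' (th x) * (v x / c (th x)) * E x + a (th x) * E1 x)) x := by
    intro x hx
    have hx' := hsub1 hx
    have h1 := ((ha (th x)).div (hκ (th x)) (hκx x hx)).comp x (hth x hx')
    have h2 := (((ha (th x)).comp x (hth x hx')).mul (hE x hx')).const_mul (p / μ)
    exact h1.sub h2
  have In : (∫ x in (1/2:ℝ)..x1, ((a' (th x) * κ (th x) - a (th x) * κ' (th x)) / κ (th x) ^ 2
      / c (th x) - p / μ * (a' (th x) / c (th x) * E x)))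
      = (a θ1 / κ θ1 - p / μ * (a θ1 * E x1)) / v1 := by
    have hhx : (1/2:ℝ) ∈ Icc (1/2:ℝ) x1 := ⟨le_rfl, hx1l.le⟩
    have hw0 := hW (1/2) hhalf
    rw [hv0, ← hmdef] at hw0
    have hμe : μ = p * κ m * E (1/2) := by linarith
    refine P_integral (N := fun x => a (th x) / κ (th x) - p / μ * (a (th x) * E x)) (v := v)
      (w := p * κ m) hx1l.le ?_ hv0 ?_ (hv _ hhalf) (mul_ne_zero hp.ne' hm) ?_ ?_
    · simp only [← hmdef]
      have : p / μ * (a m * E (1/2)) = a m / κ m := by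
        rw [div_mul_eq_mul_div, div_eq_div_iff hμ hm, hμe]; ring
      rw [this, sub_self]
    · refine (hNd _ hhx).congr_deriv ?_
      rw [hv0, hE1]; simp
    · intro x hx
      have hx' : x ∈ Icc (1/2:ℝ) x1 := ⟨hx.1.le, hx.2⟩
      have hvx' : v x ≠ 0 := (hvpos x ⟨hx.1, hx.2.trans hx1r.le⟩).ne'
      refine ((hNd x hx').div (hv x (hsub1 hx')) hvx').congr_deriv ?_
      have hw := hW x (hsub1 hx')
      have hk := hκx x hx'
      have hcx := hcne (th x)
      have hE1e : E1 x = (p * κ (th x) * E x - μ) / v x := by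
        field_simp; linarith
      rw [hE1e]
      field_simp
      ring
    · exact cI.sub (continuousOn_const.mul (cO1.mono hsub1))
  rw [intervalIntegral.integral_sub iI (iO1'.const_mul _), intervalIntegral.integral_const_mul] at In
  rw [I1, I2, hsB, hfeq, hF θ1,
    ← intervalIntegral.integral_add_adjacent_intervals iO1' iO1]
  have hκ1 : κ θ1 ≠ 0 := hκx x1 ⟨hx1l.le, le_rfl⟩
  generalize (∫ x in (1/2:ℝ)..x1, (a' (th x) * κ (th x) - a (th x) * κ' (th x)) / κ (th x) ^ 2
      / c (th x)) = A1 at *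
  generalize (∫ x in (1/2:ℝ)..x1, a' (th x) / c (th x) * E x) = A2 at *
  generalize (∫ x in x1..1, a' (th x) / c (th x) * E x) = A3 at *
  generalize (∫ x in x1..1, a (th x) / v x ^ 2) = A4 at *
  have hA1 : A1 = (a θ1 / κ θ1 - p / μ * (a θ1 * E x1)) / v1 + p / μ * A2 := by linarith
  have hA3 : a θ0 * E 1 / v 1 = A3 - μ * A4 + a θ1 * E x1 / v1 := by linarith
  have hpR : p = R ^ 2 / 2 := by linarith
  rw [hA3, hA1]
  have e1 : 2 * (v1 / R) * (p / v1 * ((a θ1 / κ θ1 - p / μ * (a θ1 * E x1)) / v1 + p / μ * A2))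
     = R * ((a θ1 / κ θ1 - p / μ * (a θ1 * E x1)) / v1 + p / μ * A2) := by
    generalize ((a θ1 / κ θ1 - p / μ * (a θ1 * E x1)) / v1 + p / μ * A2) = Q
    field_simp
    rw [hR2]
  rw [e1, hpR]
  field_simp
  ring

lemma const_of_deriv0 {f : ℝ → ℝ} (hf : ∀ x ∈ Icc (0:ℝ) 1, HasDerivAt f 0 x) :
    ∀ x ∈ Icc (0:ℝ) 1, f x = f 0 :=
  constant_of_has_deriv_right_zero (fun x hx => (hf x hx).continuousAt.continuousWithinAt)
    (fun x hx => (hf x ⟨hx.1, hx.2.le⟩).hasDerivWithinAt)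

lemma mono_of_deriv {f f' : ℝ → ℝ} {a b : ℝ} (hf : ∀ x ∈ Icc a b, HasDerivAt f (f' x) x)
    (h0 : ∀ x ∈ Icc a b, 0 ≤ f' x) : MonotoneOn f (Icc a b) := by
  refine monotoneOn_of_deriv_nonneg (convex_Icc _ _)
    (fun x hx => (hf x hx).continuousAt.continuousWithinAt) ?_ ?_
  · intro x hx
    exact (hf x (interior_subset hx)).differentiableAt.differentiableWithinAt
  · intro x hx
    rw [(hf x (interior_subset hx)).deriv]
    exact h0 x (interior_subset hx)

lemma profile_sym {c κ th v : ℝ → ℝ} {p : ℝ}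
    (hc : ContDiff ℝ 1 c) (hcpos : ∀ θ, 0 < c θ) (hκ : ContDiff ℝ 1 κ)
    (hth : ∀ x ∈ Icc (0:ℝ) 1, HasDerivAt th (v x / c (th x)) x)
    (hv : ∀ x ∈ Icc (0:ℝ) 1, HasDerivAt v (p * κ (th x)) x)
    (h01 : th 1 = th 0) (hv01 : v 1 = - v 0) :
    ∀ x ∈ Icc (0:ℝ) 1, th (1 - x) = th x ∧ v (1 - x) = - v x := by
  set Ψ : ℝ × ℝ → ℝ × ℝ := fun z => (z.2 / c z.1, p * κ z.1) with hΨ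
  have hΨc : ContDiff ℝ 1 Ψ := by
    refine ContDiff.prodMk ?_ ?_
    · exact contDiff_snd.div (hc.comp contDiff_fst) (fun z => (hcpos _).ne')
    · exact contDiff_const.mul (hκ.comp contDiff_fst)
  set f : ℝ → ℝ × ℝ := fun x => (th x, v x) with hf
  set f2 : ℝ → ℝ × ℝ := fun x => (th (1 - x), - v (1 - x)) with hf2
  have hfd : ∀ x ∈ Icc (0:ℝ) 1, HasDerivAt f (Ψ (f x)) x := fun x hx => (hth x hx).prodMk (hv x hx)
  have hr : ∀ x : ℝ, HasDerivAt (fun x : ℝ => 1 - x) (-1) x := fun x => by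
    simpa using (hasDerivAt_id x).const_sub 1
  have hmem : ∀ x ∈ Icc (0:ℝ) 1, 1 - x ∈ Icc (0:ℝ) 1 := fun x hx =>
    ⟨by linarith [hx.2], by linarith [hx.1]⟩
  have hfd2 : ∀ x ∈ Icc (0:ℝ) 1, HasDerivAt f2 (Ψ (f2 x)) x := by
    intro x hx
    have h1 := (hth _ (hmem x hx)).comp x (hr x)
    have h2 := ((hv _ (hmem x hx)).comp x (hr x)).neg
    refine (h1.prodMk h2).congr_deriv ?_
    simp only [hΨ, hf2]
    ext
    · simp; ring
    · simp
  have hcf : ContinuousOn f (Icc 0 1) := fun x hx => (hfd x hx).continuousAt.continuousWithinAt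
  have hcf2 : ContinuousOn f2 (Icc 0 1) := fun x hx => (hfd2 x hx).continuousAt.continuousWithinAt
  obtain ⟨M1, hM1⟩ := isCompact_Icc.exists_bound_of_continuousOn hcf
  obtain ⟨M2, hM2⟩ := isCompact_Icc.exists_bound_of_continuousOn hcf2
  obtain ⟨K, hK⟩ := (hΨc.contDiffOn (s := Metric.closedBall 0 (max M1 M2))).exists_lipschitzOnWith
    one_ne_zero (convex_closedBall _ _) (isCompact_closedBall _ _)
  have := ODE_solution_unique_of_mem_Icc_right (v := fun _ => Ψ)
    (s := fun _ => Metric.closedBall 0 (max M1 M2)) (f := f2) (g := f) (a := 0) (b := 1)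
    (fun _ _ => hK) hcf2 (fun x hx => (hfd2 x ⟨hx.1, hx.2.le⟩).hasDerivWithinAt)
    (fun x hx => by
      rw [mem_closedBall_zero_iff]; exact (hM2 x ⟨hx.1, hx.2.le⟩).trans (le_max_right _ _))
    hcf (fun x hx => (hfd x ⟨hx.1, hx.2.le⟩).hasDerivWithinAt)
    (fun x hx => by
      rw [mem_closedBall_zero_iff]; exact (hM1 x ⟨hx.1, hx.2.le⟩).trans (le_max_left _ _))
    (by simp [hf, hf2, h01, hv01])
  intro x hx
  have h := this hx
  simp only [hf, hf2, Prod.mk.injEq] at h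
  exact ⟨h.1, by linarith [h.2]⟩

lemma profile {c ρ κ G th v : ℝ → ℝ} {θ0 β p : ℝ}
    (hGd : ∀ θ, HasDerivAt G (ρ θ) θ) (hGm : StrictMono G)
    (hc : ContDiff ℝ 1 c) (hcpos : ∀ θ, 0 < c θ) (hκ : ContDiff ℝ 1 κ) (hκ0 : ∀ θ, 0 ≤ κ θ)
    (hρκ : ∀ θ, ρ θ = κ θ * c θ) (hG0 : G θ0 = 0) (hβ : 0 < β)
    (hth : ∀ x ∈ Icc (0:ℝ) 1, HasDerivAt th (v x / c (th x)) x)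
    (hv : ∀ x ∈ Icc (0:ℝ) 1, HasDerivAt v (p * κ (th x)) x)
    (h0 : th 0 = θ0) (h1 : th 1 = θ0) (hm : G (th (1/2)) = -β) (hκm : κ (th (1/2)) ≠ 0) :
    0 < p ∧ (∀ x ∈ Icc (0:ℝ) 1, th (1 - x) = th x ∧ v (1 - x) = - v x) ∧ v (1/2) = 0 ∧
    (∀ x ∈ Ioc (1/2:ℝ) 1, 0 < v x) ∧
    (∀ x ∈ Icc (0:ℝ) 1, v x ^ 2 = 2 * p * (G (th x) + β)) := by
  have hsl : Icc (0:ℝ) (1/2) ⊆ Icc 0 1 := Icc_subset_Icc_right (by norm_num)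
  have hsr : Icc (1/2:ℝ) 1 ⊆ Icc 0 1 := Icc_subset_Icc_left (by norm_num)
  have hno : ¬ θ0 ≤ th (1/2) := fun h => by
    have := hGm.monotone h; linarith
  have hA : ¬ ∀ x ∈ Icc (0:ℝ) (1/2), 0 ≤ v x := by
    intro h
    apply hno
    have := mono_of_deriv (fun x hx => hth x (hsl hx)) (fun x hx => div_nonneg (h x hx) (hcpos _).le)
    rw [← h0]
    exact this (by norm_num) (by norm_num) (by norm_num)
  have hB : ¬ ∀ x ∈ Icc (1/2:ℝ) 1, v x ≤ 0 := by
    intro h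
    apply hno
    have := mono_of_deriv (fun x hx => (hth x (hsr hx)).neg) (fun x hx => by
      have := div_nonpos_of_nonpos_of_nonneg (h x hx) (hcpos (th x)).le
      linarith)
    rw [← h1]
    have := this (a := 1/2) (b := 1) (by norm_num) (by norm_num) (by norm_num)
    simpa using this
  have hp : 0 < p := by
    by_contra hp
    have hp : p ≤ 0 := not_lt.1 hp
    have hanti := mono_of_deriv (fun x hx => (hv x hx).neg) (fun x _ => by
      have := mul_nonpos_of_nonpos_of_nonneg hp (hκ0 (th x)); linarith)
    rcases le_total 0 (v (1/2)) with h | h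
    · refine hA fun x hx => ?_
      have := hanti (hsl hx) (by norm_num) hx.2
      simp only [Pi.neg_apply] at this
      linarith
    · refine hB fun x hx => ?_
      have := hanti (by norm_num) (hsr hx) hx.1
      simp only [Pi.neg_apply] at this
      linarith
  have hvm : MonotoneOn v (Icc 0 1) := mono_of_deriv hv (fun x _ => mul_nonneg hp.le (hκ0 _))
  have hen : ∀ x ∈ Icc (0:ℝ) 1, v x ^ 2 - 2 * p * G (th x) = v 0 ^ 2 - 2 * p * G (th 0) := by
    refine const_of_deriv0 (f := fun x => v x ^ 2 - 2 * p * G (th x)) ?_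
    intro x hx
    have e1 := (hv x hx).pow 2
    have e2 := ((hGd (th x)).comp x (hth x hx)).const_mul (2 * p)
    refine (e1.sub e2).congr_deriv ?_
    have := (hcpos (th x)).ne'
    rw [hρκ]
    field_simp
    norm_num
  have m0 : (0:ℝ) ∈ Icc (0:ℝ) 1 := by norm_num
  have m1 : (1:ℝ) ∈ Icc (0:ℝ) 1 := by norm_num
  have mh : (1/2:ℝ) ∈ Icc (0:ℝ) 1 := by norm_num
  have hsq : v 1 ^ 2 = v 0 ^ 2 := by
    have := hen 1 m1; rw [h0, h1] at this; linarith
  have hv01 : v 1 = - v 0 := by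
    rcases sq_eq_sq_iff_eq_or_eq_neg.1 hsq with h | h
    · exfalso
      have hcst : ∀ x ∈ Icc (0:ℝ) 1, v x = v 0 := fun x hx =>
        le_antisymm ((hvm hx m1 hx.2).trans h.le) (hvm m0 hx hx.1)
      rcases le_total 0 (v 0) with h' | h'
      · exact hA fun x hx => by rw [hcst x (hsl hx)]; exact h'
      · exact hB fun x hx => by rw [hcst x (hsr hx)]; exact h'
    · exact h
  have hsym := profile_sym hc hcpos hκ hth hv (h1.trans h0.symm) hv01
  have hvh : v (1/2) = 0 := by
    have := (hsym (1/2) mh).2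
    norm_num at this
    linarith
  refine ⟨hp, hsym, hvh, ?_, ?_⟩
  · intro x hx
    have hx' : x ∈ Icc (0:ℝ) 1 := hsr ⟨hx.1.le, hx.2⟩
    have h0' := hvm mh hx' hx.1.le
    rw [hvh] at h0'
    refine lt_of_le_of_ne h0' fun hz => ?_
    have hz' : ∀ y ∈ Icc (1/2:ℝ) x, v y = 0 := by
      intro y hy
      have hy' : y ∈ Icc (0:ℝ) 1 := hsr ⟨hy.1, hy.2.trans hx.2⟩
      exact le_antisymm ((hvm hy' hx' hy.2).trans hz.symm.le) (hvh ▸ hvm mh hy' hy.1)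
    have d1 : HasDerivWithinAt v 0 (Icc (1/2) x) (1/2) :=
      (hasDerivWithinAt_const (1/2) (Icc (1/2:ℝ) x) (0:ℝ)).congr hz' hvh
    have d2 : HasDerivWithinAt v (p * κ (th (1/2))) (Icc (1/2) x) (1/2) :=
      (hv _ mh).hasDerivWithinAt
    have := (uniqueDiffOn_Icc hx.1 (1/2) ⟨le_rfl, hx.1.le⟩).eq_deriv _ d2 d1
    exact mul_ne_zero hp.ne' hκm this
  · intro x hx
    have e1 := hen x hx
    have e2 := hen (1/2) mh
    rw [hvh, hm] at e2
    linear_combination e1 - e2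

lemma J_value {c ρ G F th v : ℝ → ℝ} {θ0 β p : ℝ}
    (hGd : ∀ θ, HasDerivAt G (ρ θ) θ) (hGm : StrictMono G)
    (hF : Function.LeftInverse F G) (hρ : {θ | ρ θ = 0}.Countable) (hρ0 : ∀ θ, 0 ≤ ρ θ)
    (hcpos : ∀ θ, 0 < c θ) (hG0 : G θ0 = 0) (hp : 0 < p) (hβ : 0 < β)
    (hth : ∀ x ∈ Icc (1/2:ℝ) 1, HasDerivAt th (v x / c (th x)) x)
    (hv0 : v (1/2) = 0) (hvpos : ∀ x ∈ Ioc (1/2:ℝ) 1, 0 < v x)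
    (hen : ∀ x ∈ Icc (1/2:ℝ) 1, v x ^ 2 = 2 * p * (G (th x) + β))
    (hth1 : th 1 = θ0) (hm : G (th (1/2)) = -β) :
    (∫ t in (0:ℝ)..β, c (F (t - β)) * 1 / ρ (F (t - β)) / √t) = √(2 * p) / 2 := by
  have hthc : ContinuousOn th (Icc (1/2) 1) := fun x hx => (hth x hx).continuousAt.continuousWithinAt
  have hGc : Continuous G := continuous_iff_continuousAt.2 fun x => (hGd x).continuousAt
  have hthm : StrictMonoOn th (Icc (1/2) 1) := by
    refine strictMonoOn_of_deriv_pos (convex_Icc _ _) hthc ?_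
    intro x hx
    rw [interior_Icc] at hx
    rw [(hth x ⟨hx.1.le, hx.2.le⟩).deriv]
    exact div_pos (hvpos x ⟨hx.1, hx.2.le⟩) (hcpos _)
  have hTm : StrictMonoOn (fun x => G (th x) + β) (Icc (1/2) 1) := fun x hx y hy hxy => by
    have := hGm (hthm hx hy hxy); simp only; linarith
  have hhalf : (1/2:ℝ) ∈ Icc (1/2:ℝ) 1 := by norm_num
  have hone : (1:ℝ) ∈ Icc (1/2:ℝ) 1 := by norm_num
  have hT0 : G (th (1/2)) + β = 0 := by rw [hm]; ring
  have hT1 : G (th 1) + β = β := by rw [hth1, hG0]; ring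
  have him : (fun x => G (th x) + β) '' Ioo (1/2) 1 = Ioo 0 β := by
    apply Subset.antisymm
    · rintro _ ⟨x, hx, rfl⟩
      have hx' : x ∈ Icc (1/2:ℝ) 1 := ⟨hx.1.le, hx.2.le⟩
      have a1 := hTm hhalf hx' hx.1
      have a2 := hTm hx' hone hx.2
      simp only [hT0, hT1] at a1 a2
      exact ⟨a1, a2⟩
    · have := intermediate_value_Ioo (show (1/2:ℝ) ≤ 1 by norm_num)
        (f := fun x => G (th x) + β) ((hGc.comp_continuousOn hthc).add continuousOn_const)
      simpa only [hT0, hT1] using this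
  have hN : (Ioo (1/2:ℝ) 1 ∩ th ⁻¹' {θ | ρ θ = 0}).Countable := by
    refine MapsTo.countable_of_injOn (f := th) (t := {θ | ρ θ = 0}) (fun x hx => hx.2) ?_ hρ
    exact (hthm.injOn).mono (inter_subset_left.trans Ioo_subset_Icc_self)
  have hR : 0 < √(2 * p) := Real.sqrt_pos.2 (by positivity)
  have p1 := subst_set (s := Ioo (1/2) 1) measurableSet_Ioo hN
    (T := fun x => G (th x) + β) (T' := fun x => ρ (th x) * (v x / c (th x)))
    (k := fun t => c (F (t - β)) * 1 / ρ (F (t - β)) / √t) (k' := fun _ => √(2 * p))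
    (l := 0) (r := β)
    (fun x hx => ((((hGd (th x)).comp x (hth x ⟨hx.1.le, hx.2.le⟩))).add_const β).hasDerivWithinAt)
    (hTm.injOn.mono Ioo_subset_Icc_self) him
    (by
      intro x hx hxN
      have hx' : x ∈ Icc (1/2:ℝ) 1 := ⟨hx.1.le, hx.2.le⟩
      have hρx : ρ (th x) ≠ 0 := fun h => hxN ⟨hx, h⟩
      have hvx := hvpos x ⟨hx.1, hx.2.le⟩
      have hcx := hcpos (th x)
      have hs : √(G (th x) + β) = v x / √(2 * p) := by
        have h1 : G (th x) + β = (v x / √(2 * p)) ^ 2 := by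
          rw [div_pow, hen x hx', Real.sq_sqrt (by positivity)]; field_simp
        rw [h1, Real.sqrt_sq (by positivity)]
      rw [abs_of_nonneg (mul_nonneg (hρ0 _) (by positivity))]
      simp only [add_sub_cancel_right, hF (th x), hs]
      field_simp)
  rw [intervalIntegral.integral_of_le hβ.le, integral_Ioc_eq_integral_Ioo, p1.1]
  simp
  norm_num
  ring

lemma evans_rel {c κ κ' g g' th v u U1 Y1 X1 U2 Y2 X2 : ℝ → ℝ} {p c0 : ℝ}
    (hc : Continuous c) (hcpos : ∀ θ, 0 < c θ) (hgpos : ∀ θ, 0 < g θ)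
    (hκ : ∀ θ, HasDerivAt κ (κ' θ) θ) (hκ' : Continuous κ')
    (hg : ∀ θ, HasDerivAt g (g' θ) θ) (hp : p ≠ 0) (hc0 : c0 ≠ 0)
    (hth : ∀ x ∈ Icc (0:ℝ) 1, HasDerivAt th (v x / c (th x)) x)
    (hv : ∀ x ∈ Icc (0:ℝ) 1, HasDerivAt v (p * κ (th x)) x)
    (hu : ∀ x ∈ Icc (0:ℝ) 1, HasDerivAt u (p / g (th x)) x) (hu0 : u 0 = 0)
    (hU1 : ∀ x ∈ Icc (0:ℝ) 1, HasDerivAt U1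
      (1 / g (th x) - p * g' (th x) / g (th x) ^ 2 * (Y1 x / c (th x))) x)
    (hY1 : ∀ x ∈ Icc (0:ℝ) 1, HasDerivAt Y1 (X1 x) x)
    (hX1 : ∀ x ∈ Icc (0:ℝ) 1, HasDerivAt X1 (p * κ' (th x) / c (th x) * Y1 x + κ (th x)) x)
    (hU2 : ∀ x ∈ Icc (0:ℝ) 1, HasDerivAt U2
      (- (p * g' (th x) / g (th x) ^ 2 * (Y2 x / c (th x)))) x)
    (hY2 : ∀ x ∈ Icc (0:ℝ) 1, HasDerivAt Y2 (X2 x) x)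
    (hX2 : ∀ x ∈ Icc (0:ℝ) 1, HasDerivAt X2 (p * κ' (th x) / c (th x) * Y2 x) x)
    (iU1 : U1 0 = 0) (iY1 : Y1 0 = 0) (iX1 : X1 0 = 0)
    (iU2 : U2 0 = 0) (iY2 : Y2 0 = 0) (iX2 : X2 0 = 1 / c0) :
    Y1 1 = v 1 / (2 * p) - v 0 * c0 / (2 * p) * Y2 1 ∧
    U1 1 = (1 / g (th 1) + u 1 / p) / 2 - v 0 * c0 / (2 * p) * U2 1 := by
  have m1 : (1:ℝ) ∈ Icc (0:ℝ) 1 := by norm_num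
  have hthc : ContinuousOn th (Icc 0 1) := fun x hx => (hth x hx).continuousAt.continuousWithinAt
  set b := v 0 * c0 / (2 * p) with hb
  set N : ℝ → ℝ := fun x => Y1 x - x * v x / (2 * p) + b * Y2 x with hN
  set M : ℝ → ℝ := fun x => X1 x - (v x + x * (p * κ (th x))) / (2 * p) + b * X2 x with hM
  have hNd : ∀ x ∈ Icc (0:ℝ) 1, HasDerivAt N (M x) x := by
    intro x hx
    have := ((hY1 x hx).sub (((hasDerivAt_id x).mul (hv x hx)).div_const (2 * p))).add
      ((hY2 x hx).const_mul b)
    refine this.congr_deriv ?_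
    simp only [hM, id]; ring
  have hMd : ∀ x ∈ Icc (0:ℝ) 1, HasDerivAt M (p * κ' (th x) / c (th x) * N x) x := by
    intro x hx
    have hk := ((hκ (th x)).comp x (hth x hx)).const_mul p
    have := ((hX1 x hx).sub (((hv x hx).add ((hasDerivAt_id x).mul hk)).div_const (2 * p))).add
      ((hX2 x hx).const_mul b)
    refine this.congr_deriv ?_
    have hcx := (hcpos (th x)).ne'
    simp only [hN, id, Function.comp]
    field_simp
    ring
  have hkc : ContinuousOn (fun x => p * κ' (th x) / c (th x)) (Icc 0 1) :=
    (continuousOn_const.mul (hκ'.comp_continuousOn hthc)).div (hc.comp_continuousOn hthc)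
      (fun x _ => (hcpos _).ne')
  obtain ⟨C, hC⟩ := isCompact_Icc.exists_bound_of_continuousOn hkc
  have hzero : ∀ x ∈ Icc (0:ℝ) 1, (fun x => (N x, M x)) x = 0 := by
    refine eq_zero_of_abs_deriv_le_mul_abs_self_of_eq_zero_right (K := max 1 C)
      (f' := fun x => (M x, p * κ' (th x) / c (th x) * N x)) ?_ ?_ ?_ ?_
    · exact fun x hx => ((hNd x hx).prodMk (hMd x hx)).continuousAt.continuousWithinAt
    · exact fun x hx => ((hNd x ⟨hx.1, hx.2.le⟩).prodMk (hMd x ⟨hx.1, hx.2.le⟩)).hasDerivWithinAt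
    · have e1 : N 0 = 0 := by simp [hN, iY1, iY2]
      have e2 : M 0 = 0 := by
        simp only [hM, iX1, iX2, hb]; field_simp; ring
      simp [e1, e2]
    · intro x hx
      have hn : |N x| ≤ ‖(N x, M x)‖ := norm_fst_le (N x, M x)
      have hm : |M x| ≤ ‖(N x, M x)‖ := norm_snd_le (N x, M x)
      have hCx := hC x ⟨hx.1, hx.2.le⟩
      have h1 : 1 ≤ max 1 C := le_max_left _ _
      have h2 : C ≤ max 1 C := le_max_right _ _
      refine (norm_prod_le_iff.2 ⟨?_, ?_⟩)
      · simp only [Real.norm_eq_abs]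
        have := norm_nonneg (N x, M x)
        nlinarith
      · simp only [norm_mul]
        refine mul_le_mul (hCx.trans h2) hn (abs_nonneg _) (by linarith)
  have hN0 : ∀ x ∈ Icc (0:ℝ) 1, N x = 0 := fun x hx => congrArg Prod.fst (hzero x hx)
  constructor
  · have := hN0 1 m1
    simp only [hN, one_mul] at this
    linarith
  · have hR := const_of_deriv0 (f := fun x => U1 x - (x / g (th x) + u x / p) / 2 + b * U2 x) (by
      intro x hx
      have hgx := (hgpos (th x)).ne'
      have hcx := (hcpos (th x)).ne'
      have d1 := (hasDerivAt_id x).div ((hg (th x)).comp x (hth x hx)) hgx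
      have := ((hU1 x hx).sub ((d1.add ((hu x hx).div_const p)).div_const 2)).add
        ((hU2 x hx).const_mul b)
      refine this.congr_deriv ?_
      have hn := hN0 x hx
      have hy : Y1 x = x * v x / (2 * p) - b * Y2 x := by simp only [hN] at hn; linarith
      simp only [id, Function.comp, hy]
      field_simp
      ring) 1 m1
    simp only [iU1, iU2, hu0] at hR
    have : U1 1 - (1 / g (th 1) + u 1 / p) / 2 + b * U2 1 = 0 := by rw [hR]; simp
    linarith

lemma evans_core {c ρ κ κ' g g' G F D th v u U1 Y1 X1 U2 Y2 X2 : ℝ → ℝ} {θ0 β p : ℝ}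
    (hGd : ∀ θ, HasDerivAt G (ρ θ) θ) (hGm : StrictMono G)
    (hF : Function.LeftInverse F G)
    (hF' : Function.RightInverse F G) (hρ : {θ | ρ θ = 0}.Countable) (hρ0 : ∀ θ, 0 ≤ ρ θ)
    (hc : ContDiff ℝ 1 c) (hcpos : ∀ θ, 0 < c θ) (hgpos : ∀ θ, 0 < g θ)
    (hρκ : ∀ θ, ρ θ = κ θ * c θ)
    (hκ : ∀ θ, HasDerivAt κ (κ' θ) θ) (hκ' : Continuous κ')
    (hg : ∀ θ, HasDerivAt g (g' θ) θ) (hg' : Continuous g')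
    (hG0 : G θ0 = 0) (hβ : 0 < β)
    (hD : ∀ b, D b = (∫ t in (0:ℝ)..b, c (F (t - b)) * 1 / ρ (F (t - b)) / √t) *
      (∫ t in (0:ℝ)..b, c (F (t - b)) * (1 / g (F (t - b))) / ρ (F (t - b)) / √t))
    (hth : ∀ x ∈ Icc (0:ℝ) 1, HasDerivAt th (v x / c (th x)) x)
    (hv : ∀ x ∈ Icc (0:ℝ) 1, HasDerivAt v (p * κ (th x)) x)
    (h0 : th 0 = θ0) (h1 : th 1 = θ0) (hm : G (th (1/2)) = -β) (hκm : κ (th (1/2)) ≠ 0)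
    (hu : ∀ x ∈ Icc (0:ℝ) 1, HasDerivAt u (p / g (th x)) x) (hu0 : u 0 = 0)
    (hu1 : u 1 = 2 * D β)
    (hU1 : ∀ x ∈ Icc (0:ℝ) 1, HasDerivAt U1
      (1 / g (th x) - p * g' (th x) / g (th x) ^ 2 * (Y1 x / c (th x))) x)
    (hY1 : ∀ x ∈ Icc (0:ℝ) 1, HasDerivAt Y1 (X1 x) x)
    (hX1 : ∀ x ∈ Icc (0:ℝ) 1, HasDerivAt X1 (p * κ' (th x) / c (th x) * Y1 x + κ (th x)) x)
    (hU2 : ∀ x ∈ Icc (0:ℝ) 1, HasDerivAt U2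
      (- (p * g' (th x) / g (th x) ^ 2 * (Y2 x / c (th x)))) x)
    (hY2 : ∀ x ∈ Icc (0:ℝ) 1, HasDerivAt Y2 (X2 x) x)
    (hX2 : ∀ x ∈ Icc (0:ℝ) 1, HasDerivAt X2 (p * κ' (th x) / c (th x) * Y2 x) x)
    (iU1 : U1 0 = 0) (iY1 : Y1 0 = 0) (iX1 : X1 0 = 0)
    (iU2 : U2 0 = 0) (iY2 : Y2 0 = 0) (iX2 : X2 0 = 1 / c θ0) :
    -(U1 1 * (Y2 1 / c θ0) - U2 1 * (Y1 1 / c θ0)) = -(2 * β / (p * c θ0 ^ 2)) * deriv D β := by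
  have hκeq : deriv κ = κ' := funext fun x => (hκ x).deriv
  have hκC : ContDiff ℝ 1 κ := by
    rw [contDiff_one_iff_deriv]
    exact ⟨fun x => (hκ x).differentiableAt, hκeq ▸ hκ'⟩
  have hκ0 : ∀ θ, 0 ≤ κ θ := fun θ => by
    have := hρ0 θ
    rw [hρκ] at this
    exact nonneg_of_mul_nonneg_left this (hcpos θ)
  obtain ⟨hp, hsym, hvh, hvpos, hen⟩ := profile hGd hGm hc hcpos hκC hκ0 hρκ hG0 hβ hth hv h0 h1 hm hκm
  have hc0 := (hcpos θ0).ne'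
  obtain ⟨rY, rU⟩ := evans_rel hc.continuous hcpos hgpos hκ hκ' hg hp.ne' hc0 hth hv hu hu0
    hU1 hY1 hX1 hU2 hY2 hX2 iU1 iY1 iX1 iU2 iY2 iX2
  have m0 : (0:ℝ) ∈ Icc (0:ℝ) 1 := by norm_num
  have m1 : (1:ℝ) ∈ Icc (0:ℝ) 1 := by norm_num
  have hsr : Icc (1/2:ℝ) 1 ⊆ Icc 0 1 := Icc_subset_Icc_left (by norm_num)
  have hw : 0 < v 1 := hvpos 1 (by norm_num)
  have hv01 : v 0 = - v 1 := by
    have := (hsym 1 m1).2; simpa using this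
  have hwsq : v 1 ^ 2 = 2 * p * β := by
    have := hen 1 m1; rw [h1, hG0] at this; simpa using this
  have hr : ∀ x : ℝ, HasDerivAt (fun x : ℝ => 1 - x) (-1) x := fun x => by
    simpa using (hasDerivAt_id x).const_sub 1
  have hmem : ∀ x ∈ Icc (0:ℝ) 1, 1 - x ∈ Icc (0:ℝ) 1 := fun x hx =>
    ⟨by linarith [hx.2], by linarith [hx.1]⟩
  -- Wronskian
  have hWr : ∀ x ∈ Icc (0:ℝ) 1, v x * X2 x - p * κ (th x) * Y2 x = - (v 1 / c θ0) := by
    intro x hx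
    have hconst := const_of_deriv0 (f := fun x => v x * X2 x - p * κ (th x) * Y2 x) (fun y hy => by
      have hk := ((hκ (th y)).comp y (hth y hy)).const_mul p
      refine (((hv y hy).mul (hX2 y hy)).sub (hk.mul (hY2 y hy))).congr_deriv ?_
      simp only [Function.comp]
      field_simp
      ring) x hx
    rw [hconst, iY2, iX2, hv01]; ring
  set E : ℝ → ℝ := fun x => (Y2 x + Y2 (1 - x)) / 2 with hEdef
  set E1 : ℝ → ℝ := fun x => (X2 x - X2 (1 - x)) / 2 with hE1def
  have hE : ∀ x ∈ Icc (0:ℝ) 1, HasDerivAt E (E1 x) x := by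
    intro x hx
    refine (((hY2 x hx).add ((hY2 _ (hmem x hx)).comp x (hr x))).div_const 2).congr_deriv ?_
    simp only [hE1def]; ring
  have hW : ∀ x ∈ Icc (0:ℝ) 1, v x * E1 x - p * κ (th x) * E x = -(v 1 / c θ0) := by
    intro x hx
    have a := hWr x hx
    have b := hWr _ (hmem x hx)
    rw [(hsym x hx).1, (hsym x hx).2] at b
    simp only [hEdef, hE1def]
    linear_combination a / 2 + b / 2
  have hEh : E1 (1/2) = 0 := by
    simp only [hE1def]; norm_num
  have hE1v : E 1 = Y2 1 / 2 := by simp [hEdef, iY2]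
  have hμ : v 1 / c θ0 ≠ 0 := (div_pos hw (hcpos _)).ne'
  have ha : ∀ θ, HasDerivAt (fun θ => 1 / g θ) (- g' θ / g θ ^ 2) θ := fun θ => by
    have := (hg θ).fun_inv (hgpos θ).ne'
    simpa [one_div] using this
  have hgc : Continuous g := continuous_iff_continuousAt.2 fun x => (hg x).continuousAt
  have ha' : Continuous fun θ => - g' θ / g θ ^ 2 :=
    hg'.neg.div (hgc.pow 2) fun x => (pow_pos (hgpos x) 2).ne'
  have hthc : ContinuousOn th (Icc 0 1) := fun x hx => (hth x hx).continuousAt.continuousWithinAt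
  have hEc : ContinuousOn E (Icc 0 1) := fun x hx => (hE x hx).continuousAt.continuousWithinAt
  have hIntU : (∫ x in (1/2:ℝ)..1, (- g' (th x) / g (th x) ^ 2) / c (th x) * E x) = U2 1 / (2 * p) := by
    have hd : ∀ x ∈ uIcc (1/2:ℝ) 1, HasDerivAt (fun x => (U2 x - U2 (1 - x)) / (2 * p))
        ((- g' (th x) / g (th x) ^ 2) / c (th x) * E x) x := by
      intro x hx
      rw [uIcc_of_le (by norm_num)] at hx
      replace hx := hsr hx
      refine (((hU2 x hx).sub ((hU2 _ (hmem x hx)).comp x (hr x))).div_const (2 * p)).congr_deriv ?_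
      rw [(hsym x hx).1]
      have := (hcpos (th x)).ne'
      have := (hgpos (th x)).ne'
      simp only [hEdef]
      field_simp
      ring
    rw [intervalIntegral.integral_eq_sub_of_hasDerivAt hd]
    · norm_num [iU2]
    · apply ContinuousOn.intervalIntegrable
      rw [uIcc_of_le (by norm_num)]
      exact ((ha'.comp_continuousOn (hthc.mono hsr)).div (hc.continuous.comp_continuousOn (hthc.mono hsr))
        (fun x _ => (hcpos _).ne')).mul (hEc.mono hsr)
  have dJ1 := J_main (a := fun _ => 1) (a' := fun _ => 0) hGd hGm hF hF' hρ hρ0 hc.continuous hcpos hρκ hκ hκ'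
    (fun θ => hasDerivAt_const θ 1) continuous_const hG0 hp hμ (fun x hx => hth x (hsr hx))
    (fun x hx => hv x (hsr hx)) hvh hvpos (fun x hx => hen x (hsr hx)) h1 hκm
    (fun x hx => hE x (hsr hx)) (fun x hx => hW x (hsr hx)) hEh
  have dJ2 := J_main hGd hGm hF hF' hρ hρ0 hc.continuous hcpos hρκ hκ hκ'
    ha ha' hG0 hp hμ (fun x hx => hth x (hsr hx))
    (fun x hx => hv x (hsr hx)) hvh hvpos (fun x hx => hen x (hsr hx)) h1 hκm
    (fun x hx => hE x (hsr hx)) (fun x hx => hW x (hsr hx)) hEh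
  have vJ1 := J_value hGd hGm hF hρ hρ0 hcpos hG0 hp hβ (fun x hx => hth x (hsr hx)) hvh hvpos
    (fun x hx => hen x (hsr hx)) h1 hm
  rw [hIntU] at dJ2
  have hDv := hD β
  have hdD := ((dJ1.fun_mul dJ2).congr_of_eventuallyEq (Eventually.of_forall hD)).deriv
  rw [vJ1] at hdD hDv
  rw [hdD, rY, rU]
  set J2 := ∫ t in (0:ℝ)..β, c (F (t - β)) * (1 / g (F (t - β))) / ρ (F (t - β)) / √t
  rw [hu1, hDv, h1, hv01, hE1v]
  have hβe : β = v 1 ^ 2 / (2 * p) := by rw [hwsq]; field_simp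
  have hR : √(2 * p) ^ 2 = 2 * p := Real.sq_sqrt (by positivity)
  generalize √(2 * p) = R at hR ⊢
  have hg0 := (hgpos θ0).ne'
  have hp' : p = R ^ 2 / 2 := by rw [hR]; ring
  have hRne : R ≠ 0 := by rintro rfl; norm_num at hR; exact hp.ne' hR
  have hwne := hw.ne'
  rw [hβe]
  simp only [zero_div, zero_mul, intervalIntegral.integral_zero]
  clear_value J2
  rw [hp']
  field_simp
  ring

lemma YX {c c1 c2 ρ ρ1 th v Θ V : ℝ → ℝ} {p P x : ℝ}
    (hcpos : ∀ θ, 0 < c θ) (hc : ∀ θ, HasDerivAt c (c1 θ) θ) (hc1 : ∀ θ, HasDerivAt c1 (c2 θ) θ)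
    (hth : HasDerivAt th (v x / c (th x)) x)
    (hv : HasDerivAt v (p * (ρ (th x) / c (th x))) x)
    (hΘ : HasDerivAt Θ (-(2 * c1 (th x) * (v x / c (th x)) / c (th x)) * Θ x
      + 1 / c (th x) ^ 2 * V x) x)
    (hV : HasDerivAt V (ρ (th x) * P + (ρ1 (th x) * p
      + (c (th x) * c2 (th x) - 3 * c1 (th x) ^ 2) * (v x / c (th x)) ^ 2) * Θ x
      + 2 * c1 (th x) * (v x / c (th x)) / c (th x) * V x) x) :
    HasDerivAt (fun y => c (th y) * Θ y)
      (-(c1 (th x) * (v x / c (th x)) * Θ x) + V x / c (th x)) x ∧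
    HasDerivAt (fun y => -(c1 (th y) * (v y / c (th y)) * Θ y) + V y / c (th y))
      (p * ((ρ1 (th x) * c (th x) - ρ (th x) * c1 (th x)) / c (th x) ^ 2) / c (th x)
        * (c (th x) * Θ x) + P * (ρ (th x) / c (th x))) x := by
  have hcx := (hcpos (th x)).ne'
  have dc := (hc (th x)).comp x hth
  have dc1 := (hc1 (th x)).comp x hth
  constructor
  · refine (dc.mul hΘ).congr_deriv ?_
    simp only [Function.comp]
    field_simp
    ring
  · refine ((((dc1.mul (hv.div dc hcx)).mul hΘ).neg).add (hV.div dc hcx)).congr_deriv ?_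
    simp only [Function.comp, Pi.mul_apply, Pi.div_apply]
    field_simp
    ring

/-- At `λ = 0`, the Evans determinant built from the solutions
`Z1, Z2` of `Z′ = A(x)Z` with `Z1(0) = e2`, `Z2(0) = e4` and the vectors `e2, e4`
equals `−(2β/(p0·c(θ0)²))·D′(β)`, where `p0 := g(θ(0))·u′(0)`. -/
theorem stmt_13
    (α1 α2 α3 α4 α5 α6 K1 K3 γ1 γ2 Cbar θ0 : ℝ)
    (hγ1 : γ1 = α3 - α2) (hγ2 : γ2 = α6 - α5) (hγ1pos : 0 < γ1)
    (hK1 : 0 < K1) (hK3 : 0 < K3) (hCbar : 0 < Cbar)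
    (g h c G : ℝ → ℝ)
    (hg : ∀ θ : ℝ, g θ = α1 * Real.sin θ ^ 2 * Real.cos θ ^ 2
        + (α5 - α2) / 2 * Real.sin θ ^ 2 + (α3 + α6) / 2 * Real.cos θ ^ 2 + α4 / 2)
    (hh : ∀ θ : ℝ, h θ = (γ1 + γ2 * Real.cos (2 * θ)) / 2)
    (hc : ∀ θ : ℝ, c θ = Real.sqrt (K1 * Real.cos θ ^ 2 + K3 * Real.sin θ ^ 2))
    (hdamp : ∀ θ : ℝ, Cbar ≤ g θ - h θ ^ 2 / γ1 ∧ g θ - h θ ^ 2 / γ1 ≤ g θ)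
    (hθ0 : h θ0 ≠ 0)
    (hG : ∀ θ : ℝ, G θ = ∫ s in θ0..θ, h s / g s)
    (hcase : γ2 = γ1 ∨ γ2 = -γ1)
    (F D : ℝ → ℝ)
    (hF : Function.LeftInverse F G) (hF' : Function.RightInverse F G)
    (hD : ∀ β : ℝ, D β =
      (∫ t in (0:ℝ)..β, c (F (t - β)) * g (F (t - β)) / h (F (t - β)) / Real.sqrt t) *
      (∫ t in (0:ℝ)..β, c (F (t - β)) / h (F (t - β)) / Real.sqrt t))
    (β : ℝ) (hβpos : 0 < β) (hβ : ∀ e : ℝ, h e = 0 → β ≠ -G e)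
    (hDdiff : DifferentiableAt ℝ D β)
    (u th : ℝ → ℝ)
    (hstat : IsStationarySolution g h c θ0 (2 * D β) u th)
    (hβth : -G (th (1/2)) = β)
    (A : ℝ → Matrix (Fin 4) (Fin 4) ℝ)
    (hA : ∀ x : ℝ, A x =
      !![0, 1 / g (th x), -(deriv g (th x) * deriv u x / g (th x)), 0;
         0, 0, 0, 0;
         0, 0, -(2 * deriv c (th x) * deriv th x / c (th x)), 1 / c (th x) ^ 2;
         0, h (th x) / g (th x),
           deriv (fun s => h s / g s) (th x) * g (th x) * deriv u x
             + (c (th x) * deriv (deriv c) (th x) - 3 * deriv c (th x) ^ 2)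
               * deriv th x ^ 2,
           2 * deriv c (th x) * deriv th x / c (th x)])
    (Z₁ Z₂ : ℝ → Fin 4 → ℝ)
    (hZ₁ : ∀ x ∈ Set.Icc (0:ℝ) 1,
      HasDerivAt Z₁ (Matrix.mulVec (A x) (Z₁ x)) x)
    (hZ₂ : ∀ x ∈ Set.Icc (0:ℝ) 1,
      HasDerivAt Z₂ (Matrix.mulVec (A x) (Z₂ x)) x)
    (hZ₁0 : Z₁ 0 = ![0, 1, 0, 0]) (hZ₂0 : Z₂ 0 = ![0, 0, 0, 1]) :
    (Matrix.of ![Z₁ 1, Z₂ 1, (![0, 1, 0, 0] : Fin 4 → ℝ),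
        (![0, 0, 0, 1] : Fin 4 → ℝ)]).transpose.det
      = -(2 * β / (g (th 0) * deriv u 0 * c θ0 ^ 2)) * deriv D β := by
  obtain ⟨hu2, hth2, hP, hV, hu0, hu1, hth0, hth1⟩ := hstat
  have hgpos : ∀ θ, 0 < g θ := fun θ => hCbar.trans_le ((hdamp θ).1.trans (hdamp θ).2)
  have hgC : ContDiff ℝ 2 g := by rw [funext hg]; fun_prop
  have hhC : ContDiff ℝ 2 h := by rw [funext hh]; fun_prop
  have hrad : ∀ θ, 0 < K1 * Real.cos θ ^ 2 + K3 * Real.sin θ ^ 2 := by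
    intro θ
    have h1 := Real.sin_sq_add_cos_sq θ
    rcases eq_or_ne (Real.sin θ) 0 with h | h
    · have : Real.cos θ ^ 2 = 1 := by rw [h] at h1; linarith
      rw [this, h]; linarith
    · have := mul_pos hK3 (sq_pos_of_ne_zero h)
      have := mul_nonneg hK1.le (sq_nonneg (Real.cos θ))
      linarith
  have hcC : ContDiff ℝ 2 c := by
    rw [funext hc]
    exact ContDiff.sqrt (by fun_prop) fun x => (hrad x).ne'
  have hcpos : ∀ θ, 0 < c θ := fun θ => by rw [hc]; exact Real.sqrt_pos.2 (hrad θ)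
  have hh0 : ∀ θ, 0 ≤ h θ := by
    intro θ
    have a := Real.cos_le_one (2 * θ)
    have b := Real.neg_one_le_cos (2 * θ)
    rw [hh]
    rcases hcase with e | e <;> rw [e] <;> nlinarith
  have hhz : {θ | h θ = 0}.Countable := by
    rcases hcase with e | e
    · refine (Set.countable_range (fun n : ℤ => (Real.pi + n * (2 * Real.pi)) / 2)).mono ?_
      intro θ hθ
      have hθ' : Real.cos (2 * θ) = -1 := by
        have : h θ = 0 := hθ
        rw [hh, e] at this
        have : γ1 * (1 + Real.cos (2 * θ)) = 0 := by linarith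
        rcases mul_eq_zero.1 this with h | h <;> linarith
      obtain ⟨n, hn⟩ := Real.cos_eq_neg_one_iff.1 hθ'
      exact ⟨n, by simp only; linarith⟩
    · refine (Set.countable_range (fun n : ℤ => (n * (2 * Real.pi)) / 2)).mono ?_
      intro θ hθ
      have hθ' : Real.cos (2 * θ) = 1 := by
        have : h θ = 0 := hθ
        rw [hh, e] at this
        have : γ1 * (1 - Real.cos (2 * θ)) = 0 := by linarith
        rcases mul_eq_zero.1 this with h | h <;> linarith
      obtain ⟨n, hn⟩ := (Real.cos_eq_one_iff _).1 hθ'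
      exact ⟨n, by simp only; linarith⟩
  set ρ : ℝ → ℝ := fun s => h s / g s with hρdef
  have hρC : ContDiff ℝ 2 ρ := hhC.div hgC fun x => (hgpos x).ne'
  have hρz : {θ | ρ θ = 0}.Countable := by
    refine hhz.mono fun θ hθ => ?_
    have : h θ / g θ = 0 := hθ
    exact (div_eq_zero_iff.1 this).resolve_right (hgpos θ).ne'
  have hρ0 : ∀ θ, 0 ≤ ρ θ := fun θ => div_nonneg (hh0 θ) (hgpos θ).le
  have hGd : ∀ θ, HasDerivAt G (ρ θ) θ := by
    intro θ
    rw [funext hG]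
    exact intervalIntegral.integral_hasDerivAt_right (hρC.continuous.intervalIntegrable _ _)
      hρC.continuous.aestronglyMeasurable.stronglyMeasurableAtFilter hρC.continuous.continuousAt
  have hG0 : G θ0 = 0 := by rw [hG]; simp
  have hGm : StrictMono G := by
    have : Monotone G := monotone_of_deriv_nonneg (fun x => (hGd x).differentiableAt)
      (fun x => by rw [(hGd x).deriv]; exact hρ0 x)
    exact this.strictMono_of_injective hF.injective
  have hder : ∀ {f : ℝ → ℝ}, ContDiff ℝ 2 f → ∀ θ, HasDerivAt f (deriv f θ) θ := fun hf θ =>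
    (hf.differentiable (by norm_num) θ).hasDerivAt
  have hder1 : ∀ {f : ℝ → ℝ}, ContDiff ℝ 2 f → ContDiff ℝ 1 (deriv f) := fun {f} hf =>
    (contDiff_succ_iff_deriv.1 (show ContDiff ℝ (1 + 1) f by rw [one_add_one_eq_two]; exact hf)).2.2
  have hdd : ∀ {f : ℝ → ℝ}, ContDiff ℝ 2 f → ∀ θ, HasDerivAt (deriv f) (deriv (deriv f) θ) θ :=
    fun hf θ => ((hder1 hf).differentiable (by norm_num) θ).hasDerivAt
  have hu' := hder hu2
  have hth' := hder hth2
  have hgd := hder hgC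
  have hcd := hder hcC
  have hcdd := hdd hcC
  have hρd := hder hρC
  set p := g (th 0) * deriv u 0 with hp
  have hpc : ∀ x ∈ Icc (0:ℝ) 1, g (th x) * deriv u x = p := by
    refine const_of_deriv0 (f := fun x => g (th x) * deriv u x) fun x hx => ?_
    rw [← hP x hx]
    exact (((hgd (th x)).comp x (hth' x)).mul (hdd hu2 x)).differentiableAt.hasDerivAt
  have hup : ∀ x ∈ Icc (0:ℝ) 1, deriv u x = p / g (th x) := fun x hx => by
    rw [← hpc x hx]; field_simp [(hgpos (th x)).ne']
  set v : ℝ → ℝ := fun x => c (th x) * deriv th x with hvdef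
  have hthv : ∀ x, deriv th x = v x / c (th x) := fun x => by
    have := (hcpos (th x)).ne'
    simp only [hvdef]; field_simp
  have hth : ∀ x ∈ Icc (0:ℝ) 1, HasDerivAt th (v x / c (th x)) x := fun x _ => hthv x ▸ hth' x
  have hv : ∀ x ∈ Icc (0:ℝ) 1, HasDerivAt v (p * (ρ (th x) / c (th x))) x := by
    intro x hx
    have hd : HasDerivAt v (deriv v x) x :=
      (((hcd (th x)).comp x (hth' x)).mul (hdd hth2 x)).differentiableAt.hasDerivAt
    refine hd.congr_deriv ?_
    have e := hV x hx
    rw [hup x hx] at e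
    have := (hcpos (th x)).ne'
    have := (hgpos (th x)).ne'
    simp only [hρdef]
    field_simp
    field_simp at e
    linarith
  have comp : ∀ {Z : ℝ → Fin 4 → ℝ}, (∀ x ∈ Icc (0:ℝ) 1, HasDerivAt Z (Matrix.mulVec (A x) (Z x)) x) →
      ∀ x ∈ Icc (0:ℝ) 1,
        HasDerivAt (fun y => Z y 0) (Z x 1 / g (th x) - p * deriv g (th x) / g (th x) ^ 2
          * (c (th x) * Z x 2 / c (th x))) x ∧
        HasDerivAt (fun y => Z y 1) 0 x ∧
        HasDerivAt (fun y => Z y 2) (-(2 * deriv c (th x) * (v x / c (th x)) / c (th x)) * Z x 2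
          + 1 / c (th x) ^ 2 * Z x 3) x ∧
        HasDerivAt (fun y => Z y 3) (ρ (th x) * Z x 1 + (deriv ρ (th x) * p
          + (c (th x) * deriv (deriv c) (th x) - 3 * deriv c (th x) ^ 2) * (v x / c (th x)) ^ 2)
            * Z x 2 + 2 * deriv c (th x) * (v x / c (th x)) / c (th x) * Z x 3) x := by
    intro Z hZ x hx
    have hz := hasDerivAt_pi.1 (hZ x hx)
    have hcx := (hcpos (th x)).ne'
    have hgx := (hgpos (th x)).ne'
    refine ⟨(hz 0).congr_deriv ?_, (hz 1).congr_deriv ?_, (hz 2).congr_deriv ?_,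
      (hz 3).congr_deriv ?_⟩
    · rw [hA]
      simp [Matrix.mulVec, dotProduct, Fin.sum_univ_four]
      rw [hup x hx]
      field_simp
      ring
    · rw [hA]
      simp [Matrix.mulVec, dotProduct, Fin.sum_univ_four]
    · rw [hA]
      simp [Matrix.mulVec, dotProduct, Fin.sum_univ_four]
      rw [hthv x]
      exact Or.inl rfl
    · rw [hA]
      simp [Matrix.mulVec, dotProduct, Fin.sum_univ_four]
      rw [hthv x, mul_assoc (deriv ρ (th x)), hpc x hx]
  have P1 : ∀ x ∈ Icc (0:ℝ) 1, Z₁ x 1 = 1 := fun x hx => by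
    rw [const_of_deriv0 (f := fun y => Z₁ y 1) (fun x hx => (comp hZ₁ x hx).2.1) x hx, hZ₁0]; simp
  have P2 : ∀ x ∈ Icc (0:ℝ) 1, Z₂ x 1 = 0 := fun x hx => by
    rw [const_of_deriv0 (f := fun y => Z₂ y 1) (fun x hx => (comp hZ₂ x hx).2.1) x hx, hZ₂0]; simp
  have yx1 := fun x (hx : x ∈ Icc (0:ℝ) 1) => YX (P := Z₁ x 1) (ρ1 := deriv ρ)
    (Θ := fun y => Z₁ y 2) (V := fun y => Z₁ y 3) hcpos hcd hcdd (hth x hx) (hv x hx)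
    (comp hZ₁ x hx).2.2.1 (comp hZ₁ x hx).2.2.2
  have yx2 := fun x (hx : x ∈ Icc (0:ℝ) 1) => YX (P := Z₂ x 1) (ρ1 := deriv ρ)
    (Θ := fun y => Z₂ y 2) (V := fun y => Z₂ y 3) hcpos hcd hcdd (hth x hx) (hv x hx)
    (comp hZ₂ x hx).2.2.1 (comp hZ₂ x hx).2.2.2
  have hm : G (th (1/2)) = -β := by linarith
  have hhm : h (th (1/2)) ≠ 0 := fun h0 => hβ _ h0 (by linarith)
  have hDD : ∀ b, D b = (∫ t in (0:ℝ)..b, c (F (t - b)) * 1 / ρ (F (t - b)) / √t) *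
      (∫ t in (0:ℝ)..b, c (F (t - b)) * (1 / g (F (t - b))) / ρ (F (t - b)) / √t) := by
    intro b
    rw [hD]
    have e1 : ∀ s, c s * g s / h s = c s * 1 / ρ s := fun s => by
      simp only [hρdef, mul_one]; rw [div_div_eq_mul_div]
    have e2 : ∀ s, c s / h s = c s * (1 / g s) / ρ s := fun s => by
      have := (hgpos s).ne'
      simp only [hρdef]; rw [div_div_eq_mul_div]; field_simp
    simp only [e1, e2]
  have key := evans_core (κ := fun s => ρ s / c s)
    (κ' := fun s => (deriv ρ s * c s - ρ s * deriv c s) / c s ^ 2)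
    (U1 := fun y => Z₁ y 0) (Y1 := fun y => c (th y) * Z₁ y 2)
    (X1 := fun y => -(deriv c (th y) * (v y / c (th y)) * Z₁ y 2) + Z₁ y 3 / c (th y))
    (U2 := fun y => Z₂ y 0) (Y2 := fun y => c (th y) * Z₂ y 2)
    (X2 := fun y => -(deriv c (th y) * (v y / c (th y)) * Z₂ y 2) + Z₂ y 3 / c (th y))
    hGd hGm hF hF' hρz hρ0 (hcC.of_le (by norm_num)) hcpos hgpos
    (fun θ => by have := (hcpos θ).ne'; field_simp)
    (fun θ => (hρd θ).div (hcd θ) (hcpos θ).ne')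
    ((((hder1 hρC).continuous.mul hcC.continuous).sub
      (hρC.continuous.mul (hder1 hcC).continuous)).div (hcC.continuous.pow 2)
      fun θ => (pow_pos (hcpos θ) 2).ne')
    hgd (hder1 hgC).continuous hG0 hβpos hDD hth hv hth0 hth1 hm
    (div_ne_zero (div_ne_zero hhm (hgpos _).ne') (hcpos _).ne')
    (fun x hx => hup x hx ▸ hu' x) hu0 hu1
    (fun x hx => by have := (comp hZ₁ x hx).1; rwa [P1 x hx] at this)
    (fun x hx => (yx1 x hx).1)
    (fun x hx => by have := (yx1 x hx).2; rwa [P1 x hx, one_mul] at this)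
    (fun x hx => by have := (comp hZ₂ x hx).1; rwa [P2 x hx, zero_div, zero_sub] at this)
    (fun x hx => (yx2 x hx).1)
    (fun x hx => by have := (yx2 x hx).2; rwa [P2 x hx, zero_mul, add_zero] at this)
    (by simp [hZ₁0]) (by simp [hZ₁0]) (by simp [hZ₁0])
    (by simp [hZ₂0]) (by simp [hZ₂0]) (by simp [hZ₂0, hth0])
  rw [← key]
  have hc0 := (hcpos θ0).ne'
  simp only [hth1, mul_div_cancel_left₀ _ hc0]
  rw [Matrix.det_transpose]
  simp [Matrix.det_succ_row_zero, Fin.sum_univ_succ, Fin.succAbove]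
  try ring
end

section
/- Let β > 0 with β ≠ −G(e) for every zero e of h, suppose D is differentiable at β, set ū := 2D(β), and let (u, θ) be a stationary solution with −G(θ(1/2)) = β. Then λ = 0 is an eigenvalue of the linearization along (u, θ) — i.e. there exists a C¹ map Z = (U, P, Θ, Q) : [0,1] → ℝ⁴, not identically zero, with Z′(x) = A(x)Z(x) on [0,1] and U(0) = Θ(0) = U(1) = Θ(1) = 0 — if and only if D′(β) = 0. -/
open Real Set Filter MeasureTheory

lemma invsqrt_int (a b : ℝ) (hab : a ≤ b) :
    IntegrableOn (fun s : ℝ => 1 / √(s - a)) (Ioc a b) := by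
  have h := (intervalIntegral.intervalIntegrable_rpow' (a := 0) (b := b - a) (r := -(1/2))
    (by norm_num)).comp_sub_right a
  rw [intervalIntegrable_iff_integrableOn_Ioc_of_le (by linarith)] at h
  simp only [zero_add, sub_add_cancel] at h
  refine h.congr_fun ?_ measurableSet_Ioc
  intro s hs
  simp only
  rw [Real.rpow_neg (by linarith [hs.1]), ← Real.sqrt_eq_rpow, one_div]

lemma invsqrt_val (a b : ℝ) (hab : a ≤ b) :
    ∫ s in a..b, 1 / √(s - a) = 2 * √(b - a) := by
  have h1 : ∫ s in a..b, 1 / √(s - a) = ∫ s in (0:ℝ)..(b - a), 1 / √s := by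
    rw [intervalIntegral.integral_comp_sub_right (fun s => 1 / √s) a]; simp
  rw [h1]
  have h2 : ∫ s in (0:ℝ)..(b - a), 1 / √s = ∫ s in (0:ℝ)..(b - a), s ^ (-(1/2) : ℝ) := by
    refine intervalIntegral.integral_congr fun s hs => ?_
    rw [uIcc_of_le (by linarith)] at hs
    rw [Real.rpow_neg hs.1, ← Real.sqrt_eq_rpow, one_div]
  rw [h2, integral_rpow (Or.inl (by norm_num)), Real.sqrt_eq_rpow, Real.zero_rpow (by norm_num)]
  norm_num
  ring

lemma dom_int (M w : ℝ → ℝ) (a b A B : ℝ) (hab : a ≤ b) (hM : IntegrableOn M (Ioc a b))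
    (hw : Measurable w)
    (hb : ∀ s ∈ Ioc a b, |M s / w s| ≤ A / √(s - a) + B * |M s|) :
    IntegrableOn (fun s => M s / w s) (Ioc a b) := by
  have h1 : IntegrableOn (fun s => A / √(s - a) + B * |M s|) (Ioc a b) := by
    refine Integrable.add ?_ (hM.abs.const_mul B)
    have := (invsqrt_int a b hab).const_mul A
    simpa only [mul_one_div] using this
  refine h1.mono' ?_ ?_
  · exact (hM.aestronglyMeasurable.aemeasurable.div hw.aemeasurable).aestronglyMeasurable
  · exact (ae_restrict_iff' measurableSet_Ioc).2 (Eventually.of_forall fun s hs => hb s hs)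

lemma A1 (M : ℝ → ℝ) (β δ C : ℝ) (hβ : 0 < β) (hδ : 0 < δ) (hC : 0 ≤ C)
    (hM : IntegrableOn M (Ioc 0 β)) (hb : ∀ s ∈ Ioc 0 δ, |M s| ≤ C * s) :
    IntegrableOn (fun s => M s / (s * √s)) (Ioc 0 β) := by
  refine dom_int M (fun s => s * √s) 0 β C (1 / (δ * √δ)) hβ.le hM (by fun_prop) ?_
  intro s hs
  have hs0 := hs.1
  have hq : 0 < √s := Real.sqrt_pos.2 hs0
  have hqd : 0 < √δ := Real.sqrt_pos.2 hδ
  rw [sub_zero, abs_div, abs_of_pos (mul_pos hs0 hq)]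
  rcases le_total s δ with h | h
  · have : |M s| / (s * √s) ≤ C / √s := by
      rw [div_le_div_iff₀ (by positivity) hq]
      nlinarith [mul_le_mul_of_nonneg_right (hb s ⟨hs0, h⟩) hq.le]
    have : 0 ≤ 1 / (δ * √δ) * |M s| := by positivity
    linarith
  · have : |M s| / (s * √s) ≤ 1 / (δ * √δ) * |M s| := by
      rw [one_div_mul_eq_div]
      gcongr
    have : 0 ≤ C / √s := by positivity
    linarith

lemma A2 (M : ℝ → ℝ) (β δ C ε : ℝ) (hε : 0 ≤ ε) (hεδ : ε < δ / 2) (hεβ : ε ≤ β) (hC : 0 ≤ C)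
    (hM : IntegrableOn M (Ioc 0 β)) (hb : ∀ s ∈ Ioc 0 δ, |M s| ≤ C * s) :
    IntegrableOn (fun s => M s / √(s - ε)) (Ioc ε β) := by
  refine dom_int M (fun s => √(s - ε)) ε β (C * δ) (1 / √(δ/2)) hεβ
    (hM.mono_set (Ioc_subset_Ioc_left hε)) (by fun_prop) ?_
  intro s hs
  have hs0 := hs.1
  have hq : 0 < √(s - ε) := Real.sqrt_pos.2 (by linarith)
  have hqd : 0 < √(δ/2) := Real.sqrt_pos.2 (by linarith)
  rw [abs_div, abs_of_pos hq]
  have hd : 0 < δ := by linarith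
  rcases le_total s δ with h | h
  · have : |M s| / √(s - ε) ≤ C * δ / √(s - ε) := by
      gcongr
      exact (hb s ⟨by linarith, h⟩).trans (by gcongr)
    have : 0 ≤ 1 / √(δ/2) * |M s| := by positivity
    linarith
  · have : |M s| / √(s - ε) ≤ 1 / √(δ/2) * |M s| := by
      rw [one_div_mul_eq_div]
      gcongr
      linarith
    have : 0 ≤ C * δ / √(s - ε) := by positivity
    linarith

lemma sqrt_diff (s ε : ℝ) (hε : 0 < ε) (hs : 2 * ε < s) :
    (1 / √(s - ε) - 1 / √s) / ε = 1 / (√(s - ε) * √s * (√s + √(s - ε))) := by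
  have h1 : 0 < √(s - ε) := Real.sqrt_pos.2 (by linarith)
  have h2 : 0 < √s := Real.sqrt_pos.2 (by linarith)
  have e1 := Real.sq_sqrt (show 0 ≤ s - ε by linarith)
  have e2 := Real.sq_sqrt (show 0 ≤ s by linarith)
  field_simp
  nlinarith

lemma A3 (M : ℝ → ℝ) (β δ C : ℝ) (hβ : 0 < β) (hδ : 0 < δ) (hC : 0 ≤ C)
    (hM : IntegrableOn M (Ioc 0 β)) (hb : ∀ s ∈ Ioc 0 δ, |M s| ≤ C * s) :
    Tendsto (fun ε => ∫ s in Ioc 0 β, (Ioi (2 * ε)).indicator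
        (fun s => M s * ((1 / √(s - ε) - 1 / √s) / ε)) s) (nhdsWithin 0 (Ioi 0))
      (nhds (∫ s in Ioc 0 β, 1/2 * (M s / (s * √s)))) := by
  refine tendsto_integral_filter_of_dominated_convergence (fun s => 2 * |M s / (s * √s)|) ?_ ?_ ?_ ?_
  · refine Eventually.of_forall fun ε => ?_
    refine AEStronglyMeasurable.indicator ?_ measurableSet_Ioi
    refine AEMeasurable.aestronglyMeasurable ?_
    refine hM.aestronglyMeasurable.aemeasurable.mul ?_
    apply Measurable.aemeasurable
    fun_prop
  · filter_upwards [self_mem_nhdsWithin] with ε hε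
    have hε : 0 < ε := hε
    refine (ae_restrict_iff' measurableSet_Ioc).2 (Eventually.of_forall fun s hs => ?_)
    by_cases h : s ∈ Ioi (2 * ε)
    · rw [indicator_of_mem h]
      have h : 2 * ε < s := h
      rw [sqrt_diff s ε hε h, norm_eq_abs, abs_mul, div_eq_mul_one_div (M s), abs_mul (M s), mul_left_comm 2]
      have hs0 := hs.1
      have hq : 0 < √s := Real.sqrt_pos.2 hs0
      have h1 : 0 < √(s - ε) := Real.sqrt_pos.2 (by linarith)
      gcongr
      rw [abs_of_pos (by positivity), abs_of_pos (by positivity), mul_one_div,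
        div_le_div_iff₀ (by positivity) (by positivity)]
      have e1 := Real.sq_sqrt (show 0 ≤ s - ε by linarith)
      have e2 := Real.sq_sqrt (show 0 ≤ s by linarith)
      have h2 : √s ≤ 2 * √(s - ε) := by
        rw [show 2 * √(s - ε) = √(4 * (s - ε)) by
          rw [Real.sqrt_mul (by norm_num), show (4:ℝ) = 2 ^ 2 by norm_num, Real.sqrt_sq (by norm_num)]]
        apply Real.sqrt_le_sqrt; linarith
      have h3 : s ≤ 2 * √(s - ε) * √s := by nlinarith
      have h4 : s * √s ≤ 2 * √(s - ε) * √s * √s := by nlinarith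
      nlinarith [mul_pos (mul_pos h1 hq) h1]
    · rw [indicator_of_notMem h]; simp
  · exact (A1 M β δ C hβ hδ hC hM hb).abs.const_mul 2
  · refine (ae_restrict_iff' measurableSet_Ioc).2 (Eventually.of_forall fun s hs => ?_)
    have hs0 := hs.1
    have hq : 0 < √s := Real.sqrt_pos.2 hs0
    have h1 : Tendsto (fun ε => M s * (1 / (√(s - ε) * √s * (√s + √(s - ε))))) (nhdsWithin 0 (Ioi 0))
        (nhds (M s * (1 / (√(s - 0) * √s * (√s + √(s - 0)))))) := by
      apply Tendsto.mono_left _ nhdsWithin_le_nhds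
      have : ContinuousAt (fun ε => M s * (1 / (√(s - ε) * √s * (√s + √(s - ε))))) 0 := by
        have : √(s - 0) * √s * (√s + √(s - 0)) ≠ 0 := by rw [sub_zero]; positivity
        fun_prop (disch := assumption)
      exact this
    have e : 1/2 * (M s / (s * √s)) = M s * (1 / (√(s - 0) * √s * (√s + √(s - 0)))) := by
      rw [sub_zero]
      have e2 := Real.sq_sqrt (show 0 ≤ s by linarith)
      field_simp
      rw [e2]; ring
    rw [e]
    refine h1.congr' ?_
    filter_upwards [self_mem_nhdsWithin, nhdsWithin_le_nhds (Iio_mem_nhds (show 0 < s/2 by linarith))]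
      with ε h1 h2
    have h2 : ε < s / 2 := h2
    rw [indicator_of_mem (show s ∈ Ioi (2 * ε) by simp; linarith), sqrt_diff s ε h1 (by linarith)]

lemma A4 (M : ℝ → ℝ) (β δ C : ℝ) (hβ : 0 < β) (hδ : 0 < δ) (hC : 0 ≤ C)
    (hM : IntegrableOn M (Ioc 0 β)) (hb : ∀ s ∈ Ioc 0 δ, |M s| ≤ C * s) :
    Tendsto (fun ε => ((∫ s in ε..β, M s / √(s - ε)) - ∫ s in (0:ℝ)..β, M s / √s) / ε)
      (nhdsWithin 0 (Ioi 0)) (nhds (1/2 * ∫ s in (0:ℝ)..β, M s / (s * √s))) := by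
  have hA3 := A3 M β δ C hβ hδ hC hM hb
  rw [integral_const_mul, ← intervalIntegral.integral_of_le hβ.le] at hA3
  have hz : Tendsto (fun ε : ℝ => 4 * C * √ε + 4 * C * √(2 * ε)) (nhdsWithin 0 (Ioi 0)) (nhds 0) := by
    apply Tendsto.mono_left _ nhdsWithin_le_nhds
    have : ContinuousAt (fun ε : ℝ => 4 * C * √ε + 4 * C * √(2 * ε)) 0 := by fun_prop
    simpa [ContinuousAt] using this
  have key : Tendsto (fun ε => ((∫ s in ε..(2*ε), M s / √(s - ε)) - ∫ s in (0:ℝ)..(2*ε), M s / √s) / ε)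
      (nhdsWithin 0 (Ioi 0)) (nhds 0) := by
    refine squeeze_zero_norm' ?_ hz
    filter_upwards [self_mem_nhdsWithin, nhdsWithin_le_nhds (Iio_mem_nhds (show 0 < δ/2 by linarith))]
      with ε hε hεd
    have hε : 0 < ε := hε
    have hεd : ε < δ/2 := hεd
    have b1 : ‖∫ s in ε..(2*ε), M s / √(s - ε)‖ ≤ ∫ s in ε..(2*ε), (C * (2 * ε)) * (1 / √(s - ε)) := by
      refine intervalIntegral.norm_integral_le_of_norm_le (by linarith) ?_ ?_
      · refine Eventually.of_forall fun s hs => ?_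
        have hq : 0 < √(s - ε) := Real.sqrt_pos.2 (by linarith [hs.1])
        rw [norm_div, norm_eq_abs, norm_eq_abs, abs_of_pos hq, mul_one_div]
        gcongr
        exact (hb s ⟨by linarith [hs.1], by linarith [hs.2]⟩).trans (by gcongr; exact hs.2)
      · rw [intervalIntegrable_iff_integrableOn_Ioc_of_le (by linarith)]
        exact (invsqrt_int _ _ (by linarith)).const_mul _
    have b2 : ‖∫ s in (0:ℝ)..(2*ε), M s / √s‖ ≤ ∫ s in (0:ℝ)..(2*ε), (C * (2 * ε)) * (1 / √(s - 0)) := by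
      refine intervalIntegral.norm_integral_le_of_norm_le (by linarith) ?_ ?_
      · refine Eventually.of_forall fun s hs => ?_
        rw [sub_zero]
        have hq : 0 < √s := Real.sqrt_pos.2 hs.1
        rw [norm_div, norm_eq_abs, norm_eq_abs, abs_of_pos hq, mul_one_div]
        gcongr
        exact (hb s ⟨by linarith [hs.1], by linarith [hs.2]⟩).trans (by gcongr; exact hs.2)
      · rw [intervalIntegrable_iff_integrableOn_Ioc_of_le (by linarith)]
        exact (invsqrt_int _ _ (by linarith)).const_mul _
    rw [intervalIntegral.integral_const_mul, invsqrt_val _ _ (by linarith)] at b1 b2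
    rw [show 2 * ε - ε = ε by ring] at b1
    rw [sub_zero] at b2
    rw [norm_div, norm_eq_abs ε, abs_of_pos hε, div_le_iff₀ hε]
    refine (norm_sub_le _ _).trans ?_
    nlinarith
  have := key.add hA3
  rw [zero_add] at this
  refine this.congr' ?_
  filter_upwards [self_mem_nhdsWithin, nhdsWithin_le_nhds (Iio_mem_nhds (show 0 < δ/2 by linarith)),
    nhdsWithin_le_nhds (Iio_mem_nhds (show 0 < β/2 by linarith))] with ε hε hεd hεβ
  have hε : 0 < ε := hε
  have hεd : ε < δ/2 := hεd
  have hεβ : ε < β/2 := hεβ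
  have i1 := A2 M β δ C ε hε.le hεd (by linarith) hC hM hb
  have i0 := A2 M β δ C 0 le_rfl (by linarith) hβ.le hC hM hb
  simp only [sub_zero] at i0
  have j1 : IntervalIntegrable (fun s => M s / √(s - ε)) volume ε (2 * ε) := by
    rw [intervalIntegrable_iff_integrableOn_Ioc_of_le (by linarith)]
    exact i1.mono_set (Ioc_subset_Ioc_right (by linarith))
  have j2 : IntervalIntegrable (fun s => M s / √(s - ε)) volume (2 * ε) β := by
    rw [intervalIntegrable_iff_integrableOn_Ioc_of_le (by linarith)]
    exact i1.mono_set (Ioc_subset_Ioc_left (by linarith))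
  have j3 : IntervalIntegrable (fun s => M s / √s) volume 0 (2 * ε) := by
    rw [intervalIntegrable_iff_integrableOn_Ioc_of_le (by linarith)]
    exact i0.mono_set (Ioc_subset_Ioc_right (by linarith))
  have j4 : IntervalIntegrable (fun s => M s / √s) volume (2 * ε) β := by
    rw [intervalIntegrable_iff_integrableOn_Ioc_of_le (by linarith)]
    exact i0.mono_set (Ioc_subset_Ioc_left (by linarith))
  have e : ∫ s in Ioc 0 β, (Ioi (2 * ε)).indicator (fun s => M s * ((1 / √(s - ε) - 1 / √s) / ε)) s
      = ((∫ s in (2*ε)..β, M s / √(s - ε)) - ∫ s in (2*ε)..β, M s / √s) / ε := by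
    rw [setIntegral_indicator measurableSet_Ioi,
      show Ioc 0 β ∩ Ioi (2 * ε) = Ioc (2 * ε) β by
        ext x; simp only [mem_inter_iff, mem_Ioc, mem_Ioi]
        constructor
        · rintro ⟨⟨a, b⟩, c⟩; exact ⟨c, b⟩
        · rintro ⟨a, b⟩; exact ⟨⟨by linarith, b⟩, a⟩,
      ← intervalIntegral.integral_of_le (by linarith), ← intervalIntegral.integral_sub j2 j4,
      ← intervalIntegral.integral_div]
    congr 1; ext s; ring
  rw [e, ← intervalIntegral.integral_add_adjacent_intervals j1 j2,
    ← intervalIntegral.integral_add_adjacent_intervals j3 j4]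
  ring

/-- differentiation of the Abel-type integral -/
lemma A5 (N : ℝ → ℝ) (β δ C μ : ℝ) (hβ : 0 < β) (hδ : 0 < δ) (hC : 0 ≤ C)
    (hN : IntegrableOn N (Ioc 0 β)) (hb : ∀ s ∈ Ioc 0 δ, |N s - μ| ≤ C * s) :
    Tendsto (fun ε => ((∫ s in ε..β, N s / √(s - ε)) - ∫ s in (0:ℝ)..β, N s / √s) / ε)
      (nhdsWithin 0 (Ioi 0))
      (nhds (1/2 * (∫ s in (0:ℝ)..β, (N s - μ) / (s * √s)) - μ / √β)) := by
  have hM : IntegrableOn (fun s => N s - μ) (Ioc 0 β) := hN.sub (by simp)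
  have h4 := A4 (fun s => N s - μ) β δ C hβ hδ hC hM hb
  have hd : HasDerivAt (fun ε => 2 * μ * √(β - ε)) (- (μ / √β)) 0 := by
    have h1 : HasDerivAt (fun ε : ℝ => β - ε) (-1) 0 := by
      simpa using (hasDerivAt_id (0:ℝ)).const_sub β
    have h2 := (h1.sqrt (by simpa using hβ.ne')).const_mul (2 * μ)
    have h3 : -(μ / √β) = 2 * μ * (-1 / (2 * √(β - 0))) := by
      rw [sub_zero]; field_simp
    rw [h3]; exact h2
  have h5 : Tendsto (fun ε => (2 * μ * √(β - ε) - 2 * μ * √β) / ε) (nhdsWithin 0 (Ioi 0))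
      (nhds (- (μ / √β))) := by
    have := hd.tendsto_slope.mono_left (nhdsWithin_mono _ (fun x (hx : 0 < x) => hx.ne'))
    refine this.congr fun ε => ?_
    simp [slope_def_field]
  have h6 := h4.add h5
  rw [← sub_eq_add_neg] at h6
  refine h6.congr' ?_
  filter_upwards [self_mem_nhdsWithin, nhdsWithin_le_nhds (Iio_mem_nhds (show 0 < δ/2 by linarith)),
    nhdsWithin_le_nhds (Iio_mem_nhds (show 0 < β/2 by linarith))] with ε hε hεd hεβ
  have hε : 0 < ε := hε
  have hεd : ε < δ/2 := hεd
  have hεβ : ε < β/2 := hεβ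
  have key : ∀ ε : ℝ, 0 ≤ ε → ε < δ / 2 → ε < β / 2 →
      ∫ s in ε..β, N s / √(s - ε) = (∫ s in ε..β, (N s - μ) / √(s - ε)) + 2 * μ * √(β - ε) := by
    intro ε hε hεd hεβ
    have i1 := A2 _ β δ C ε hε hεd (by linarith) hC hM hb
    rw [← intervalIntegrable_iff_integrableOn_Ioc_of_le (by linarith)] at i1
    have i2 := (invsqrt_int ε β (by linarith)).const_mul μ
    rw [← IntegrableOn, ← intervalIntegrable_iff_integrableOn_Ioc_of_le (by linarith)] at i2
    have : 2 * μ * √(β - ε) = ∫ s in ε..β, μ * (1 / √(s - ε)) := by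
      rw [intervalIntegral.integral_const_mul, invsqrt_val _ _ (by linarith)]; ring
    rw [this, ← intervalIntegral.integral_add i1 i2]
    congr 1; ext s; ring
  have k0 := key 0 le_rfl (by linarith) (by linarith)
  simp only [sub_zero] at k0
  rw [key ε hε.le hεd hεβ, k0]
  ring

/-- the nonlinearity -/
noncomputable def ff (g h c : ℝ → ℝ) (θ : ℝ) : ℝ := h θ / (g θ * c θ)

/-- the momentum -/
noncomputable def ph (c th : ℝ → ℝ) (x : ℝ) : ℝ := c (th x) * deriv th x

structure Ctx (g h c G F th : ℝ → ℝ) (p β θ0 : ℝ) : Prop where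
  gpos : ∀ x, 0 < g x
  hnn : ∀ x, 0 ≤ h x
  cpos : ∀ x, 0 < c x
  gC : ContDiff ℝ 2 g
  hC : ContDiff ℝ 2 h
  cC : ContDiff ℝ 2 c
  hcount : {x | h x = 0}.Countable
  Gd : ∀ x, HasDerivAt G (h x / g x) x
  hF : Function.LeftInverse F G
  hF' : Function.RightInverse F G
  thC : ContDiff ℝ 2 th
  ppos : 0 < p
  bpos : 0 < β
  phd : ∀ x ∈ Icc (0:ℝ) 1, HasDerivAt (ph c th) (p * ff g h c (th x)) x
  th0 : th 0 = θ0
  th1 : th 1 = θ0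
  G0 : G θ0 = 0
  Gm : G (th (1/2)) = -β
  hm : h (th (1/2)) ≠ 0

lemma const_Icc {f : ℝ → ℝ} (hf : ∀ x ∈ Icc (0:ℝ) 1, HasDerivAt f 0 x) {x y : ℝ}
    (hx : x ∈ Icc (0:ℝ) 1) (hy : y ∈ Icc (0:ℝ) 1) : f x = f y := by
  have h := constant_of_has_deriv_right_zero (f := f) (a := 0) (b := 1)
    (fun z hz => (hf z hz).continuousAt.continuousWithinAt)
    (fun z hz => (hf z ⟨hz.1, hz.2.le⟩).hasDerivWithinAt)
  rw [h x hx, h y hy]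

namespace Ctx
variable {g h c G F th : ℝ → ℝ} {p β θ0 : ℝ}

lemma ffC (C : Ctx g h c G F th p β θ0) : ContDiff ℝ 2 (ff g h c) :=
  C.hC.div (C.gC.mul C.cC) (fun x => (mul_pos (C.gpos x) (C.cpos x)).ne')

lemma ffd (C : Ctx g h c G F th p β θ0) (x : ℝ) :
    HasDerivAt (ff g h c) (deriv (ff g h c) x) x :=
  ((C.ffC.differentiable (by norm_num)) x).hasDerivAt

lemma ffnn (C : Ctx g h c G F th p β θ0) (x : ℝ) : 0 ≤ ff g h c x :=
  div_nonneg (C.hnn x) (mul_pos (C.gpos x) (C.cpos x)).le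

lemma ffm (C : Ctx g h c G F th p β θ0) : 0 < ff g h c (th (1/2)) :=
  div_pos (lt_of_le_of_ne (C.hnn _) (Ne.symm C.hm)) (mul_pos (C.gpos _) (C.cpos _))

lemma hg_eq (C : Ctx g h c G F th p β θ0) (x : ℝ) : h x / g x = ff g h c x * c x := by
  have := (C.gpos x).ne'
  have := (C.cpos x).ne'
  unfold ff; field_simp

lemma thd (C : Ctx g h c G F th p β θ0) (x : ℝ) :
    HasDerivAt th (ph c th x / c (th x)) x := by
  have h1 : ph c th x / c (th x) = deriv th x := by
    have := (C.cpos (th x)).ne'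
    unfold ph; field_simp
  rw [h1]
  exact ((C.thC.differentiable (by norm_num)) x).hasDerivAt

lemma thcont (C : Ctx g h c G F th p β θ0) : Continuous th := C.thC.continuous

lemma phcont (C : Ctx g h c G F th p β θ0) : Continuous (ph c th) :=
  (C.cC.continuous.comp C.thcont).mul (C.thC.continuous_deriv (by norm_num))

lemma Gthd (C : Ctx g h c G F th p β θ0) (x : ℝ) :
    HasDerivAt (fun x => G (th x)) (ff g h c (th x) * ph c th x) x := by
  have h1 := (C.Gd (th x)).comp x (C.thd x)
  have := (C.cpos (th x)).ne'
  rw [C.hg_eq] at h1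
  exact h1.congr_deriv (by field_simp)

lemma phmono (C : Ctx g h c G F th p β θ0) : MonotoneOn (ph c th) (Icc 0 1) := by
  refine monotoneOn_of_deriv_nonneg (convex_Icc 0 1) C.phcont.continuousOn ?_ ?_
  · intro x hx
    exact (C.phd x (interior_subset hx)).differentiableAt.differentiableWithinAt
  · intro x hx
    rw [(C.phd x (interior_subset hx)).deriv]
    exact mul_nonneg C.ppos.le (C.ffnn _)

lemma energy0 (C : Ctx g h c G F th p β θ0) {x y : ℝ} (hx : x ∈ Icc (0:ℝ) 1)
    (hy : y ∈ Icc (0:ℝ) 1) :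
    ph c th x ^ 2 - 2 * p * G (th x) = ph c th y ^ 2 - 2 * p * G (th y) := by
  refine const_Icc (f := fun x => ph c th x ^ 2 - 2 * p * G (th x)) ?_ hx hy
  intro x hx
  have h1 := ((C.phd x hx).pow 2).sub ((C.Gthd x).const_mul (2 * p))
  exact h1.congr_deriv (by simp; ring)

lemma half_mem : (1/2 : ℝ) ∈ Icc (0:ℝ) 1 := by constructor <;> norm_num

lemma ph_const_false (C : Ctx g h c G F th p β θ0) {a b : ℝ} (ha : 0 ≤ a) (ha' : a ≤ 1/2)
    (hb : 1/2 ≤ b) (hb' : b ≤ 1) (hab : a < b) (he : ph c th a = ph c th b) : False := by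
  have hc : ∀ x ∈ Icc a b, ph c th x = ph c th (1/2) := by
    have aux : ∀ x ∈ Icc a b, ph c th x = ph c th a := by
      intro x hx
      have h1 := C.phmono ⟨ha, by linarith⟩ ⟨ha.trans hx.1, hx.2.trans hb'⟩ hx.1
      have h2 := C.phmono ⟨ha.trans hx.1, hx.2.trans hb'⟩ ⟨by linarith, hb'⟩ hx.2
      linarith
    intro x hx
    rw [aux x hx, aux (1/2) ⟨ha', hb⟩]
  have hd := (C.phd (1/2) half_mem).hasDerivWithinAt (s := Icc a b)
  have hd0 : HasDerivWithinAt (ph c th) 0 (Icc a b) (1/2) :=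
    (hasDerivWithinAt_const (1/2 : ℝ) (Icc a b) (ph c th (1/2))).congr hc rfl
  have hu := (uniqueDiffOn_Icc hab (1/2) ⟨ha', hb⟩).eq_deriv _ hd hd0
  have := mul_pos C.ppos C.ffm
  linarith

lemma ph0 (C : Ctx g h c G F th p β θ0) : ph c th 0 = - ph c th 1 := by
  have h1 := C.energy0 (x := 0) (y := 1) (by simp) (by simp)
  rw [C.th0, C.th1] at h1
  have h2 : (ph c th 0 - ph c th 1) * (ph c th 0 + ph c th 1) = 0 := by linarith
  rcases mul_eq_zero.1 h2 with h | h
  · exact (C.ph_const_false (a := 0) (b := 1) le_rfl (by norm_num) (by norm_num) le_rfl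
      (by norm_num) (by linarith)).elim
  · linarith

lemma symm (C : Ctx g h c G F th p β θ0) : ∀ x ∈ Icc (0:ℝ) 1,
    th (1 - x) = th x ∧ ph c th (1 - x) = - ph c th x := by
  let v : ℝ → ℝ × ℝ → ℝ × ℝ := fun _ z => (z.2 / c z.1, p * ff g h c z.1)
  have hv : ContDiff ℝ 1 (v 0) := by
    have hc1 : ContDiff ℝ 1 (fun z : ℝ × ℝ => c z.1) := (C.cC.of_le (by norm_num)).comp contDiff_fst
    have hf1 : ContDiff ℝ 1 (fun z : ℝ × ℝ => ff g h c z.1) :=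
      (C.ffC.of_le (by norm_num)).comp contDiff_fst
    exact (contDiff_snd.div hc1 (fun z => (C.cpos _).ne')).prodMk (contDiff_const.mul hf1)
  let f1 : ℝ → ℝ × ℝ := fun x => (th x, ph c th x)
  let f2 : ℝ → ℝ × ℝ := fun x => (th (1 - x), - ph c th (1 - x))
  have f1c : Continuous f1 := C.thcont.prodMk C.phcont
  have f2c : Continuous f2 := (C.thcont.comp (by fun_prop)).prodMk (C.phcont.comp (by fun_prop)).neg
  obtain ⟨R, hR⟩ := ((isCompact_Icc (a := (0:ℝ)) (b := 1)).image f1c).isBounded.subset_closedBall 0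
  have hR1 : ∀ x ∈ Icc (0:ℝ) 1, f1 x ∈ Metric.closedBall (0 : ℝ × ℝ) R :=
    fun x hx => hR (mem_image_of_mem _ hx)
  have hR2 : ∀ x ∈ Icc (0:ℝ) 1, f2 x ∈ Metric.closedBall (0 : ℝ × ℝ) R := by
    intro x hx
    have := hR1 (1 - x) ⟨by linarith [hx.2], by linarith [hx.1]⟩
    simpa [f1, f2, Prod.norm_def] using this
  obtain ⟨K, hK⟩ := (hv.contDiffOn (s := Metric.closedBall (0 : ℝ × ℝ) R)).exists_lipschitzOnWith
    (by norm_num) (convex_closedBall _ _) (isCompact_closedBall _ _)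
  have hE : EqOn f1 f2 (Icc 0 1) := by
    refine ODE_solution_unique_of_mem_Icc_right (v := v) (s := fun _ => Metric.closedBall 0 R)
      (K := K) (fun t _ => hK) f1c.continuousOn ?_ (fun t ht => hR1 t ⟨ht.1, ht.2.le⟩)
      f2c.continuousOn ?_ (fun t ht => hR2 t ⟨ht.1, ht.2.le⟩) ?_
    · intro t ht
      exact ((C.thd t).prodMk (C.phd t ⟨ht.1, ht.2.le⟩)).hasDerivWithinAt
    · intro t ht
      have hr : HasDerivAt (fun x : ℝ => 1 - x) (-1) t := by
        simpa using (hasDerivAt_id t).const_sub 1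
      have h1 := (C.thd (1 - t)).comp t hr
      have h2 := ((C.phd (1 - t) ⟨by linarith [ht.2], by linarith [ht.1]⟩).comp t hr).neg
      have h3 := (h1.prodMk h2).hasDerivWithinAt (s := Ici t)
      have e : v t (f2 t) = (ph c th (1 - t) / c (th (1 - t)) * -1,
          -(p * ff g h c (th (1 - t)) * -1)) := by
        simp only [v, f2, Prod.mk.injEq]; constructor <;> ring
      rw [e]; exact h3
    · simp [f1, f2, C.th0, C.th1, C.ph0]
  intro x hx
  have := hE hx
  simp only [f1, f2, Prod.mk.injEq] at this
  exact ⟨this.1.symm, by linarith [this.2]⟩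

lemma phhalf (C : Ctx g h c G F th p β θ0) : ph c th (1/2) = 0 := by
  have := (C.symm (1/2) half_mem).2
  norm_num at this
  norm_num
  linarith

lemma energy (C : Ctx g h c G F th p β θ0) {x : ℝ} (hx : x ∈ Icc (0:ℝ) 1) :
    ph c th x ^ 2 = 2 * p * (G (th x) + β) := by
  have := C.energy0 hx half_mem
  rw [C.phhalf, C.Gm] at this
  linarith

lemma phpos (C : Ctx g h c G F th p β θ0) {x : ℝ} (hx : x ∈ Ioc (1/2 : ℝ) 1) :
    0 < ph c th x := by
  have hx1 := hx.1
  have h1 := C.phmono half_mem (show x ∈ Icc (0:ℝ) 1 from ⟨by linarith, hx.2⟩) hx.1.le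
  rw [C.phhalf] at h1
  refine lt_of_le_of_ne h1 fun h2 => ?_
  exact C.ph_const_false (a := 1/2) (b := x) (by norm_num) le_rfl hx.1.le hx.2 hx.1
    (by rw [C.phhalf, h2])

lemma phne (C : Ctx g h c G F th p β θ0) {x : ℝ} (hx : x ∈ Icc (0 : ℝ) 1) (hne : x ≠ 1/2) :
    ph c th x ≠ 0 := by
  rcases lt_or_gt_of_ne hne with h | h
  · have := C.phpos (x := 1 - x) ⟨by linarith, by linarith [hx.1]⟩
    rw [(C.symm x hx).2] at this
    linarith
  · exact (C.phpos ⟨h, hx.2⟩).ne'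

lemma Ginj (C : Ctx g h c G F th p β θ0) : Function.Injective G := C.hF.injective

lemma Gmono (C : Ctx g h c G F th p β θ0) : StrictMono G := by
  refine Monotone.strictMono_of_injective ?_ C.Ginj
  refine monotone_of_deriv_nonneg (fun x => (C.Gd x).differentiableAt) fun x => ?_
  rw [(C.Gd x).deriv]
  exact div_nonneg (C.hnn x) (C.gpos x).le

lemma thne (C : Ctx g h c G F th p β θ0) {x : ℝ} (hx : x ∈ Icc (0 : ℝ) 1) (hne : x ≠ 1/2) :
    th x ≠ th (1/2) := by
  intro he
  have := C.energy hx
  rw [he, C.Gm] at this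
  exact C.phne hx hne (by simpa using this)

end Ctx

/-- divided difference of `q` with respect to `G` at `m` -/
noncomputable def rho (G : ℝ → ℝ) (m : ℝ) (q : ℝ → ℝ) (θ : ℝ) : ℝ :=
  dslope q m θ / dslope G m θ

namespace Ctx
variable {g h c G F th : ℝ → ℝ} {p β θ0 : ℝ}

lemma dslope_cont {q : ℝ → ℝ} (hq : Differentiable ℝ q) (m : ℝ) : Continuous (dslope q m) := by
  rw [continuous_iff_continuousAt]
  intro x
  by_cases hx : x = m
  · subst hx; exact continuousAt_dslope_same.2 (hq x)
  · exact (continuousAt_dslope_of_ne hx).2 (hq x).continuousAt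

lemma dslopeG_ne (C : Ctx g h c G F th p β θ0) (θ : ℝ) : dslope G (th (1/2)) θ ≠ 0 := by
  by_cases hx : θ = th (1/2)
  · rw [hx, dslope_same, (C.Gd _).deriv]
    exact div_ne_zero C.hm (C.gpos _).ne'
  · rw [dslope_of_ne _ hx, slope_def_field]
    exact div_ne_zero (sub_ne_zero.2 (fun e => hx (C.Ginj e))) (sub_ne_zero.2 hx)

lemma rho_cont (C : Ctx g h c G F th p β θ0) {q : ℝ → ℝ} (hq : Differentiable ℝ q) :
    Continuous (rho G (th (1/2)) q) :=
  (dslope_cont hq _).div (dslope_cont (fun x => (C.Gd x).differentiableAt) _) C.dslopeG_ne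

lemma rho_eq (C : Ctx g h c G F th p β θ0) (q : ℝ → ℝ) (θ : ℝ) :
    q θ - q (th (1/2)) = rho G (th (1/2)) q θ * (G θ + β) := by
  have h1 := sub_smul_dslope q (th (1/2)) θ
  have h2 := sub_smul_dslope G (th (1/2)) θ
  rw [C.Gm, sub_neg_eq_add] at h2
  have h3 := C.dslopeG_ne θ
  rw [← h1, ← h2, rho]
  simp only [smul_eq_mul]
  field_simp

lemma rho_m (C : Ctx g h c G F th p β θ0) (q : ℝ → ℝ) :
    rho G (th (1/2)) q (th (1/2)) * (ff g h c (th (1/2)) * c (th (1/2))) = deriv q (th (1/2)) := by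
  have h3 := C.dslopeG_ne (th (1/2))
  rw [dslope_same, (C.Gd _).deriv] at h3
  rw [rho, dslope_same, dslope_same, (C.Gd _).deriv, ← C.hg_eq,
    div_mul_cancel₀ _ h3]

lemma th_mono (C : Ctx g h c G F th p β θ0) : StrictMonoOn th (Icc (1/2) 1) := by
  refine strictMonoOn_of_deriv_pos (convex_Icc _ _) C.thcont.continuousOn ?_
  intro x hx
  rw [interior_Icc] at hx
  rw [(C.thd x).deriv]
  exact div_pos (C.phpos ⟨hx.1, hx.2.le⟩) (C.cpos _)

lemma s_mono (C : Ctx g h c G F th p β θ0) : StrictMonoOn (fun x => G (th x) + β) (Icc (1/2) 1) := by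
  intro x hx y hy hxy
  have := C.Gmono (C.th_mono hx hy hxy)
  simp only; linarith

lemma s_image (C : Ctx g h c G F th p β θ0) :
    (fun x => G (th x) + β) '' (Ioc (1/2) 1) = Ioc 0 β := by
  have e0 : G (th (1/2)) + β = 0 := by rw [C.Gm]; ring
  have e1 : G (th 1) + β = β := by rw [C.th1, C.G0]; ring
  apply Subset.antisymm
  · rintro _ ⟨x, hx, rfl⟩
    have h1 := C.s_mono (left_mem_Icc.2 (by norm_num)) (Ioc_subset_Icc_self hx) hx.1
    have h2 := C.s_mono.monotoneOn (Ioc_subset_Icc_self hx) (right_mem_Icc.2 (by norm_num)) hx.2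
    simp only [e0, e1] at h1 h2
    exact ⟨h1, h2⟩
  · have hc : ContinuousOn (fun x => G (th x) + β) (Icc (1/2) 1) :=
      fun x _ => ((C.Gthd x).add_const β).continuousAt.continuousWithinAt
    have := intermediate_value_Ioc (show (1/2:ℝ) ≤ 1 by norm_num) hc
    simp only [e0, e1] at this
    exact this

lemma ae_h (C : Ctx g h c G F th p β θ0) :
    ∀ᵐ x ∂(volume.restrict (Ioc (1/2 : ℝ) 1)), x ∈ Ioc (1/2 : ℝ) 1 ∧ h (th x) ≠ 0 := by
  have hc : (Ioc (1/2 : ℝ) 1 ∩ {x | h (th x) = 0}).Countable := by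
    refine MapsTo.countable_of_injOn (t := {x | h x = 0}) (f := th) (fun x hx => hx.2) ?_ C.hcount
    exact C.th_mono.injOn.mono (fun x hx => Ioc_subset_Icc_self hx.1)
  have h0 := hc.ae_notMem volume
  refine (ae_restrict_iff' measurableSet_Ioc).2 ?_
  filter_upwards [h0] with x hx hxm
  exact ⟨hxm, fun e => hx ⟨hxm, e⟩⟩

lemma cv_ae (C : Ctx g h c G F th p β θ0) (T W : ℝ → ℝ)
    (hTW : ∀ x ∈ Ioc (1/2 : ℝ) 1, h (th x) ≠ 0 →
      ff g h c (th x) * ph c th x * T (G (th x) + β) = W x) :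
    (fun x => |ff g h c (th x) * ph c th x| • T (G (th x) + β))
      =ᵐ[volume.restrict (Ioc (1/2 : ℝ) 1)] W := by
  filter_upwards [C.ae_h] with x hx
  rw [abs_of_nonneg (mul_nonneg (C.ffnn _) (C.phpos hx.1).le), smul_eq_mul, hTW x hx.1 hx.2]

lemma cv_integral (C : Ctx g h c G F th p β θ0) (T W : ℝ → ℝ)
    (hTW : ∀ x ∈ Ioc (1/2 : ℝ) 1, h (th x) ≠ 0 →
      ff g h c (th x) * ph c th x * T (G (th x) + β) = W x) :
    ∫ t in (0:ℝ)..β, T t = ∫ x in (1/2:ℝ)..1, W x := by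
  rw [intervalIntegral.integral_of_le C.bpos.le, intervalIntegral.integral_of_le (by norm_num),
    ← C.s_image, integral_image_eq_integral_abs_deriv_smul measurableSet_Ioc
      (fun x _ => ((C.Gthd x).add_const β).hasDerivWithinAt)
      (C.s_mono.injOn.mono Ioc_subset_Icc_self)]
  exact integral_congr_ae (C.cv_ae T W hTW)

lemma cv_integrable (C : Ctx g h c G F th p β θ0) (T W : ℝ → ℝ)
    (hTW : ∀ x ∈ Ioc (1/2 : ℝ) 1, h (th x) ≠ 0 →
      ff g h c (th x) * ph c th x * T (G (th x) + β) = W x)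
    (hW : Continuous W) : IntegrableOn T (Ioc 0 β) := by
  rw [← C.s_image, integrableOn_image_iff_integrableOn_abs_deriv_smul measurableSet_Ioc
      (fun x _ => ((C.Gthd x).add_const β).hasDerivWithinAt)
      (C.s_mono.injOn.mono Ioc_subset_Icc_self)]
  exact (hW.integrableOn_Ioc (a := 1/2) (b := 1)).congr (C.cv_ae T W hTW).symm

lemma sqrt_s (C : Ctx g h c G F th p β θ0) {x : ℝ} (hx : x ∈ Ioc (1/2 : ℝ) 1) :
    ph c th x = √(2 * p) * √(G (th x) + β) ∧ 0 < √(G (th x) + β) ∧ 0 < G (th x) + β := by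
  have hx1 := hx.1
  have h1 := C.energy (x := x) ⟨by linarith, hx.2⟩
  have h2 := C.phpos hx
  have h3 := C.ppos
  have h4 : 0 < G (th x) + β := by
    by_contra hcon
    have : 2 * p * (G (th x) + β) ≤ 0 := mul_nonpos_of_nonneg_of_nonpos (by linarith) (not_lt.1 hcon)
    nlinarith
  refine ⟨?_, Real.sqrt_pos.2 h4, h4⟩
  rw [← Real.sqrt_mul (by linarith), ← h1, Real.sqrt_sq h2.le]

/-- the integrals in the definition of `D` -/
noncomputable def JJ (g h c F k : ℝ → ℝ) (b : ℝ) : ℝ :=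
  ∫ t in (0:ℝ)..b, k (F (t - b)) / ff g h c (F (t - b)) / √t

lemma Fth (C : Ctx g h c G F th p β θ0) (x : ℝ) : F (G (th x) + β - β) = th x := by
  rw [add_sub_cancel_right, C.hF]

lemma ff_ne (C : Ctx g h c G F th p β θ0) {x : ℝ} (hx : h x ≠ 0) : ff g h c x ≠ 0 :=
  div_ne_zero hx (mul_pos (C.gpos x) (C.cpos x)).ne'

lemma JJ_val (C : Ctx g h c G F th p β θ0) (k : ℝ → ℝ) :
    JJ g h c F k β = √(2 * p) * ∫ x in (1/2:ℝ)..1, k (th x) := by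
  rw [JJ, ← intervalIntegral.integral_const_mul]
  refine C.cv_integral _ _ fun x hx hne => ?_
  obtain ⟨e1, e2, -⟩ := C.sqrt_s hx
  have := C.ff_ne hne
  rw [C.Fth, e1]
  field_simp

lemma N_integrable (C : Ctx g h c G F th p β θ0) (k : ℝ → ℝ) (hk : Continuous k) :
    IntegrableOn (fun t => k (F (t - β)) / ff g h c (F (t - β))) (Ioc 0 β) := by
  refine C.cv_integrable _ (fun x => k (th x) * ph c th x) (fun x hx hne => ?_)
    ((hk.comp C.thcont).mul C.phcont)
  have := C.ff_ne hne
  rw [C.Fth]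
  field_simp

lemma M_val (C : Ctx g h c G F th p β θ0) (k : ℝ → ℝ) (μ : ℝ)
    (hμ : μ * ff g h c (th (1/2)) = k (th (1/2))) :
    ∫ t in (0:ℝ)..β, (k (F (t - β)) / ff g h c (F (t - β)) - μ) / (t * √t) =
      √(2 * p) * ∫ x in (1/2:ℝ)..1, (rho G (th (1/2)) k (th x)
        - μ * rho G (th (1/2)) (ff g h c) (th x)) := by
  rw [← intervalIntegral.integral_const_mul]
  refine C.cv_integral _ _ fun x hx hne => ?_
  obtain ⟨e1, e2, e3⟩ := C.sqrt_s hx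
  have hf := C.ff_ne hne
  have r1 := C.rho_eq k (th x)
  have r2 := C.rho_eq (ff g h c) (th x)
  rw [C.Fth, e1]
  have key : k (th x) / ff g h c (th x) - μ = (G (th x) + β) * (rho G (th (1/2)) k (th x)
        - μ * rho G (th (1/2)) (ff g h c) (th x)) / ff g h c (th x) := by
    field_simp
    linear_combination r1 - μ * r2 - hμ
  rw [key]
  field_simp

lemma F_deriv (C : Ctx g h c G F th p β θ0) : DifferentiableAt ℝ F (-β) := by
  have hFm : StrictMono F := by
    intro a b hab
    by_contra hcon
    have := C.Gmono.monotone (not_lt.1 hcon)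
    rw [C.hF' a, C.hF' b] at this
    linarith
  have hFc : Continuous F := hFm.monotone.continuous_of_surjective C.hF.surjective
  have e : F (-β) = th (1/2) := by rw [← C.Gm, C.hF]
  refine (HasDerivAt.of_local_left_inverse (f := G) (f' := h (th (1/2)) / g (th (1/2)))
    hFc.continuousAt ?_ ?_ ?_).differentiableAt
  · rw [e]; exact C.Gd _
  · exact div_ne_zero C.hm (C.gpos _).ne'
  · exact Eventually.of_forall fun y => C.hF' y

lemma JJ_lim (C : Ctx g h c G F th p β θ0) (k : ℝ → ℝ) (hk : Differentiable ℝ k) (μ : ℝ)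
    (hμ : μ * ff g h c (th (1/2)) = k (th (1/2))) :
    Tendsto (fun ε => (JJ g h c F k (β - ε) - JJ g h c F k β) / ε) (nhdsWithin 0 (Ioi 0))
      (nhds (1/2 * (√(2 * p) * ∫ x in (1/2:ℝ)..1, (rho G (th (1/2)) k (th x)
        - μ * rho G (th (1/2)) (ff g h c) (th x))) - μ / √β)) := by
  set N : ℝ → ℝ := fun t => k (F (t - β)) / ff g h c (F (t - β)) with hN
  have e : F (0 - β) = th (1/2) := by rw [zero_sub, ← C.Gm, C.hF]
  have hm := C.ffm
  have hN0 : N 0 = μ := by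
    simp only [hN, e]; field_simp; linarith
  have hNd : DifferentiableAt ℝ N 0 := by
    have h1 : DifferentiableAt ℝ (fun t => F (t - β)) 0 := by
      have h2 : DifferentiableAt ℝ F (0 - β) := by rw [zero_sub]; exact C.F_deriv
      exact h2.comp (0:ℝ) (by fun_prop : DifferentiableAt ℝ (fun t : ℝ => t - β) 0)
    have h3 : DifferentiableAt ℝ (fun t => k (F (t - β))) 0 := (hk _).comp (0:ℝ) h1
    have h4 : DifferentiableAt ℝ (fun t => ff g h c (F (t - β))) 0 :=
      (C.ffd _).differentiableAt.comp (0:ℝ) h1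
    exact h3.div h4 (by rw [e]; exact hm.ne')
  obtain ⟨K, hK⟩ := hNd.hasDerivAt.isBigO_sub.bound
  obtain ⟨δ, hδ, hδb⟩ := Metric.eventually_nhds_iff.1 hK
  have hb : ∀ s ∈ Ioc 0 (δ/2), |N s - μ| ≤ |K| * s := by
    intro s hs
    have := hδb (y := s) (by rw [dist_zero_right, norm_eq_abs, abs_of_pos hs.1]; linarith [hs.2])
    rw [hN0, sub_zero, norm_eq_abs, norm_eq_abs, abs_of_pos hs.1] at this
    exact this.trans (mul_le_mul_of_nonneg_right (le_abs_self K) hs.1.le)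
  have h5 := A5 N β (δ/2) |K| μ C.bpos (by linarith) (abs_nonneg K)
    (C.N_integrable k hk.continuous) hb
  rw [← C.M_val k μ hμ]
  refine h5.congr fun ε => ?_
  congr 2
  have := intervalIntegral.integral_comp_sub_right (a := ε) (b := β)
    (fun t => k (F (t - (β - ε))) / ff g h c (F (t - (β - ε))) / √t) ε
  rw [JJ, ← sub_self ε, ← this]
  congr 1; ext s
  simp only [hN]
  rw [show s - ε - (β - ε) = s - β by ring]

end Ctx

namespace Ctx
variable {g h c G F th : ℝ → ℝ} {p β θ0 : ℝ}

noncomputable def SS (g h c G th : ℝ → ℝ) (x : ℝ) : ℝ :=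
  ∫ y in (1/2:ℝ)..x, rho G (th (1/2)) (ff g h c) (th y) / 2

noncomputable def we (g h c G th : ℝ → ℝ) (x : ℝ) : ℝ := 1 + ph c th x * SS g h c G th x

noncomputable def ve (g h c G th : ℝ → ℝ) (p : ℝ) (x : ℝ) : ℝ :=
  p * ff g h c (th x) * SS g h c G th x + ph c th x * (rho G (th (1/2)) (ff g h c) (th x) / 2)

noncomputable def wp (c th : ℝ → ℝ) (x : ℝ) : ℝ := (x - 1/2) * ph c th x

noncomputable def vp (g h c th : ℝ → ℝ) (p : ℝ) (x : ℝ) : ℝ :=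
  ph c th x + (x - 1/2) * (p * ff g h c (th x))

lemma ffdiff (C : Ctx g h c G F th p β θ0) : Differentiable ℝ (ff g h c) :=
  C.ffC.differentiable (by norm_num)

lemma rhof_cont (C : Ctx g h c G F th p β θ0) :
    Continuous (fun y => rho G (th (1/2)) (ff g h c) (th y)) :=
  (C.rho_cont C.ffdiff).comp C.thcont

lemma SSd (C : Ctx g h c G F th p β θ0) (x : ℝ) :
    HasDerivAt (SS g h c G th) (rho G (th (1/2)) (ff g h c) (th x) / 2) x :=
  intervalIntegral.integral_hasDerivAt_right
    ((C.rhof_cont.div_const 2).intervalIntegrable _ _)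
    ((C.rhof_cont.div_const 2).stronglyMeasurableAtFilter _ _)
    (C.rhof_cont.div_const 2).continuousAt

lemma SS_half : SS g h c G th (1/2) = 0 := by simp [SS]

lemma comp_thd (C : Ctx g h c G F th p β θ0) {q : ℝ → ℝ} (hq : Differentiable ℝ q) (x : ℝ) :
    HasDerivAt (fun x => q (th x)) (deriv q (th x) / c (th x) * ph c th x) x :=
  ((hq (th x)).hasDerivAt.comp x (C.thd x)).congr_deriv (by ring)

/-- derivative of the divided difference away from the midpoint, multiplied by `ph` -/
lemma phrho_d (C : Ctx g h c G F th p β θ0) {q : ℝ → ℝ} (hq : Differentiable ℝ q) {x : ℝ}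
    (hx : x ∈ Icc (0:ℝ) 1) :
    HasDerivAt (fun x => ph c th x * rho G (th (1/2)) q (th x))
      (2 * p * (deriv q (th x) / c (th x))
        - p * ff g h c (th x) * rho G (th (1/2)) q (th x)) x := by
  have hp := C.ppos
  have hcp := C.cpos (th x)
  by_cases hxh : x = 1/2
  · have hφ := C.phd x hx
    have hr : ContinuousAt (fun x => rho G (th (1/2)) q (th x)) x :=
      ((C.rho_cont hq).comp C.thcont).continuousAt
    have h0 : ph c th x = 0 := by rw [hxh]; exact C.phhalf
    have hm := C.rho_m q
    rw [← hxh] at hm ⊢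
    rw [← hm]
    have e : 2 * p * (rho G (th x) q (th x) * (ff g h c (th x) * c (th x)) / c (th x))
        - p * ff g h c (th x) * rho G (th x) q (th x)
        = p * ff g h c (th x) * rho G (th x) q (th x) := by
      field_simp; ring
    rw [e]
    rw [hasDerivAt_iff_tendsto_slope] at hφ ⊢
    rw [← hxh] at hr
    have := hφ.mul (hr.tendsto.mono_left (nhdsWithin_le_nhds (s := {x}ᶜ)))
    refine this.congr fun y => ?_
    simp only [slope_def_field, h0]
    ring
  · have hne := C.thne hx hxh
    have hs : G (th x) + β ≠ 0 := by
      have := C.energy hx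
      intro h0
      rw [h0] at this
      exact C.phne hx hxh (by simpa using this)
    have hφ0 := C.phne hx hxh
    have hev : (fun x => ph c th x * rho G (th (1/2)) q (th x)) =ᶠ[nhds x]
        fun x => ph c th x * ((q (th x) - q (th (1/2))) / (G (th x) + β)) := by
      have hcont : ContinuousAt (fun x => G (th x) + β) x := ((C.Gthd x).add_const β).continuousAt
      filter_upwards [hcont.eventually_ne hs] with y hy
      rw [C.rho_eq q (th y)]
      field_simp
    refine HasDerivAt.congr_of_eventuallyEq ?_ hev
    have h1 := (C.phd x hx).mul
      (((C.comp_thd hq x).sub_const (q (th (1/2)))).div ((C.Gthd x).add_const β) hs)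
    refine h1.congr_deriv ?_
    simp only [Pi.div_apply]
    rw [C.rho_eq q (th x)]
    have hE := C.energy hx
    have hp2 : ph c th x ^ 2 = 2 * p * (G (th x) + β) := hE
    field_simp
    ring_nf
    ring_nf at hp2
    linear_combination (deriv q (th x) - c (th x) * rho G (th (1/2)) q (th x) * ff g h c (th x)) * hp2

lemma we_d (C : Ctx g h c G F th p β θ0) {x : ℝ} (hx : x ∈ Icc (0:ℝ) 1) :
    HasDerivAt (we g h c G th) (ve g h c G th p x) x :=
  ((C.phd x hx).mul (C.SSd x)).const_add 1

lemma ve_d (C : Ctx g h c G F th p β θ0) {x : ℝ} (hx : x ∈ Icc (0:ℝ) 1) :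
    HasDerivAt (ve g h c G th p)
      (p * (deriv (ff g h c) (th x) / c (th x)) * we g h c G th x) x := by
  have h1 := (((C.comp_thd C.ffdiff x).const_mul p).mul (C.SSd x)).add
    ((C.phrho_d C.ffdiff hx).div_const 2)
  refine (h1.congr_of_eventuallyEq (Eventually.of_forall fun y => ?_)).congr_deriv ?_
  · simp only [ve, Pi.add_apply, Pi.mul_apply]; ring
  · simp only [we]; ring

lemma wp_d (C : Ctx g h c G F th p β θ0) {x : ℝ} (hx : x ∈ Icc (0:ℝ) 1) :
    HasDerivAt (wp c th) (vp g h c th p x) x :=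
  (((hasDerivAt_id x).sub_const (1/2)).mul (C.phd x hx)).congr_deriv (by simp [vp])

lemma vp_d (C : Ctx g h c G F th p β θ0) {x : ℝ} (hx : x ∈ Icc (0:ℝ) 1) :
    HasDerivAt (vp g h c th p)
      (2 * p * ff g h c (th x) + p * (deriv (ff g h c) (th x) / c (th x)) * wp c th x) x := by
  have h1 := (C.phd x hx).add (((hasDerivAt_id x).sub_const (1/2)).mul
    ((C.comp_thd C.ffdiff x).const_mul p))
  exact h1.congr_deriv (by simp [wp]; ring)

lemma wron (C : Ctx g h c G F th p β θ0) {x : ℝ} (hx : x ∈ Icc (0:ℝ) 1) :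
    ph c th x * ve g h c G th p x - p * ff g h c (th x) * we g h c G th x
      = - (p * ff g h c (th (1/2))) := by
  have h1 := C.energy hx
  have h2 := C.rho_eq (ff g h c) (th x)
  simp only [ve, we]
  linear_combination (rho G (th (1/2)) (ff g h c) (th x) / 2) * h1 - p * h2

/-- general solution of the linearized second order equation -/
lemma gen_sol (C : Ctx g h c G F th p β θ0) (w v : ℝ → ℝ) (P : ℝ)
    (hw : ∀ x ∈ Icc (0:ℝ) 1, HasDerivAt w (v x) x)
    (hv : ∀ x ∈ Icc (0:ℝ) 1, HasDerivAt v
      (P * ff g h c (th x) + p * (deriv (ff g h c) (th x) / c (th x)) * w x) x) :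
    ∃ a b : ℝ, ∀ x ∈ Icc (0:ℝ) 1,
      w x = a * ph c th x + b * we g h c G th x + P / (2 * p) * wp c th x ∧
      v x = a * (p * ff g h c (th x)) + b * ve g h c G th p x + P / (2 * p) * vp g h c th p x := by
  have hp := C.ppos
  have hm := C.ffm
  set κ := p * ff g h c (th (1/2)) with hκ
  have hκ0 : κ ≠ 0 := (mul_pos hp hm).ne'
  set w1 : ℝ → ℝ := fun x => w x - P / (2 * p) * wp c th x with hw1
  set v1 : ℝ → ℝ := fun x => v x - P / (2 * p) * vp g h c th p x with hv1
  have dw1 : ∀ x ∈ Icc (0:ℝ) 1, HasDerivAt w1 (v1 x) x := fun x hx =>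
    (hw x hx).sub ((C.wp_d hx).const_mul _)
  have dv1 : ∀ x ∈ Icc (0:ℝ) 1, HasDerivAt v1
      (p * (deriv (ff g h c) (th x) / c (th x)) * w1 x) x := fun x hx =>
    ((hv x hx).sub ((C.vp_d hx).const_mul _)).congr_deriv (by simp only [hw1]; field_simp; ring)
  have W1 : ∀ x ∈ Icc (0:ℝ) 1, HasDerivAt
      (fun x => ph c th x * v1 x - p * ff g h c (th x) * w1 x) 0 x := by
    intro x hx
    have h1 := ((C.phd x hx).mul (dv1 x hx)).sub
      (((C.comp_thd C.ffdiff x).const_mul p).mul (dw1 x hx))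
    exact h1.congr_deriv (by ring)
  have W2 : ∀ x ∈ Icc (0:ℝ) 1, HasDerivAt
      (fun x => we g h c G th x * v1 x - ve g h c G th p x * w1 x) 0 x := by
    intro x hx
    have h1 := ((C.we_d hx).mul (dv1 x hx)).sub ((C.ve_d hx).mul (dw1 x hx))
    exact h1.congr_deriv (by ring)
  refine ⟨(we g h c G th 0 * v1 0 - ve g h c G th p 0 * w1 0) / κ,
    -((ph c th 0 * v1 0 - p * ff g h c (th 0) * w1 0) / κ), fun x hx => ?_⟩
  have c1 := const_Icc W1 hx (show (0:ℝ) ∈ Icc (0:ℝ) 1 by simp)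
  have c2 := const_Icc W2 hx (show (0:ℝ) ∈ Icc (0:ℝ) 1 by simp)
  rw [← c1, ← c2]
  have hW := C.wron hx
  rw [← hκ] at hW
  have e1 : w1 x = w x - P / (2 * p) * wp c th x := rfl
  have e2 : v1 x = v x - P / (2 * p) * vp g h c th p x := rfl
  constructor
  · have : w1 x = (we g h c G th x * v1 x - ve g h c G th p x * w1 x) / κ * ph c th x
      + -((ph c th x * v1 x - p * ff g h c (th x) * w1 x) / κ) * we g h c G th x := by
      field_simp
      linear_combination w1 x * hW
    rw [← this, e1]; ring
  · have : v1 x = (we g h c G th x * v1 x - ve g h c G th p x * w1 x) / κ * (p * ff g h c (th x))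
      + -((ph c th x * v1 x - p * ff g h c (th x) * w1 x) / κ) * ve g h c G th p x := by
      field_simp
      linear_combination v1 x * hW
    rw [← this, e2]; ring

/-- reflection symmetry of integrals -/
lemma int_symm (C : Ctx g h c G F th p β θ0) {q : ℝ → ℝ} (hq : Continuous q) :
    ∫ x in (0:ℝ)..(1/2), q (th x) = ∫ x in (1/2:ℝ)..1, q (th x) := by
  have h1 := intervalIntegral.integral_comp_sub_left (a := 0) (b := 1/2) (fun x => q (th x)) (1:ℝ)
  norm_num at h1
  norm_num
  rw [← h1]
  refine intervalIntegral.integral_congr fun x hx => ?_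
  rw [uIcc_of_le (by norm_num)] at hx
  rw [(C.symm x ⟨hx.1, by linarith [hx.2]⟩).1]

lemma int_full (C : Ctx g h c G F th p β θ0) {q : ℝ → ℝ} (hq : Continuous q) :
    ∫ x in (0:ℝ)..1, q (th x) = 2 * ∫ x in (1/2:ℝ)..1, q (th x) := by
  have hc : Continuous (fun x => q (th x)) := hq.comp C.thcont
  rw [← intervalIntegral.integral_add_adjacent_intervals (b := 1/2) (hc.intervalIntegrable _ _)
    (hc.intervalIntegrable _ _), C.int_symm hq]
  ring

lemma SS0 (C : Ctx g h c G F th p β θ0) : SS g h c G th 0 = - SS g h c G th 1 := by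
  have := C.int_symm (q := fun θ => rho G (th (1/2)) (ff g h c) θ / 2)
    ((C.rho_cont C.ffdiff).div_const 2)
  rw [SS, SS, ← this, intervalIntegral.integral_symm]

lemma we0 (C : Ctx g h c G F th p β θ0) : we g h c G th 0 = we g h c G th 1 := by
  simp only [we, C.SS0, C.ph0]; ring

lemma int_p (C : Ctx g h c G F th p β θ0) {k : ℝ → ℝ} (hk : ContDiff ℝ 1 k) :
    ∫ x in (0:ℝ)..1, (k (th x) + deriv k (th x) / c (th x) * wp c th x) = k θ0 := by
  have hkd : Differentiable ℝ k := hk.differentiable (by norm_num)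
  have hd : ∀ x ∈ uIcc (0:ℝ) 1, HasDerivAt (fun x => (x - 1/2) * k (th x))
      (k (th x) + deriv k (th x) / c (th x) * wp c th x) x := by
    intro x hx
    exact (((hasDerivAt_id x).sub_const (1/2)).mul (C.comp_thd hkd x)).congr_deriv
      (by simp [wp]; ring)
  have hc1 : Continuous (fun x => k (th x)) := hkd.continuous.comp C.thcont
  have hc2 : Continuous (fun x => deriv k (th x) / c (th x)) :=
    ((hk.continuous_deriv (by norm_num)).comp C.thcont).div (C.cC.continuous.comp C.thcont)
      (fun x => (C.cpos _).ne')
  have hc3 : Continuous (wp c th) := (continuous_id.sub continuous_const).mul C.phcont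
  rw [intervalIntegral.integral_eq_sub_of_hasDerivAt hd
    ((hc1.add (hc2.mul hc3)).intervalIntegrable _ _), C.th0, C.th1]
  ring

lemma SS_cont (C : Ctx g h c G F th p β θ0) : Continuous (SS g h c G th) :=
  continuous_iff_continuousAt.2 fun x => (C.SSd x).continuousAt

lemma we_cont (C : Ctx g h c G F th p β θ0) : Continuous (we g h c G th) :=
  continuous_const.add (C.phcont.mul C.SS_cont)

lemma int_e (C : Ctx g h c G F th p β θ0) {k : ℝ → ℝ} (hk : ContDiff ℝ 1 k) (μ : ℝ)
    (hμ : μ * ff g h c (th (1/2)) = k (th (1/2))) :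
    ∫ x in (0:ℝ)..1, (deriv k (th x) / c (th x) * we g h c G th x) =
      2 * (ph c th 1 * rho G (th (1/2)) k θ0 / (2 * p) + k θ0 * SS g h c G th 1
        + 1/2 * ff g h c (th (1/2)) * ∫ x in (1/2:ℝ)..1, (rho G (th (1/2)) k (th x)
        - μ * rho G (th (1/2)) (ff g h c) (th x))) := by
  have hp := C.ppos
  have hkd : Differentiable ℝ k := hk.differentiable (by norm_num)
  set X : ℝ → ℝ := fun θ => rho G (th (1/2)) k θ - μ * rho G (th (1/2)) (ff g h c) θ with hX
  have hXc : Continuous X := (C.rho_cont hkd).sub (continuous_const.mul (C.rho_cont C.ffdiff))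
  have hXc2 : Continuous (fun x => X (th x)) := hXc.comp C.thcont
  have hc2 : Continuous (fun x => deriv k (th x) / c (th x) * we g h c G th x) :=
    (((hk.continuous_deriv (by norm_num)).comp C.thcont).div (C.cC.continuous.comp C.thcont)
      (fun x => (C.cpos _).ne')).mul C.we_cont
  have hd : ∀ x ∈ uIcc (0:ℝ) 1, HasDerivAt
      (fun x => ph c th x * rho G (th (1/2)) k (th x) / (2 * p) + k (th x) * SS g h c G th x)
      (deriv k (th x) / c (th x) * we g h c G th x - 1/2 * ff g h c (th (1/2)) * X (th x)) x := by
    intro x hx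
    rw [uIcc_of_le (by norm_num)] at hx
    have h1 := ((C.phrho_d hkd hx).div_const (2 * p)).add ((C.comp_thd hkd x).mul (C.SSd x))
    refine h1.congr_deriv ?_
    have r1 := C.rho_eq k (th x)
    have r2 := C.rho_eq (ff g h c) (th x)
    have hcp := (C.cpos (th x)).ne'
    simp only [we, hX]
    set r := rho G (th (1/2)) k (th x)
    set ρ := rho G (th (1/2)) (ff g h c) (th x)
    have e : (2 * p * (deriv k (th x) / c (th x)) - p * ff g h c (th x) * r) / (2 * p)
        = deriv k (th x) / c (th x) - ff g h c (th x) * r / 2 := by field_simp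
    rw [e]
    linear_combination (ρ / 2) * r1 - (r / 2) * r2 - (ρ / 2) * hμ
  have hXc3 : Continuous (fun x => 1/2 * ff g h c (th (1/2)) * X (th x)) :=
    continuous_const.mul hXc2
  have hI := intervalIntegral.integral_eq_sub_of_hasDerivAt hd
    ((hc2.sub hXc3).intervalIntegrable _ _)
  rw [intervalIntegral.integral_sub (hc2.intervalIntegrable _ _)
    (hXc3.intervalIntegrable _ _), intervalIntegral.integral_const_mul,
    C.int_full hXc, C.th0, C.th1, C.SS0, C.ph0] at hI
  linear_combination hI

end Ctx

namespace Ctx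
variable {g h c G F th : ℝ → ℝ} {p β θ0 : ℝ}

noncomputable def Det (g h c G th k : ℝ → ℝ) (θ0 : ℝ) : ℝ :=
  we g h c G th 1 * ((∫ x in (0:ℝ)..1, k (th x)) + k θ0) / 2
    - ph c th 1 * (∫ x in (0:ℝ)..1, (deriv k (th x) / c (th x) * we g h c G th x)) / 4

lemma det_deriv (C : Ctx g h c G F th p β θ0) {k : ℝ → ℝ} (hk : ContDiff ℝ 1 k) (D : ℝ → ℝ)
    (hD : ∀ b, D b = JJ g h c F (fun _ => 1) b * JJ g h c F k b) (hDd : DifferentiableAt ℝ D β) :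
    Det g h c G th k θ0 = 0 ↔ deriv D β = 0 := by
  have hkd : Differentiable ℝ k := hk.differentiable (by norm_num)
  have hfm := C.ffm
  have hp := C.ppos
  have hb := C.bpos
  set fm := ff g h c (th (1/2)) with hfmdef
  have l1 := C.JJ_lim (fun _ => 1) (differentiable_const 1) (1 / fm) (by rw [← hfmdef]; field_simp)
  have l2 := C.JJ_lim k hkd (k (th (1/2)) / fm) (by rw [← hfmdef]; field_simp)
  have v1 := C.JJ_val (fun _ => 1)
  have v2 := C.JJ_val k
  have ie := C.int_e hk (k (th (1/2)) / fm) (by rw [← hfmdef]; field_simp)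
  have r0 : ∀ θ, rho G (th (1/2)) (fun _ => (1:ℝ)) θ = 0 := by
    intro θ
    have : dslope (fun _ : ℝ => (1:ℝ)) (th (1/2)) θ = 0 := by
      by_cases hθ : θ = th (1/2)
      · rw [hθ, dslope_same]; simp
      · rw [dslope_of_ne _ hθ]; simp [slope_def_field]
    rw [rho, this, zero_div]
  have hS : ∫ x in (1/2:ℝ)..1, (rho G (th (1/2)) (fun _ => (1:ℝ)) (th x)
        - 1 / fm * rho G (th (1/2)) (ff g h c) (th x)) = -(2 / fm) * SS g h c G th 1 := by
    rw [SS, ← intervalIntegral.integral_const_mul]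
    congr 1; ext x; rw [r0]; ring
  rw [hS] at l1
  set X := ∫ x in (1/2:ℝ)..1, (rho G (th (1/2)) k (th x)
        - k (th (1/2)) / fm * rho G (th (1/2)) (ff g h c) (th x)) with hX
  set j1 := 1 / 2 * (√(2 * p) * (-(2 / fm) * SS g h c G th 1)) - 1 / fm / √β with hj1
  set jk := 1 / 2 * (√(2 * p) * X) - k (th (1/2)) / fm / √β with hjk
  -- the derivative of D
  have hl : Tendsto (fun ε => (D (β - ε) - D β) / ε) (nhdsWithin 0 (Ioi 0))
      (nhds (j1 * JJ g h c F k β + JJ g h c F (fun _ => 1) β * jk)) := by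
    have hid : Tendsto (fun ε : ℝ => ε) (nhdsWithin 0 (Ioi 0)) (nhds 0) :=
      tendsto_id.mono_left nhdsWithin_le_nhds
    have h3 := (hid.mul l1).mul l2
    have h4 := ((l1.mul_const (JJ g h c F k β)).add (l2.const_mul (JJ g h c F (fun _ => 1) β))).add h3
    rw [zero_mul, zero_mul, add_zero] at h4
    refine h4.congr' ?_
    filter_upwards [self_mem_nhdsWithin] with ε hε
    have hε : ε ≠ 0 := ne_of_gt hε
    rw [hD, hD]
    field_simp
    ring
  have hr : Tendsto (fun ε => (D (β - ε) - D β) / ε) (nhdsWithin 0 (Ioi 0))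
      (nhds (- deriv D β)) := by
    have h1 : HasDerivAt (fun ε : ℝ => β - ε) (-1) 0 := by
      simpa using (hasDerivAt_id (0:ℝ)).const_sub β
    have h2 : HasDerivAt D (deriv D β) (β - 0) := by rw [sub_zero]; exact hDd.hasDerivAt
    have h3 := (h2.comp (0:ℝ) h1).tendsto_slope.mono_left
      (nhdsWithin_mono _ (fun x (hx : 0 < x) => hx.ne'))
    rw [mul_neg, mul_one] at h3
    refine h3.congr fun ε => ?_
    simp [slope_def_field]
  have heq := tendsto_nhds_unique hl hr
  have hone : JJ g h c F (fun _ => 1) β = √(2 * p) / 2 := by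
    rw [v1]; simp; ring
  rw [hone, v2] at heq
  have hY := C.int_full hkd.continuous
  have hph := C.sqrt_s (x := 1) ⟨by norm_num, le_rfl⟩
  rw [C.th1, C.G0, zero_add] at hph
  have hρ := C.rho_eq k θ0
  rw [C.G0, zero_add] at hρ
  have q1 : 0 < √(2 * p) := Real.sqrt_pos.2 (by linarith)
  have q2 : 0 < √β := hph.2.1
  have s1 := Real.sq_sqrt (show 0 ≤ 2 * p by linarith)
  have s2 := Real.sq_sqrt hb.le
  have key : Det g h c G th k θ0 = fm * √β / √(2 * p) * deriv D β := by
    rw [← neg_neg (deriv D β), ← heq, Det, hY, ie, we, hph.1, hj1, hjk]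
    set Y := ∫ x in (1/2:ℝ)..1, k (th x)
    set S1 := SS g h c G th 1
    set R := rho G (th (1/2)) k θ0
    set km := k (th (1/2))
    have e1 : √(2 * p) * √β * R / (2 * p) = √β * R / √(2 * p) := by
      rw [← s1]; field_simp
      rw [Real.sqrt_sq q1.le]
    rw [e1]
    have e2 : k θ0 = km + R * √β ^ 2 := by rw [s2]; linarith
    rw [e2]
    field_simp
    ring
  rw [key]
  constructor
  · intro h0
    rcases mul_eq_zero.1 h0 with h1 | h1
    · exact absurd h1 (by positivity)
    · exact h1
  · intro h0; rw [h0, mul_zero]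

def Kernel (g h c th k : ℝ → ℝ) (p : ℝ) : Prop :=
  ∃ U w v : ℝ → ℝ, ∃ P : ℝ,
    (∀ x ∈ Icc (0:ℝ) 1, HasDerivAt U (P * k (th x) + p * (deriv k (th x) / c (th x) * w x)) x) ∧
    (∀ x ∈ Icc (0:ℝ) 1, HasDerivAt w (v x) x) ∧
    (∀ x ∈ Icc (0:ℝ) 1, HasDerivAt v
      (P * ff g h c (th x) + p * (deriv (ff g h c) (th x) / c (th x)) * w x) x) ∧
    U 0 = 0 ∧ U 1 = 0 ∧ w 0 = 0 ∧ w 1 = 0 ∧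
    (P ≠ 0 ∨ ∃ x ∈ Icc (0:ℝ) 1, U x ≠ 0 ∨ w x ≠ 0 ∨ v x ≠ 0)

lemma int_comb (C : Ctx g h c G F th p β θ0) {k : ℝ → ℝ} (hk : ContDiff ℝ 1 k) (P b : ℝ) :
    ∫ x in (0:ℝ)..1, (P * k (th x) + p * (deriv k (th x) / c (th x) *
        (b * we g h c G th x + P / (2 * p) * wp c th x))) =
      P / 2 * ((∫ x in (0:ℝ)..1, k (th x)) + k θ0)
      + p * b * ∫ x in (0:ℝ)..1, (deriv k (th x) / c (th x) * we g h c G th x) := by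
  have hp := C.ppos
  have hkd : Differentiable ℝ k := hk.differentiable (by norm_num)
  have hc1 : Continuous (fun x => k (th x)) := hkd.continuous.comp C.thcont
  have hc2 : Continuous (fun x => deriv k (th x) / c (th x)) :=
    ((hk.continuous_deriv (by norm_num)).comp C.thcont).div (C.cC.continuous.comp C.thcont)
      (fun x => (C.cpos _).ne')
  have hc3 : Continuous (wp c th) := (continuous_id.sub continuous_const).mul C.phcont
  have hc4 : Continuous (fun x => k (th x) + deriv k (th x) / c (th x) * wp c th x) :=
    hc1.add (hc2.mul hc3)
  have hc5 : Continuous (fun x => deriv k (th x) / c (th x) * we g h c G th x) := hc2.mul C.we_cont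
  rw [← C.int_p hk, ← intervalIntegral.integral_add (hc1.intervalIntegrable _ _)
    (hc4.intervalIntegrable _ _), ← intervalIntegral.integral_const_mul,
    ← intervalIntegral.integral_const_mul, ← intervalIntegral.integral_add]
  · congr 1; ext x; field_simp; ring
  · exact (continuous_const.mul (hc1.add hc4)).intervalIntegrable _ _
  · exact (continuous_const.mul hc5).intervalIntegrable _ _

lemma kernel_iff (C : Ctx g h c G F th p β θ0) {k : ℝ → ℝ} (hk : ContDiff ℝ 1 k) :
    Kernel g h c th k p ↔ Det g h c G th k θ0 = 0 := by
  have hp := C.ppos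
  have hkd : Differentiable ℝ k := hk.differentiable (by norm_num)
  have hφ1 := C.phpos (x := 1) ⟨by norm_num, le_rfl⟩
  have m0 : (0:ℝ) ∈ Icc (0:ℝ) 1 := by simp
  have m1 : (1:ℝ) ∈ Icc (0:ℝ) 1 := by simp
  have hc1 : Continuous (fun x => k (th x)) := hkd.continuous.comp C.thcont
  have hc2 : Continuous (fun x => deriv k (th x) / c (th x)) :=
    ((hk.continuous_deriv (by norm_num)).comp C.thcont).div (C.cC.continuous.comp C.thcont)
      (fun x => (C.cpos _).ne')
  have hc3 : Continuous (wp c th) := (continuous_id.sub continuous_const).mul C.phcont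
  have hcc : ∀ P b : ℝ, Continuous (fun x => P * k (th x) + p * (deriv k (th x) / c (th x) *
        (b * we g h c G th x + P / (2 * p) * wp c th x))) := fun P b =>
    (continuous_const.mul hc1).add (continuous_const.mul (hc2.mul
      ((continuous_const.mul C.we_cont).add (continuous_const.mul hc3))))
  unfold Det
  set I := ∫ x in (0:ℝ)..1, (deriv k (th x) / c (th x) * we g h c G th x) with hI
  set Y := (∫ x in (0:ℝ)..1, k (th x)) + k θ0 with hY
  constructor
  · rintro ⟨U, w, v, P, hU, hw, hv, U0, U1, w0, w1, hne⟩
    obtain ⟨a, b, hab⟩ := C.gen_sol w v P hw hv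
    have e0 := (hab 0 m0).1
    have e1 := (hab 1 m1).1
    rw [w0, C.we0, C.ph0] at e0
    rw [w1] at e1
    simp only [wp, C.ph0] at e0 e1
    have ha : a = 0 := by
      have : a * ph c th 1 = 0 := by linarith
      exact (mul_eq_zero.1 this).resolve_right hφ1.ne'
    subst ha
    have hU' : ∀ x ∈ uIcc (0:ℝ) 1, HasDerivAt U (P * k (th x) + p * (deriv k (th x) / c (th x) *
        (b * we g h c G th x + P / (2 * p) * wp c th x))) x := by
      intro x hx
      rw [uIcc_of_le (by norm_num)] at hx
      have := hU x hx
      rw [(hab x hx).1, zero_mul, zero_add] at this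
      exact this
    have hi := intervalIntegral.integral_eq_sub_of_hasDerivAt hU'
      ((hcc P b).intervalIntegrable _ _)
    rw [C.int_comb hk, U0, U1, ← hI, ← hY] at hi
    set W := we g h c G th 1
    set f1 := ph c th 1
    have eq1 : b * W + P * f1 / (4 * p) = 0 := by
      rw [e1]; field_simp; ring
    have d1 : P * (W * Y / 2 - f1 * I / 4) = 0 := by
      have : P * f1 / (4 * p) * (4 * p) = P * f1 := by field_simp
      linear_combination W * hi - p * I * eq1 + (I/4) * this
    have d2 : b * (W * Y / 2 - f1 * I / 4) = 0 := by
      have : P * f1 / (4 * p) * p * 4 = P * f1 := by field_simp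
      have h5 : b * (W * Y / 2 - f1 * I / 4) * p = 0 := by
        linear_combination (p * Y / 2) * eq1 - (f1/4) * hi - (Y/8) * this
      exact (mul_eq_zero.1 h5).resolve_right hp.ne'
    by_contra hdet
    have hP := (mul_eq_zero.1 d1).resolve_right hdet
    have hb := (mul_eq_zero.1 d2).resolve_right hdet
    subst hP hb
    rcases hne with h1 | ⟨x, hx, h1⟩
    · exact h1 rfl
    · have hwx : ∀ x ∈ Icc (0:ℝ) 1, w x = 0 := fun x hx => by
        rw [(hab x hx).1]; simp
      rcases h1 with h1 | h1 | h1
      · refine h1 ?_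
        rw [← U0]
        refine const_Icc (fun y hy => ?_) hx m0
        have := hU y hy
        rw [hwx y hy] at this
        simpa using this
      · exact h1 (hwx x hx)
      · exact h1 (by rw [(hab x hx).2]; simp)
  · intro hdet
    set W := we g h c G th 1 with hW
    set f1 := ph c th 1 with hf1
    -- choose a nontrivial element of the kernel of the 2x2 system
    obtain ⟨P, b, hPb, eq1, eq2⟩ : ∃ P b : ℝ, (P ≠ 0 ∨ b ≠ 0) ∧ b * W + P * f1 / (4 * p) = 0 ∧
        P / 2 * Y + p * b * I = 0 := by
      refine ⟨-(4 * p) * W, f1, Or.inr hφ1.ne', by field_simp; ring, ?_⟩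
      linear_combination (-4 * p) * hdet
    refine ⟨fun x => ∫ y in (0:ℝ)..x, (P * k (th y) + p * (deriv k (th y) / c (th y) *
        (b * we g h c G th y + P / (2 * p) * wp c th y))),
      fun x => b * we g h c G th x + P / (2 * p) * wp c th x,
      fun x => b * ve g h c G th p x + P / (2 * p) * vp g h c th p x, P, ?_, ?_, ?_, ?_, ?_, ?_, ?_, ?_⟩
    · intro x _
      exact intervalIntegral.integral_hasDerivAt_right ((hcc P b).intervalIntegrable _ _)
        ((hcc P b).stronglyMeasurableAtFilter _ _) (hcc P b).continuousAt
    · intro x hx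
      exact ((C.we_d hx).const_mul b).add ((C.wp_d hx).const_mul _)
    · intro x hx
      refine (((C.ve_d hx).const_mul b).add ((C.vp_d hx).const_mul _)).congr_deriv ?_
      field_simp; ring
    · simp
    · simp only
      rw [C.int_comb hk, ← hI, ← hY]; exact eq2
    · simp only [wp]
      rw [C.we0, C.ph0, ← hW, ← hf1]
      have e : P / (2 * p) * ((0 - 1 / 2) * (-f1)) = P * f1 / (4 * p) := by field_simp; ring
      rw [e]; exact eq1
    · simp only [wp]
      rw [← hW, ← hf1]
      have e : P / (2 * p) * ((1 - 1 / 2) * f1) = P * f1 / (4 * p) := by field_simp; ring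
      rw [e]; exact eq1
    · by_cases hP : P = 0
      · right
        refine ⟨1/2, half_mem, Or.inr (Or.inl ?_)⟩
        have hb := hPb.resolve_left (not_not.2 hP)
        simp only [we, wp, C.phhalf]
        simpa using hb
      · exact Or.inl hP

end Ctx

namespace Ctx
variable {g h c G F th : ℝ → ℝ} {p β θ0 : ℝ}

lemma gd (C : Ctx g h c G F th p β θ0) (x : ℝ) : HasDerivAt g (deriv g x) x :=
  ((C.gC.differentiable (by norm_num)) x).hasDerivAt

lemma cd (C : Ctx g h c G F th p β θ0) (x : ℝ) : HasDerivAt c (deriv c x) x :=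
  ((C.cC.differentiable (by norm_num)) x).hasDerivAt

lemma thd1 (C : Ctx g h c G F th p β θ0) (x : ℝ) : HasDerivAt th (deriv th x) x :=
  ((C.thC.differentiable (by norm_num)) x).hasDerivAt

lemma thd2 (C : Ctx g h c G F th p β θ0) (x : ℝ) :
    HasDerivAt (deriv th) (deriv (deriv th) x) x :=
  ((C.thC.differentiable_deriv_two) x).hasDerivAt

lemma cd2 (C : Ctx g h c G F th p β θ0) (x : ℝ) :
    HasDerivAt (deriv c) (deriv (deriv c) x) x :=
  ((C.cC.differentiable_deriv_two) x).hasDerivAt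

lemma cth (C : Ctx g h c G F th p β θ0) (x : ℝ) :
    HasDerivAt (fun x => c (th x)) (deriv c (th x) * deriv th x) x :=
  (C.cd (th x)).comp x (C.thd1 x)

lemma cdth (C : Ctx g h c G F th p β θ0) (x : ℝ) :
    HasDerivAt (fun x => deriv c (th x) * deriv th x)
      (deriv (deriv c) (th x) * deriv th x * deriv th x
        + deriv c (th x) * deriv (deriv th) x) x :=
  ((C.cd2 (th x)).comp x (C.thd1 x)).mul (C.thd2 x)

lemma th2 (C : Ctx g h c G F th p β θ0) {x : ℝ} (hx : x ∈ Icc (0:ℝ) 1) :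
    deriv c (th x) * deriv th x * deriv th x + c (th x) * deriv (deriv th) x
      = p * ff g h c (th x) :=
  ((C.cth x).mul (C.thd2 x)).unique (C.phd x hx)

lemma ffderiv (C : Ctx g h c G F th p β θ0) (x : ℝ) :
    deriv (fun s => h s / g s) x = deriv (ff g h c) x * c x + ff g h c x * deriv c x := by
  have : (fun s => h s / g s) = fun s => ff g h c s * c s := by
    ext s; exact C.hg_eq s
  rw [this]
  exact ((C.ffd x).mul (C.cd x)).deriv

lemma kderiv (C : Ctx g h c G F th p β θ0) (x : ℝ) :
    deriv (fun s => 1 / g s) x = - deriv g x / g x ^ 2 := by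
  have := (C.gd x).inv (C.gpos x).ne'
  have e : (fun s => 1 / g s) = g⁻¹ := by ext s; simp
  rw [e]; exact this.deriv

lemma eigen_iff (C : Ctx g h c G F th p β θ0) (u : ℝ → ℝ)
    (hu : ∀ x ∈ Icc (0:ℝ) 1, deriv u x = p / g (th x))
    (A : ℝ → Matrix (Fin 4) (Fin 4) ℝ)
    (hA : ∀ x : ℝ, A x =
      !![0, 1 / g (th x), -(deriv g (th x) * deriv u x / g (th x)), 0;
         0, 0, 0, 0;
         0, 0, -(2 * deriv c (th x) * deriv th x / c (th x)), 1 / c (th x) ^ 2;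
         0, h (th x) / g (th x),
           deriv (fun s => h s / g s) (th x) * g (th x) * deriv u x
             + (c (th x) * deriv (deriv c) (th x) - 3 * deriv c (th x) ^ 2)
               * deriv th x ^ 2,
           2 * deriv c (th x) * deriv th x / c (th x)]) :
    (∃ Z : ℝ → Fin 4 → ℝ,
      (∀ x ∈ Set.Icc (0:ℝ) 1, HasDerivAt Z (Matrix.mulVec (A x) (Z x)) x) ∧
      (∃ x ∈ Set.Icc (0:ℝ) 1, Z x ≠ 0) ∧
      Z 0 0 = 0 ∧ Z 0 2 = 0 ∧ Z 1 0 = 0 ∧ Z 1 2 = 0) ↔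
    Kernel g h c th (fun s => 1 / g s) p := by
  have m0 : (0:ℝ) ∈ Icc (0:ℝ) 1 := by simp
  constructor
  · rintro ⟨Z, hZ, ⟨x0, hx0, hne⟩, Z00, Z02, Z10, Z12⟩
    have d0 : ∀ x ∈ Icc (0:ℝ) 1, HasDerivAt (fun x => Z x 0)
        (1 / g (th x) * Z x 1 + -(deriv g (th x) * deriv u x / g (th x)) * Z x 2) x := by
      intro x hx
      have := (hasDerivAt_pi.1 (hZ x hx)) 0
      rw [hA] at this
      refine this.congr_deriv ?_
      simp [Matrix.mulVec, dotProduct, Fin.sum_univ_four]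
    have d1 : ∀ x ∈ Icc (0:ℝ) 1, HasDerivAt (fun x => Z x 1) 0 x := by
      intro x hx
      have := (hasDerivAt_pi.1 (hZ x hx)) 1
      rw [hA] at this
      refine this.congr_deriv ?_
      simp [Matrix.mulVec, dotProduct, Fin.sum_univ_four]
    have d2 : ∀ x ∈ Icc (0:ℝ) 1, HasDerivAt (fun x => Z x 2)
        (-(2 * deriv c (th x) * deriv th x / c (th x)) * Z x 2 + 1 / c (th x) ^ 2 * Z x 3) x := by
      intro x hx
      have := (hasDerivAt_pi.1 (hZ x hx)) 2
      rw [hA] at this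
      refine this.congr_deriv ?_
      simp [Matrix.mulVec, dotProduct, Fin.sum_univ_four]
    have d3 : ∀ x ∈ Icc (0:ℝ) 1, HasDerivAt (fun x => Z x 3)
        (h (th x) / g (th x) * Z x 1 + (deriv (fun s => h s / g s) (th x) * g (th x) * deriv u x
             + (c (th x) * deriv (deriv c) (th x) - 3 * deriv c (th x) ^ 2)
               * deriv th x ^ 2) * Z x 2 + 2 * deriv c (th x) * deriv th x / c (th x) * Z x 3) x := by
      intro x hx
      have := (hasDerivAt_pi.1 (hZ x hx)) 3
      rw [hA] at this
      refine this.congr_deriv ?_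
      simp [Matrix.mulVec, dotProduct, Fin.sum_univ_four]
    have hP : ∀ x ∈ Icc (0:ℝ) 1, Z x 1 = Z 0 1 := fun x hx => const_Icc d1 hx m0
    refine ⟨fun x => Z x 0, fun x => c (th x) * Z x 2,
      fun x => Z x 3 / c (th x) - deriv c (th x) * deriv th x * Z x 2, Z 0 1,
      ?_, ?_, ?_, Z00, Z10, by simp [Z02], by simp [Z12], ?_⟩
    · intro x hx
      refine (d0 x hx).congr_deriv ?_
      have := (C.gpos (th x)).ne'
      have := (C.cpos (th x)).ne'
      rw [C.kderiv, hP x hx, hu x hx]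
      field_simp
    · intro x hx
      refine ((C.cth x).mul (d2 x hx)).congr_deriv ?_
      have := (C.cpos (th x)).ne'
      field_simp
      ring
    · intro x hx
      have hc0 := (C.cpos (th x)).ne'
      have hg0 := (C.gpos (th x)).ne'
      refine (((d3 x hx).div (C.cth x) hc0).sub ((C.cdth x).mul (d2 x hx))).congr_deriv ?_
      have t2 := C.th2 hx
      have e2 : deriv (deriv th) x
          = (p * ff g h c (th x) - deriv c (th x) * deriv th x * deriv th x) / c (th x) := by
        field_simp; linear_combination t2
      rw [C.ffderiv, hP x hx, hu x hx, e2, C.hg_eq]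
      field_simp
      ring
    · by_contra hcon
      push Not at hcon
      obtain ⟨h1, h2⟩ := hcon
      obtain ⟨a0, a1, a2⟩ := h2 x0 hx0
      have hc0 := (C.cpos (th x0)).ne'
      have z2 : Z x0 2 = 0 := by simpa [hc0] using a1
      have z3 : Z x0 3 = 0 := by simpa [hc0, z2] using a2
      apply hne
      ext i
      fin_cases i
      · exact a0
      · exact (hP x0 hx0).trans h1
      · exact z2
      · exact z3
  · rintro ⟨U, w, v, P, hU, hw, hv, U0, U1, w0, w1, hne⟩
    refine ⟨fun x => ![U x, P, w x / c (th x), c (th x) * v x + deriv c (th x) * deriv th x * w x],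
      ?_, ?_, by simp [U0], by simp [w0], by simp [U1], by simp [w1]⟩
    · intro x hx
      have hc0 := (C.cpos (th x)).ne'
      have hg0 := (C.gpos (th x)).ne'
      rw [hA, hasDerivAt_pi]
      intro i
      fin_cases i
      · refine (hU x hx).congr_deriv ?_
        simp only [C.kderiv, hu x hx]
        simp [Matrix.mulVec, dotProduct, Fin.sum_univ_four]
        field_simp
      · refine (hasDerivAt_const x P).congr_deriv ?_
        simp [Matrix.mulVec, dotProduct, Fin.sum_univ_four]
      · refine ((hw x hx).div (C.cth x) hc0).congr_deriv ?_
        simp [Matrix.mulVec, dotProduct, Fin.sum_univ_four]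
        field_simp
        ring
      · refine (((C.cth x).mul (hv x hx)).add ((C.cdth x).mul (hw x hx))).congr_deriv ?_
        have t2 := C.th2 hx
        have e2 : deriv (deriv th) x
            = (p * ff g h c (th x) - deriv c (th x) * deriv th x * deriv th x) / c (th x) := by
          field_simp; linear_combination t2
        rw [C.ffderiv, hu x hx, e2, C.hg_eq]
        simp [Matrix.mulVec, dotProduct, Fin.sum_univ_four]
        field_simp
        ring
    · rcases hne with h1 | ⟨x, hx, h1⟩
      · exact ⟨0, m0, fun e => h1 (by simpa using congrFun e 1)⟩
      · refine ⟨x, hx, fun e => ?_⟩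
        have hc0 := (C.cpos (th x)).ne'
        have e0 : U x = 0 := by simpa using congrFun e 0
        have e2 : w x = 0 := by simpa [hc0] using congrFun e 2
        have e3 : v x = 0 := by simpa [hc0, e2] using congrFun e 3
        simp [e0, e2, e3] at h1

end Ctx

/-- `λ = 0` is an eigenvalue of the linearization along the
stationary solution `(u, θ)` (i.e. `Z′ = A(x)Z` has a nonzero solution on `[0,1]`
with `U` and `Θ` vanishing at both endpoints) if and only if `D′(β) = 0`. -/
theorem stmt_14
    (α1 α2 α3 α4 α5 α6 K1 K3 γ1 γ2 Cbar θ0 : ℝ)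
    (hγ1 : γ1 = α3 - α2) (hγ2 : γ2 = α6 - α5) (hγ1pos : 0 < γ1)
    (hK1 : 0 < K1) (hK3 : 0 < K3) (hCbar : 0 < Cbar)
    (g h c G : ℝ → ℝ)
    (hg : ∀ θ : ℝ, g θ = α1 * Real.sin θ ^ 2 * Real.cos θ ^ 2
        + (α5 - α2) / 2 * Real.sin θ ^ 2 + (α3 + α6) / 2 * Real.cos θ ^ 2 + α4 / 2)
    (hh : ∀ θ : ℝ, h θ = (γ1 + γ2 * Real.cos (2 * θ)) / 2)
    (hc : ∀ θ : ℝ, c θ = Real.sqrt (K1 * Real.cos θ ^ 2 + K3 * Real.sin θ ^ 2))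
    (hdamp : ∀ θ : ℝ, Cbar ≤ g θ - h θ ^ 2 / γ1 ∧ g θ - h θ ^ 2 / γ1 ≤ g θ)
    (hθ0 : h θ0 ≠ 0)
    (hG : ∀ θ : ℝ, G θ = ∫ s in θ0..θ, h s / g s)
    (hcase : γ2 = γ1 ∨ γ2 = -γ1)
    (F D : ℝ → ℝ)
    (hF : Function.LeftInverse F G) (hF' : Function.RightInverse F G)
    (hD : ∀ β : ℝ, D β =
      (∫ t in (0:ℝ)..β, c (F (t - β)) * g (F (t - β)) / h (F (t - β)) / Real.sqrt t) *
      (∫ t in (0:ℝ)..β, c (F (t - β)) / h (F (t - β)) / Real.sqrt t))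
    (β : ℝ) (hβpos : 0 < β) (hβ : ∀ e : ℝ, h e = 0 → β ≠ -G e)
    (hDdiff : DifferentiableAt ℝ D β)
    (u th : ℝ → ℝ)
    (hstat : IsStationarySolution g h c θ0 (2 * D β) u th)
    (hβth : -G (th (1/2)) = β)
    (A : ℝ → Matrix (Fin 4) (Fin 4) ℝ)
    (hA : ∀ x : ℝ, A x =
      !![0, 1 / g (th x), -(deriv g (th x) * deriv u x / g (th x)), 0;
         0, 0, 0, 0;
         0, 0, -(2 * deriv c (th x) * deriv th x / c (th x)), 1 / c (th x) ^ 2;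
         0, h (th x) / g (th x),
           deriv (fun s => h s / g s) (th x) * g (th x) * deriv u x
             + (c (th x) * deriv (deriv c) (th x) - 3 * deriv c (th x) ^ 2)
               * deriv th x ^ 2,
           2 * deriv c (th x) * deriv th x / c (th x)])
    :
    (∃ Z : ℝ → Fin 4 → ℝ,
      (∀ x ∈ Set.Icc (0:ℝ) 1, HasDerivAt Z (Matrix.mulVec (A x) (Z x)) x) ∧
      (∃ x ∈ Set.Icc (0:ℝ) 1, Z x ≠ 0) ∧
      Z 0 0 = 0 ∧ Z 0 2 = 0 ∧ Z 1 0 = 0 ∧ Z 1 2 = 0) ↔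
    deriv D β = 0 := by
  obtain ⟨huC, hthC, hus, hths, u0, u1, th0, th1⟩ := hstat
  have m0 : (0:ℝ) ∈ Icc (0:ℝ) 1 := by simp
  have m1 : (1:ℝ) ∈ Icc (0:ℝ) 1 := by simp
  have mh : (1/2:ℝ) ∈ Icc (0:ℝ) 1 := by constructor <;> norm_num
  have gpos : ∀ x, 0 < g x := fun x => hCbar.trans_le ((hdamp x).1.trans (hdamp x).2)
  have hsq : (∀ x, h x = γ1 * Real.cos x ^ 2) ∨ (∀ x, h x = γ1 * Real.sin x ^ 2) := by
    rcases hcase with e | e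
    · left; intro x; rw [hh, e, Real.cos_two_mul]; ring
    · right; intro x; rw [hh, e, Real.cos_two_mul, Real.sin_sq]; ring
  have hnn : ∀ x, 0 ≤ h x := by
    intro x
    rcases hsq with e | e <;> rw [e] <;> positivity
  have cradpos : ∀ x, 0 < K1 * Real.cos x ^ 2 + K3 * Real.sin x ^ 2 := by
    intro x
    have h1 := Real.sin_sq_add_cos_sq x
    by_cases hs : Real.sin x = 0
    · rw [hs] at h1 ⊢
      have : Real.cos x ^ 2 = 1 := by linarith
      rw [this]; simpa using hK1
    · positivity
  have cpos : ∀ x, 0 < c x := fun x => by rw [hc]; exact Real.sqrt_pos.2 (cradpos x)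
  have gC : ContDiff ℝ 2 g := by
    rw [show g = _ from funext hg]
    fun_prop
  have hC : ContDiff ℝ 2 h := by
    rw [show h = _ from funext hh]
    fun_prop
  have cC : ContDiff ℝ 2 c := by
    rw [show c = _ from funext hc]
    refine ContDiff.sqrt (by fun_prop) (fun x => (cradpos x).ne')
  have hcount : {x | h x = 0}.Countable := by
    rcases hsq with e | e
    · refine (Set.countable_range (fun k : ℤ => (2 * (k:ℝ) + 1) * π / 2)).mono ?_
      intro x hx
      have hx' : h x = 0 := hx
      rw [e] at hx'
      have : Real.cos x = 0 := by simpa [hγ1pos.ne'] using hx'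
      obtain ⟨k, hk⟩ := Real.cos_eq_zero_iff.1 this
      exact ⟨k, hk.symm⟩
    · refine (Set.countable_range (fun k : ℤ => (k:ℝ) * π)).mono ?_
      intro x hx
      have hx' : h x = 0 := hx
      rw [e] at hx'
      have : Real.sin x = 0 := by simpa [hγ1pos.ne'] using hx'
      obtain ⟨k, hk⟩ := Real.sin_eq_zero_iff.1 this
      exact ⟨k, hk⟩
  have hgc : Continuous (fun s => h s / g s) :=
    hC.continuous.div gC.continuous (fun x => (gpos x).ne')
  have Gd : ∀ x, HasDerivAt G (h x / g x) x := by
    intro x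
    rw [show G = _ from funext hG]
    exact intervalIntegral.integral_hasDerivAt_right (hgc.intervalIntegrable _ _)
      (hgc.stronglyMeasurableAtFilter _ _) hgc.continuousAt
  have G0 : G θ0 = 0 := by rw [hG]; simp
  have Gm : G (th (1/2)) = -β := by linarith
  have hm : h (th (1/2)) ≠ 0 := fun e => hβ _ e hβth.symm
  have thdiff : Differentiable ℝ th := hthC.differentiable (by norm_num)
  have udiff : Differentiable ℝ u := huC.differentiable (by norm_num)
  have udiff2 : Differentiable ℝ (deriv u) := huC.differentiable_deriv_two
  have thdiff2 : Differentiable ℝ (deriv th) := hthC.differentiable_deriv_two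
  have gdiff : Differentiable ℝ g := gC.differentiable (by norm_num)
  have cdiff : Differentiable ℝ c := cC.differentiable (by norm_num)
  obtain ⟨p, hp⟩ : ∃ p, ∀ x ∈ Icc (0:ℝ) 1, g (th x) * deriv u x = p := by
    refine ⟨g (th 0) * deriv u 0, fun x hx => ?_⟩
    refine const_Icc (f := fun y => g (th y) * deriv u y) (fun y hy => ?_) hx m0
    have hd : DifferentiableAt ℝ (fun y => g (th y) * deriv u y) y :=
      ((gdiff.comp thdiff).mul udiff2) y
    rw [← hus y hy]; exact hd.hasDerivAt
  have hu : ∀ x ∈ Icc (0:ℝ) 1, deriv u x = p / g (th x) := by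
    intro x hx
    rw [eq_div_iff (gpos _).ne', ← hp x hx]; ring
  have phd : ∀ x ∈ Icc (0:ℝ) 1, HasDerivAt (ph c th) (p * ff g h c (th x)) x := by
    intro x hx
    have hd : DifferentiableAt ℝ (ph c th) x := ((cdiff.comp thdiff).mul thdiff2) x
    have e := hths x hx
    rw [hu x hx] at e
    have hc0 := (cpos (th x)).ne'
    have hg0 := (gpos (th x)).ne'
    have e2 : deriv (ph c th) x = p * ff g h c (th x) := by
      have e3 : c (th x) * deriv (ph c th) x = h (th x) * (p / g (th x)) := by
        have := sub_eq_zero.1 e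
        exact this
      unfold ff
      field_simp at e3 ⊢
      linear_combination e3
    rw [← e2]; exact hd.hasDerivAt
  have Dnn : 0 ≤ D β := by
    rw [hD]
    refine mul_nonneg ?_ ?_ <;>
      refine intervalIntegral.integral_nonneg hβpos.le (fun t _ => ?_)
    · exact div_nonneg (div_nonneg (mul_pos (cpos _) (gpos _)).le (hnn _)) (Real.sqrt_nonneg _)
    · exact div_nonneg (div_nonneg (cpos _).le (hnn _)) (Real.sqrt_nonneg _)
  have ppos : 0 < p := by
    rcases lt_trichotomy p 0 with hneg | hz | hpos
    · exfalso
      obtain ⟨y, hy, e⟩ := exists_deriv_eq_slope u (zero_lt_one) udiff.continuous.continuousOn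
        udiff.differentiableOn
      have hy' : y ∈ Icc (0:ℝ) 1 := Ioo_subset_Icc_self hy
      rw [hu y hy', u0, u1] at e
      have : p / g (th y) < 0 := div_neg_of_neg_of_pos hneg (gpos _)
      rw [e] at this
      norm_num at this
      linarith
    · exfalso
      obtain ⟨y, hy, e⟩ := exists_deriv_eq_zero (f := th) (zero_lt_one)
        thdiff.continuous.continuousOn (by rw [th0, th1])
      have hy' : y ∈ Icc (0:ℝ) 1 := Ioo_subset_Icc_self hy
      have ph0 : ∀ x ∈ Icc (0:ℝ) 1, ph c th x = 0 := by
        intro x hx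
        have := const_Icc (f := ph c th) (fun z hz' => by simpa [hz] using phd z hz') hx hy'
        rw [this, ph, e, mul_zero]
      have thc : th (1/2) = th 0 := by
        refine const_Icc (f := th) (fun z hz' => ?_) mh m0
        have e1 := ph0 z hz'
        unfold ph at e1
        have e2 : deriv th z = 0 := (mul_eq_zero.1 e1).resolve_left (cpos _).ne'
        rw [← e2]; exact (thdiff z).hasDerivAt
      rw [thc, th0, G0] at Gm
      linarith
    · exact hpos
  have C : Ctx g h c G F th p β θ0 :=
    { gpos := gpos, hnn := hnn, cpos := cpos, gC := gC, hC := hC, cC := cC, hcount := hcount,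
      Gd := Gd, hF := hF, hF' := hF', thC := hthC, ppos := ppos, bpos := hβpos, phd := phd,
      th0 := th0, th1 := th1, G0 := G0, Gm := Gm, hm := hm }
  have hk : ContDiff ℝ 1 (fun s => 1 / g s) :=
    (contDiff_const.div gC (fun x => (gpos x).ne')).of_le (by norm_num)
  have hDJ : ∀ b, D b = Ctx.JJ g h c F (fun _ => 1) b * Ctx.JJ g h c F (fun s => 1 / g s) b := by
    intro b
    rw [hD, Ctx.JJ, Ctx.JJ]
    congr 1
    · congr 1; ext t
      unfold ff
      rw [one_div_div]; ring
    · congr 1; ext t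
      have hg0 := (gpos (F (t - b))).ne'
      unfold ff
      congr 1
      rw [div_div_eq_mul_div]
      field_simp
  rw [C.eigen_iff u hu A hA, C.kernel_iff hk, C.det_deriv hk D hDJ hDdiff]
end
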